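/- Let r, s ≥ 1 be integers. For Weil generic (q,t), i.e. for all (q,t) ∈ C^2 outside some countable union of proper Zariski-closed subsets of C^2 (in particular q, t not roots of unity and q ≠ t), the algebra A_{r,s,q,t} is Cohen–Macaulay, and its Hilbert series equals h_{r+1,s+1}(u) − u^{2(r+1)(s+1)}/((u;u)_{r+1}(u;u)_{s+1}), where h_{r+1,s+1}(u) = (1/(u;u)_{r+1}) · Σ_{i=0}^{s+1} u^{i(r+2)}/(u;u)_i. -/

import Mathlib

open MvPolynomial

set_option synthInstance.maxHeartbeats 1000000
set_option maxHeartbeats 1000000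

noncomputable section

/-- The polynomial ring `ℂ[x, y_1,...,y_r, z_1,...,z_s]`, with `x = X (inl ())`,
`y_j = X (inr (inl j))`, `z_l = X (inr (inr l))`. -/
abbrev Rxrs (r s : ℕ) := MvPolynomial (Unit ⊕ Fin r ⊕ Fin s) ℂ

/-- The degree-`n` homogeneous component of a graded subspace. -/
def compX (r s : ℕ) (M : Submodule ℂ (Rxrs r s)) (n : ℕ) : Submodule ℂ (Rxrs r s) :=
  M ⊓ homogeneousSubmodule (Unit ⊕ Fin r ⊕ Fin s) ℂ n

/-- The Hilbert series of a graded subspace, as a power series over `ℚ`. -/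
def hilbX (r s : ℕ) (M : Submodule ℂ (Rxrs r s)) : PowerSeries ℚ :=
  PowerSeries.mk fun n => (Module.finrank ℂ (compX r s M n) : ℚ)

/-- The `q`-Pochhammer factor `(u;u)_m = (1-u)(1-u^2)⋯(1-u^m)` as a power series. -/
def uu (m : ℕ) : PowerSeries ℚ :=
  ∏ k ∈ Finset.range m, (1 - PowerSeries.X ^ (k + 1))

/-- The generating polynomial
`P_i = ((q^i−t^i)/(1−t^i)) x^i + ((q^i−1)/(1−t^i))(y_1^i+...+y_r^i) + z_1^i+...+z_s^i`. -/
def Pqt (r s : ℕ) (q t : ℂ) (i : ℕ) : Rxrs r s :=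
  C ((q ^ i - t ^ i) / (1 - t ^ i)) * X (Sum.inl ()) ^ i +
    C ((q ^ i - 1) / (1 - t ^ i)) * ∑ j : Fin r, X (Sum.inr (Sum.inl j)) ^ i +
    ∑ l : Fin s, X (Sum.inr (Sum.inr l)) ^ i

/-- The algebra `A_{r,s,q,t}` generated by the `P_i`, `i ≥ 1`. -/
def Aqt (r s : ℕ) (q t : ℂ) : Subalgebra ℂ (Rxrs r s) :=
  Algebra.adjoin ℂ {f : Rxrs r s | ∃ i : ℕ, 1 ≤ i ∧ f = Pqt r s q t i}

/-- The subalgebra `ℂ[P_1,...,P_{r+s+1}]`. -/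
def BAqt (r s : ℕ) (q t : ℂ) : Subalgebra ℂ (Rxrs r s) :=
  Algebra.adjoin ℂ {f : Rxrs r s | ∃ i : ℕ, 1 ≤ i ∧ i ≤ r + s + 1 ∧ f = Pqt r s q t i}

/-- `A_{r,s,q,t}` viewed as a module over `ℂ[P_1,...,P_{r+s+1}]`. -/
def AqtMod (r s : ℕ) (q t : ℂ) : Submodule ↥(BAqt r s q t) (Rxrs r s) :=
  Submodule.span (BAqt r s q t) (Aqt r s q t : Set (Rxrs r s))

namespace AqtCM

/-! ### Graded regular sequences -/

section Abstract

variable {K R R' : Type*} [Field K] [CommRing R] [Algebra K R] [CommRing R'] [Algebra K R']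

/-- The degree-`d` part of `(p_0, ..., p_{j-1}) M`, where `p_i` has degree `i + 1`. -/
def idl (M : ℤ → Submodule K R) (p : ℕ → R) : ℕ → ℤ → Submodule K R
  | 0, _ => ⊥
  | j + 1, d => idl M p j d ⊔ (M (d - (j + 1))).map (LinearMap.mulLeft K (p j))

/-- Multiplication by `p_i` raises the degree by `i + 1`. -/
def Stable (M : ℤ → Submodule K R) (p : ℕ → R) : Prop :=
  ∀ (i : ℕ) d, ∀ v ∈ M d, p i * v ∈ M (d + (i + 1))

/-- `p_0, ..., p_{k-1}` is a regular sequence on `M`. -/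
def Reg (M : ℤ → Submodule K R) (p : ℕ → R) (k : ℕ) : Prop :=
  ∀ j < k, ∀ d, ∀ v ∈ M d, p j * v ∈ idl M p j (d + (j + 1)) → v ∈ idl M p j d

/-- `M / (p_0, ..., p_{k-1}) M` vanishes in large degrees. -/
def FinQ (M : ℤ → Submodule K R) (p : ℕ → R) (k : ℕ) : Prop :=
  ∃ d₀ : ℤ, ∀ d ≥ d₀, M d ≤ idl M p k d

variable {M M' L : ℤ → Submodule K R} {N : ℤ → Submodule K R'} {p : ℕ → R} {p' : ℕ → R'}

theorem mem_idl_succ {j : ℕ} {d : ℤ} {v : R} :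
    v ∈ idl M p (j + 1) d ↔
      ∃ a ∈ idl M p j d, ∃ w ∈ M (d - (j + 1)), v = a + p j * w := by
  simp only [idl, Submodule.mem_sup, Submodule.mem_map, LinearMap.mulLeft_apply]
  constructor
  · rintro ⟨a, ha, _, ⟨w, hw, rfl⟩, rfl⟩
    exact ⟨a, ha, w, hw, rfl⟩
  · rintro ⟨a, ha, w, hw, rfl⟩
    exact ⟨a, ha, _, ⟨w, hw, rfl⟩, rfl⟩

theorem idl_le_succ (j : ℕ) (d : ℤ) : idl M p j d ≤ idl M p (j + 1) d := le_sup_left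

theorem mul_mem_idl_succ {j : ℕ} {d : ℤ} {w : R} (hw : w ∈ M (d - (j + 1))) :
    p j * w ∈ idl M p (j + 1) d :=
  mem_idl_succ.2 ⟨0, zero_mem _, w, hw, by simp⟩

theorem idl_le_of_le {i j : ℕ} (h : i ≤ j) (d : ℤ) : idl M p i d ≤ idl M p j d :=
  monotone_nat_of_le_succ (f := fun j => idl M p j d) (fun j => idl_le_succ j d) h

theorem idl_map (φ : R →ₗ[K] R') (e : ℤ) (hM : ∀ d, ∀ v ∈ M d, φ v ∈ N (d + e))
    (hp : ∀ i d, ∀ v ∈ M d, φ (p i * v) = p' i * φ v) (j : ℕ) (d : ℤ) (v : R)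
    (hv : v ∈ idl M p j d) : φ v ∈ idl N p' j (d + e) := by
  induction j generalizing v with
  | zero => simp_all [idl]
  | succ j ih =>
    obtain ⟨a, ha, w, hw, rfl⟩ := mem_idl_succ.1 hv
    refine mem_idl_succ.2 ⟨φ a, ih a ha, φ w, ?_, ?_⟩
    · have := hM _ _ hw
      rwa [show d - (j + 1) + e = d + e - (j + 1) by ring] at this
    · rw [map_add, hp _ _ _ hw]

theorem idl_map_zero (φ : R →ₗ[K] R') (hM : ∀ d, ∀ v ∈ M d, φ v ∈ N d)
    (hp : ∀ i d, ∀ v ∈ M d, φ (p i * v) = p' i * φ v) (j : ℕ) (d : ℤ) (v : R)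
    (hv : v ∈ idl M p j d) : φ v ∈ idl N p' j d := by
  simpa using idl_map (N := N) φ 0 (by simpa using hM) hp j d v hv

theorem idl_mono (h : ∀ d, M d ≤ L d) (j : ℕ) (d : ℤ) : idl M p j d ≤ idl L p j d := fun v hv =>
  idl_map_zero (N := L) (p' := p) LinearMap.id (fun d _ hv => h d hv) (fun _ _ _ _ => rfl) j d v hv

theorem mul_mem_idl (x : R) (e : ℤ) (hM : ∀ d, ∀ v ∈ M d, x * v ∈ M (d + e)) {j : ℕ} {d : ℤ}
    {v : R} (hv : v ∈ idl M p j d) : x * v ∈ idl M p j (d + e) :=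
  idl_map (LinearMap.mulLeft K x) e hM (fun i _ v _ => by simp [mul_left_comm]) j d v hv

theorem Stable.mul_mem_idl (h : Stable M p) (i : ℕ) {j : ℕ} {d : ℤ} {v : R}
    (hv : v ∈ idl M p j d) : p i * v ∈ idl M p j (d + (i + 1)) :=
  AqtCM.mul_mem_idl _ _ (h i) hv

theorem Stable.mul_mem_sub (h : Stable M p) {i : ℕ} {d : ℤ} {v : R}
    (hv : v ∈ M (d - (i + 1))) : p i * v ∈ M d := by
  have := h i _ v hv
  rwa [sub_add_cancel] at this

theorem Stable.mul_mem_idl_sub (h : Stable M p) (i : ℕ) {j : ℕ} {d : ℤ} {v : R}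
    (hv : v ∈ idl M p j (d - (i + 1))) : p i * v ∈ idl M p j d := by
  have := h.mul_mem_idl i hv
  rwa [sub_add_cancel] at this

theorem Stable.idl_le (h : Stable M p) (j : ℕ) (d : ℤ) : idl M p j d ≤ M d := by
  induction j with
  | zero => simp [idl]
  | succ j ih =>
    intro v hv
    obtain ⟨a, ha, w, hw, rfl⟩ := mem_idl_succ.1 hv
    exact add_mem (ih ha) (h.mul_mem_sub hw)

theorem Reg.mem_sub {k : ℕ} (h : Reg M p k) {j : ℕ} (hj : j < k) {d : ℤ} {v : R}
    (hv : v ∈ M (d - (j + 1))) (hv' : p j * v ∈ idl M p j d) : v ∈ idl M p j (d - (j + 1)) :=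
  h j hj _ v hv (by rwa [sub_add_cancel])

theorem Reg.mono {k l : ℕ} (h : Reg M p k) (hl : l ≤ k) : Reg M p l :=
  fun j hj => h j (hj.trans_le hl)

theorem idl_lift (φ : R →ₗ[K] R') (hM : ∀ d, ∀ w ∈ N d, ∃ v ∈ M d, φ v = w)
    (hp : ∀ i d, ∀ v ∈ M d, φ (p i * v) = p' i * φ v) (j : ℕ) (d : ℤ) (w : R')
    (hw : w ∈ idl N p' j d) : ∃ v ∈ idl M p j d, φ v = w := by
  induction j generalizing w with
  | zero => exact ⟨0, zero_mem _, by simp_all [idl]⟩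
  | succ j ih =>
    obtain ⟨a, ha, u, hu, rfl⟩ := mem_idl_succ.1 hw
    obtain ⟨a', ha', rfl⟩ := ih a ha
    obtain ⟨w', hw', rfl⟩ := hM _ _ hu
    exact ⟨a' + p j * w', mem_idl_succ.2 ⟨a', ha', w', hw', rfl⟩, by rw [map_add, hp _ _ _ hw']⟩

/-- The kernel of a degree-preserving surjection `M → N` inherits a regular sequence of length
`k + 1` from `M` if `N` has a regular sequence of length `k`. -/
theorem Reg.ker {k : ℕ} (φ : R →ₗ[K] R') (hMN : ∀ d, ∀ v ∈ M d, φ v ∈ N d)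
    (hNM : ∀ d, ∀ w ∈ N d, ∃ v ∈ M d, φ v = w)
    (hp : ∀ i d, ∀ v ∈ M d, φ (p i * v) = p' i * φ v) (hs : Stable M p)
    (hM : Reg M p (k + 1)) (hN : Reg N p' k) :
    Reg (fun d => M d ⊓ LinearMap.ker φ) p (k + 1) := by
  have key : ∀ j ≤ k, ∀ d, ∀ v ∈ idl M p j d, φ v = 0 →
      v ∈ idl (fun d => M d ⊓ LinearMap.ker φ) p j d := by
    intro j
    induction j with
    | zero => intro _ d v hv _; simpa [idl] using hv
    | succ j ih =>
      intro hj d v hv h0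
      obtain ⟨a, ha, w, hw, rfl⟩ := mem_idl_succ.1 hv
      rw [map_add, hp _ _ _ hw] at h0
      have h1 : p' j * φ w ∈ idl N p' j d := by
        rw [eq_neg_of_add_eq_zero_right h0]
        exact neg_mem (idl_map_zero φ hMN hp _ _ _ ha)
      obtain ⟨w', hw', hww⟩ := idl_lift φ hNM hp _ _ _ (hN.mem_sub hj (hMN _ _ hw) h1)
      have hw'M := hs.idl_le _ _ hw'
      refine mem_idl_succ.2 ⟨a + p j * w', ih (by omega) d _ (add_mem ha (hs.mul_mem_idl_sub j hw'))
        ?_, w - w', ⟨sub_mem hw hw'M, ?_⟩, by ring⟩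
      · rw [map_add, hp _ _ _ hw'M, hww, h0]
      · simp [hww]
  intro j hj d v hv h
  exact key j (by omega) d v (hM j hj d v hv.1 (idl_mono (fun _ => inf_le_left) _ _ h)) hv.2

/-- A graded summand inherits regular sequences. -/
theorem Reg.summand {k : ℕ} (π : R →ₗ[K] R) (hLM : ∀ d, L d ≤ M d)
    (hπ : ∀ d, ∀ v ∈ M d, π v ∈ L d) (hid : ∀ d, ∀ v ∈ L d, π v = v)
    (hp : ∀ i d, ∀ v ∈ M d, π (p i * v) = p i * π v) (hM : Reg M p k) : Reg L p k := by
  intro j hj d v hv h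
  have := hM j hj d v (hLM _ hv) (idl_mono hLM _ _ h)
  rw [← hid d v hv]
  exact idl_map_zero π hπ hp _ _ _ this

theorem Reg.transport {k : ℕ} (φ : R →ₗ[K] R') (hφ : Function.Injective φ)
    (hMN : ∀ d, ∀ v ∈ M d, φ v ∈ N d) (hNM : ∀ d, ∀ w ∈ N d, ∃ v ∈ M d, φ v = w)
    (hp : ∀ i d, ∀ v ∈ M d, φ (p i * v) = p' i * φ v) (hM : Reg M p k) : Reg N p' k := by
  intro j hj d w hw h
  obtain ⟨v, hv, rfl⟩ := hNM d w hw
  rw [← hp _ _ _ hv] at h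
  obtain ⟨u, hu, huv⟩ := idl_lift φ hNM hp _ _ _ h
  rw [hφ huv] at hu
  exact idl_map_zero φ hMN hp _ _ _ (hM j hj d v hv hu)

theorem FinQ.map {k : ℕ} (φ : R →ₗ[K] R')
    (hMN : ∀ d, ∀ v ∈ M d, φ v ∈ N d) (hNM : ∀ d, ∀ w ∈ N d, ∃ v ∈ M d, φ v = w)
    (hp : ∀ i d, ∀ v ∈ M d, φ (p i * v) = p' i * φ v) (hM : FinQ M p k) : FinQ N p' k := by
  obtain ⟨d₀, h⟩ := hM
  refine ⟨d₀, fun d hd w hw => ?_⟩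
  obtain ⟨v, hv, rfl⟩ := hNM d w hw
  exact idl_map_zero φ hMN hp _ _ _ (h d hd hv)

theorem int_induction {P : ℤ → Prop} (h0 : ∀ d < 0, P d) (h : ∀ d, 0 ≤ d → (∀ e < d, P e) → P d)
    (d : ℤ) : P d := by
  suffices ∀ n : ℕ, ∀ d < (n : ℤ), P d from this (d.toNat + 1) d (by omega)
  intro n
  induction n with
  | zero => intro d hd; exact h0 d (by simpa using hd)
  | succ n ih =>
    intro d hd
    by_cases hd0 : d < 0
    · exact h0 d hd0
    · exact h d (by omega) fun e he => ih e (by push_cast at hd; omega)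

/-- If multiplication by `D` is injective modulo `(p_0, ..., p_{N-1})` then it is so modulo each
`(p_0, ..., p_{j-1})` with `j ≤ N`. -/
theorem Reg.descend {k : ℕ} (hM : Reg M p k) (hs : Stable M p) (h0 : ∀ d < 0, M d = ⊥)
    (D : R) (e : ℤ) (hD : ∀ d, ∀ v ∈ M d, D * v ∈ M (d + e))
    (h : ∀ d, ∀ v ∈ M d, D * v ∈ idl M p k (d + e) → v ∈ idl M p k d) :
    ∀ j ≤ k, ∀ d, ∀ v ∈ M d, D * v ∈ idl M p j (d + e) → v ∈ idl M p j d := by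
  intro j hj
  induction hj using Nat.decreasingInduction with
  | self => exact h
  | of_succ j hj ih =>
    intro d
    induction d using int_induction with
    | h0 d hd =>
      intro v hv _
      rw [h0 d hd, Submodule.mem_bot] at hv
      simp [hv]
    | h d hd ihd =>
      intro v hv hDv
      obtain ⟨a, ha, w, hw, rfl⟩ := mem_idl_succ.1 (ih d v hv (idl_le_succ _ _ hDv))
      have h1 : p j * (D * w) ∈ idl M p j (d + e) := by
        have := sub_mem hDv (AqtCM.mul_mem_idl D e hD ha)
        rwa [show D * (a + p j * w) - D * a = p j * (D * w) by ring] at this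
      have e1 : d - (j + 1) + e = d + e - (j + 1) := by ring
      have h2 := hD _ _ hw
      rw [e1] at h2
      have h3 := hM.mem_sub hj h2 h1
      rw [← e1] at h3
      exact add_mem ha (hs.mul_mem_idl_sub j (ihd _ (by omega) w hw h3))

/-- Cokernel of `D · S → Λ`. -/
theorem Reg.coker {k : ℕ} {Λ S : ℤ → Submodule K R} (ρ : R →ₗ[K] R') (D : R) (e : ℤ)
    (hΛS : ∀ d, Λ d ≤ S d) (hDS : ∀ d, ∀ v ∈ S (d - e), D * v ∈ Λ d)
    (hρD : ∀ d, ∀ v ∈ S d, ρ (D * v) = 0)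
    (hker : ∀ d, ∀ v ∈ Λ d, ρ v = 0 → ∃ s ∈ S (d - e), v = D * s)
    (hD : ∀ j ≤ k, ∀ d, ∀ v ∈ S d, D * v ∈ idl S p j (d + e) → v ∈ idl S p j d)
    (hΛN : ∀ d, ∀ v ∈ Λ d, ρ v ∈ N d) (hNΛ : ∀ d, ∀ w ∈ N d, ∃ v ∈ Λ d, ρ v = w)
    (hp : ∀ i d, ∀ v ∈ Λ d, ρ (p i * v) = p' i * ρ v)
    (hs : Stable Λ p) (hΛ : Reg Λ p k) : Reg N p' k := by
  intro j hj d w hw h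
  obtain ⟨u, hu, rfl⟩ := hNΛ d w hw
  rw [← hp _ _ _ hu] at h
  obtain ⟨a, ha, hau⟩ := idl_lift ρ hNΛ hp _ _ _ h
  obtain ⟨s, hsS, hse⟩ := hker _ (p j * u - a) (sub_mem (hs _ _ _ hu) (hs.idl_le _ _ ha))
    (by rw [map_sub, hau, sub_self])
  have h1 : D * s ∈ idl Λ p (j + 1) (d + (j + 1)) := by
    rw [← hse]
    refine sub_mem (mul_mem_idl_succ ?_) (idl_le_succ _ _ ha)
    rwa [add_sub_cancel_right]
  have h2 := hD (j + 1) hj (d + (j + 1) - e) s hsS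
    (by rw [sub_add_cancel]; exact idl_mono hΛS _ _ h1)
  obtain ⟨b, hb, c, hc, rfl⟩ := mem_idl_succ.1 h2
  have e1 : d + (j + 1) - e - (j + 1) = d - e := by ring
  rw [e1] at hc
  have h3 : D * b ∈ idl Λ p j (d + (j + 1)) := by
    have := idl_map (N := Λ) (p' := p) (LinearMap.mulLeft K D) e (M := S) (p := p)
      (fun d v hv => hDS _ v (by rwa [add_sub_cancel_right]))
      (fun i _ v _ => by simp [mul_left_comm]) j _ b hb
    rwa [sub_add_cancel] at this
  have h4 : u - D * c ∈ idl Λ p j d := by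
    refine hΛ j hj d _ (sub_mem hu (hDS _ c hc)) ?_
    have : p j * (u - D * c) = a + D * b := by linear_combination hse
    rw [this]
    exact add_mem ha h3
  have h5 := idl_map_zero ρ hΛN hp _ _ _ h4
  rwa [map_sub, hρD _ c hc, sub_zero] at h5

section Bijective

variable {G I : ℤ → Submodule K R}

/-- The graded pieces of the quotient `G / I`. -/
abbrev quo (G I : ℤ → Submodule K R) (d : ℤ) : Type _ := (G d) ⧸ ((I d).comap (G d).subtype)

/-- Multiplication on graded pieces of `G / I`. -/
def quoMul (x : R) (e : ℤ) (hG : ∀ d, ∀ v ∈ G d, x * v ∈ G (d + e))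
    (hI : ∀ d, ∀ v ∈ I d, x * v ∈ I (d + e)) (d : ℤ) : quo G I d →ₗ[K] quo G I (d + e) :=
  Submodule.mapQ _ _ ((LinearMap.mulLeft K x).restrict (hG d)) fun v hv => hI d v hv

theorem quoMul_mk (x : R) (e : ℤ) (hG : ∀ d, ∀ v ∈ G d, x * v ∈ G (d + e))
    (hI : ∀ d, ∀ v ∈ I d, x * v ∈ I (d + e)) (d : ℤ) (v : G d) :
    quoMul x e hG hI d (Submodule.Quotient.mk v) =
      Submodule.Quotient.mk ⟨x * v.1, hG d v.1 v.2⟩ := rfl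

theorem quoMul_injective_iff (x : R) (e : ℤ) (hG : ∀ d, ∀ v ∈ G d, x * v ∈ G (d + e))
    (hI : ∀ d, ∀ v ∈ I d, x * v ∈ I (d + e)) (d : ℤ) :
    Function.Injective (quoMul x e hG hI d) ↔ ∀ v ∈ G d, x * v ∈ I (d + e) → v ∈ I d := by
  rw [injective_iff_map_eq_zero]
  constructor
  · intro h v hv hx
    have := h (Submodule.Quotient.mk ⟨v, hv⟩) (by
      rw [quoMul_mk, Submodule.Quotient.mk_eq_zero]; exact hx)
    rw [Submodule.Quotient.mk_eq_zero] at this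
    exact this
  · intro h v hv
    obtain ⟨v, rfl⟩ := Submodule.Quotient.mk_surjective _ v
    rw [quoMul_mk, Submodule.Quotient.mk_eq_zero] at hv
    rw [Submodule.Quotient.mk_eq_zero]
    exact h v.1 v.2 hv

theorem quoMul_surjective (x : R) (e : ℤ) (hG : ∀ d, ∀ v ∈ G d, x * v ∈ G (d + e))
    (hI : ∀ d, ∀ v ∈ I d, x * v ∈ I (d + e)) (d : ℤ)
    (h : ∀ v ∈ G (d + e), ∃ w ∈ G d, v - x * w ∈ I (d + e)) :
    Function.Surjective (quoMul x e hG hI d) := by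
  intro v
  obtain ⟨v, rfl⟩ := Submodule.Quotient.mk_surjective _ v
  obtain ⟨w, hw, hvw⟩ := h v.1 v.2
  refine ⟨Submodule.Quotient.mk ⟨w, hw⟩, ?_⟩
  rw [quoMul_mk, eq_comm, Submodule.Quotient.eq]
  exact hvw

/-- If some `x` is injective on a locally finite graded quotient and bijective in large degrees,
then any `y` which is surjective in large degrees is injective. -/
theorem injective_of_eventually_surjective [∀ d, FiniteDimensional K (G d)]
    (x : R) (b : ℕ) (hb : 1 ≤ b)
    (hxG : ∀ d, ∀ v ∈ G d, x * v ∈ G (d + b)) (hxI : ∀ d, ∀ v ∈ I d, x * v ∈ I (d + b))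
    (hxinj : ∀ d, ∀ v ∈ G d, x * v ∈ I (d + b) → v ∈ I d)
    (y : R) (a : ℕ)
    (hyG : ∀ d, ∀ v ∈ G d, y * v ∈ G (d + a)) (hyI : ∀ d, ∀ v ∈ I d, y * v ∈ I (d + a))
    (d₀ : ℤ)
    (hxsurj : ∀ d ≥ d₀, ∀ v ∈ G (d + b), ∃ w ∈ G d, v - x * w ∈ I (d + b))
    (hysurj : ∀ d ≥ d₀, ∀ v ∈ G (d + a), ∃ w ∈ G d, v - y * w ∈ I (d + a)) :
    ∀ d, ∀ v ∈ G d, y * v ∈ I (d + a) → v ∈ I d := by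
  let f : ℤ → ℕ := fun d => Module.finrank K (quo G I d)
  have hx : ∀ d ≥ d₀, f (d + b) = f d := fun d hd => by
    refine (LinearEquiv.finrank_eq (LinearEquiv.ofBijective (quoMul x b hxG hxI d)
      ⟨(quoMul_injective_iff ..).2 (hxinj d), quoMul_surjective _ _ _ _ _ (hxsurj d hd)⟩)).symm
  have hy : ∀ d ≥ d₀, f (d + a) ≤ f d := fun d hd =>
    LinearMap.finrank_le_finrank_of_surjective
      (quoMul_surjective y a hyG hyI _ (hysurj d hd))
  have hxn : ∀ (n : ℕ), ∀ d ≥ d₀, f (d + n * b) = f d := by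
    intro n d hd
    induction n with
    | zero => simp
    | succ n ih =>
      rw [← ih, ← hx (d + n * b) (by have : (0:ℤ) ≤ n * b := by positivity
                                     omega)]
      rw [Nat.cast_succ, add_mul, one_mul, add_assoc]
  have hyn : ∀ (n : ℕ), ∀ d ≥ d₀, f (d + (n + 1 : ℕ) * a) ≤ f (d + a) := by
    intro n d hd
    induction n with
    | zero => simp
    | succ n ih =>
      refine le_trans ?_ ih
      have := hy (d + (n + 1 : ℕ) * a) (by have : (0:ℤ) ≤ (n + 1 : ℕ) * a := by positivity
                                           omega)
      rwa [show d + (n + 1 + 1 : ℕ) * (a : ℤ) = d + (n + 1 : ℕ) * a + a by push_cast; ring]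
  have large : ∀ d ≥ d₀, ∀ v ∈ G d, y * v ∈ I (d + a) → v ∈ I d := by
    intro d hd
    rw [← quoMul_injective_iff y a hyG hyI,
      LinearMap.injective_iff_surjective_of_finrank_eq_finrank]
    · exact quoMul_surjective y a hyG hyI _ (hysurj d hd)
    · refine le_antisymm ?_ (hy d hd)
      change f d ≤ f (d + a)
      rw [← hxn a d hd]
      have := hyn (b - 1) d hd
      rw [Nat.sub_add_cancel hb] at this
      rwa [mul_comm]
  have climb : ∀ (n : ℕ), ∀ d ≥ d₀ - n, ∀ v ∈ G d, y * v ∈ I (d + a) → v ∈ I d := by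
    intro n
    induction n with
    | zero => simpa using large
    | succ n ih =>
      intro d hd v hv hyv
      refine hxinj d v hv (ih (d + b) (by push_cast at hd; omega) _ (hxG d v hv) ?_)
      have := hxI _ _ hyv
      rw [mul_left_comm] at this
      rwa [show d + b + a = d + a + b by ring]
  intro d
  exact climb (d₀ - d).toNat d (by omega)

end Bijective

/-- A graded algebra extended by one variable `x`. -/
theorem Reg.add_variable {k : ℕ} {q : ℕ → R} (ε : R →ₗ[K] R) (x : R)
    (hx : ∀ v, x * v = 0 → v = 0)
    (hεM : ∀ d, ∀ v ∈ M' d, ε v ∈ M d) (hMε : ∀ d, ∀ w ∈ M d, ∃ v ∈ M' d, ε v = w)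
    (hp : ∀ i d, ∀ v ∈ M' d, ε (q i * v) = p i * ε v) (hεx : ∀ v, ε (x * v) = 0)
    (hker : ∀ d, ∀ v ∈ M' d, ε v = 0 → ∃ w ∈ M' (d - 1), v = x * w)
    (hxM : ∀ d, ∀ v ∈ M' d, x * v ∈ M' (d + 1)) (h0 : ∀ d < 0, M' d = ⊥)
    [∀ d, FiniteDimensional K (M' d)] (hs : Stable M' q)
    (hM : Reg M p k) (hF : FinQ M p k) (hF' : FinQ M' q (k + 1)) : Reg M' q (k + 1) := by
  have hxinj : ∀ j ≤ k, ∀ d, ∀ v ∈ M' d, x * v ∈ idl M' q j (d + 1) → v ∈ idl M' q j d := by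
    intro j
    induction j with
    | zero => intro _ d v _ h; exact hx v h
    | succ j ih =>
      intro hj d v hv h
      obtain ⟨a, ha, w, hw, hxv⟩ := mem_idl_succ.1 h
      have h1 : p j * ε w ∈ idl M p j (d + 1) := by
        have := congrArg ε hxv
        rw [hεx, map_add, hp _ _ _ hw] at this
        rw [eq_neg_of_add_eq_zero_right this.symm]
        exact neg_mem (idl_map_zero ε hεM hp _ _ _ ha)
      obtain ⟨w', hw', hww⟩ := idl_lift ε hMε hp _ _ _ (hM.mem_sub hj (hεM _ _ hw) h1)
      obtain ⟨u, hu, hwu⟩ := hker _ (w - w') (sub_mem hw (hs.idl_le _ _ hw')) (by simp [hww])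
      rw [show d + 1 - (j + 1) - 1 = d - (j + 1) by ring] at hu
      have h2 := ih (by omega) d (v - q j * u) (sub_mem hv (hs.mul_mem_sub hu)) (by
        have : x * (v - q j * u) = a + q j * w' := by linear_combination hxv + q j * hwu
        rw [this]
        exact add_mem ha (hs.mul_mem_idl_sub j hw'))
      exact mem_idl_succ.2 ⟨_, h2, u, hu, by ring⟩
  have hlt : Reg M' q k := by
    intro j hj d
    induction d using int_induction with
    | h0 d hd => intro v hv _; rw [h0 d hd, Submodule.mem_bot] at hv; simp [hv]
    | h d hd ih =>
      intro v hv h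
      have h1 := idl_map_zero ε hεM hp _ _ _ h
      rw [hp _ _ _ hv] at h1
      obtain ⟨v', hv', hvv⟩ := idl_lift ε hMε hp _ _ _ (hM j hj d _ (hεM _ _ hv) h1)
      obtain ⟨u, hu, hvu⟩ := hker _ (v - v') (sub_mem hv (hs.idl_le _ _ hv')) (by simp [hvv])
      have h2 : u ∈ idl M' q j (d - 1) := by
        refine ih (d - 1) (by omega) u hu (hxinj j hj.le _ _ (hs _ _ _ hu) ?_)
        rw [show d - 1 + (j + 1) + 1 = d + (j + 1) by ring]
        have : x * (q j * u) = q j * v - q j * v' := by linear_combination - q j * hvu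
        rw [this]
        exact sub_mem h (hs.mul_mem_idl j hv')
      rw [show v = v' + x * u by linear_combination hvu]
      have h3 := mul_mem_idl x 1 hxM h2
      rw [sub_add_cancel] at h3
      exact add_mem hv' h3
  intro j hj
  rcases Nat.lt_succ_iff_lt_or_eq.1 hj with hj | rfl
  · exact hlt j hj
  obtain ⟨d₁, h1⟩ := hF
  obtain ⟨d₂, h2⟩ := hF'
  have := injective_of_eventually_surjective (G := M') (I := fun d => idl M' q j d) x 1 le_rfl
    (by simpa using hxM) (fun d v hv => by simpa using mul_mem_idl x 1 hxM hv)
    (by simpa using hxinj j le_rfl) (q j) (j + 1) (by simpa using hs j)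
    (fun d v hv => by simpa using hs.mul_mem_idl j hv) (max d₁ d₂)
    (fun d hd v hv => by
      obtain ⟨v', hv', hvv⟩ := idl_lift ε hMε hp _ _ _ (h1 (d + 1) (by
        have := le_trans (le_max_left d₁ d₂) hd
        omega) (hεM _ _ hv))
      obtain ⟨u, hu, hvu⟩ := hker _ (v - v') (sub_mem hv (hs.idl_le _ _ hv')) (by simp [hvv])
      simp only [Nat.cast_one, add_sub_cancel_right] at hu
      refine ⟨u, hu, ?_⟩
      rw [show v - x * u = v' by linear_combination hvu]
      exact hv')
    (fun d hd v hv => by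
      obtain ⟨a, ha, w, hw, rfl⟩ := mem_idl_succ.1 (h2 (d + (j + 1 : ℕ)) (by
        have := le_trans (le_max_right d₁ d₂) hd
        omega) hv)
      push_cast at hw
      rw [add_sub_cancel_right] at hw
      exact ⟨w, hw, by simpa using ha⟩)
  simpa using this

end Abstract

/-! ### Graded subspaces of polynomial rings -/

section Graded

variable {K σ : Type*} [Field K]

/-- Homogeneous polynomials of integer degree `d`. -/
def hs (K σ : Type*) [Field K] (d : ℤ) : Submodule K (MvPolynomial σ K) :=
  weightedHomogeneousSubmodule K (fun _ => (1 : ℤ)) d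

/-- The homogeneous component of degree `d`. -/
def comp (d : ℤ) : MvPolynomial σ K →ₗ[K] MvPolynomial σ K :=
  weightedHomogeneousComponent (fun _ => (1 : ℤ)) d

/-- The degree-`d` part of a subspace. -/
def gr (W : Submodule K (MvPolynomial σ K)) (d : ℤ) : Submodule K (MvPolynomial σ K) :=
  W ⊓ hs K σ d

/-- A subspace is graded if it contains the homogeneous components of its elements. -/
def Grd (W : Submodule K (MvPolynomial σ K)) : Prop := ∀ d, ∀ v ∈ W, comp d v ∈ W

theorem comp_mem_hs (d : ℤ) (v : MvPolynomial σ K) : comp d v ∈ hs K σ d :=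
  weightedHomogeneousComponent_mem _ _ _

theorem comp_of_mem {d : ℤ} {v : MvPolynomial σ K} (h : v ∈ hs K σ d) : comp d v = v := by
  have := weightedHomogeneousComponent_of_mem (w := fun _ : σ => (1 : ℤ)) (m := d) (n := d) h
  rw [comp, this]
  simp

theorem comp_of_ne {d e : ℤ} {v : MvPolynomial σ K} (h : v ∈ hs K σ e) (hne : d ≠ e) :
    comp d v = 0 := by
  have := weightedHomogeneousComponent_of_mem (w := fun _ : σ => (1 : ℤ)) (m := d) (n := e) h
  rw [comp, this, if_neg hne]

theorem comp_finite (v : MvPolynomial σ K) : (Function.support fun d : ℤ => comp d v).Finite :=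
  weightedHomogeneousComponent_finsupp v

theorem sum_comp (v : MvPolynomial σ K) : ∑ᶠ d : ℤ, comp d v = v :=
  sum_weightedHomogeneousComponent _ v

theorem mem_of_comp {W : Submodule K (MvPolynomial σ K)} {v : MvPolynomial σ K}
    (h : ∀ d, comp d v ∈ W) : v ∈ W := by
  rw [← sum_comp v, finsum_eq_sum _ (comp_finite v)]
  exact sum_mem fun d _ => h d

theorem eq_zero_of_comp {v : MvPolynomial σ K} (h : ∀ d, comp d v = 0) : v = 0 := by
  rw [← Submodule.mem_bot K]
  exact mem_of_comp fun d => by simp [h d]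

theorem exists_comp_bound (v : MvPolynomial σ K) : ∃ D : ℤ, ∀ d ≥ D, comp d v = 0 := by
  obtain ⟨D, hD⟩ := (comp_finite v).bddAbove
  refine ⟨D + 1, fun d hd => ?_⟩
  by_contra h
  have := hD h
  omega

theorem one_mem_hs : (1 : MvPolynomial σ K) ∈ hs K σ 0 := isWeightedHomogeneous_one _ _

theorem C_mem_hs (c : K) : (C c : MvPolynomial σ K) ∈ hs K σ 0 := isWeightedHomogeneous_C _ _

theorem X_mem_hs (v : σ) : (X v : MvPolynomial σ K) ∈ hs K σ 1 := isWeightedHomogeneous_X _ _ _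

theorem mul_mem_hs {d e : ℤ} {u v : MvPolynomial σ K} (hu : u ∈ hs K σ d) (hv : v ∈ hs K σ e) :
    u * v ∈ hs K σ (d + e) := IsWeightedHomogeneous.mul hu hv

theorem pow_mem_hs {d : ℤ} {u : MvPolynomial σ K} (hu : u ∈ hs K σ d) (n : ℕ) :
    u ^ n ∈ hs K σ (n * d) := by
  have : IsWeightedHomogeneous (fun _ => (1 : ℤ)) (u ^ n) (n • d) := IsWeightedHomogeneous.pow hu n
  rwa [nsmul_eq_mul] at this

theorem Xpow_mem_hs (v : σ) (n : ℕ) : (X v ^ n : MvPolynomial σ K) ∈ hs K σ n := by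
  simpa using pow_mem_hs (X_mem_hs (K := K) v) n

theorem C_mul_mem_hs {d : ℤ} (c : K) {v : MvPolynomial σ K} (hv : v ∈ hs K σ d) :
    C c * v ∈ hs K σ d := by
  rw [← smul_eq_C_mul]
  exact Submodule.smul_mem _ _ hv

theorem mem_hs_iff_natCast {d : ℕ} {v : MvPolynomial σ K} :
    v ∈ hs K σ d ↔ v ∈ homogeneousSubmodule σ K d := by
  simp only [hs, mem_weightedHomogeneousSubmodule, mem_homogeneousSubmodule, IsHomogeneous,
    IsWeightedHomogeneous, Finsupp.weight_apply, Finsupp.sum]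
  refine forall₂_congr fun c _ => ?_
  simp only [Pi.one_apply, smul_eq_mul, mul_one, nsmul_eq_mul]
  norm_cast

theorem hs_neg {d : ℤ} (hd : d < 0) : hs K σ d = ⊥ := by
  refine (Submodule.eq_bot_iff _).2 fun v hv => ?_
  ext c
  by_contra h
  have := hv (d := c) h
  rw [Finsupp.weight_apply, Finsupp.sum] at this
  have h2 : 0 ≤ ∑ a ∈ c.support, c a • (1 : ℤ) := Finset.sum_nonneg fun _ _ => by positivity
  omega

theorem gr_neg (W : Submodule K (MvPolynomial σ K)) {d : ℤ} (hd : d < 0) : gr W d = ⊥ := by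
  rw [gr, hs_neg hd, inf_bot_eq]

theorem comp_mul {e : ℤ} {p : MvPolynomial σ K} (hp : p ∈ hs K σ e) (d : ℤ)
    (v : MvPolynomial σ K) : comp (d + e) (p * v) = p * comp d v := by
  conv_lhs => rw [← sum_comp v, finsum_eq_sum _ (comp_finite v)]
  rw [Finset.mul_sum, map_sum]
  rw [Finset.sum_eq_single d]
  · exact comp_of_mem (by rw [add_comm]; exact mul_mem_hs hp (comp_mem_hs d v))
  · intro b _ hb
    refine comp_of_ne (e := e + b) (mul_mem_hs hp (comp_mem_hs b v)) (by omega)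
  · intro h
    have : comp d v = 0 := by simpa using h
    simp [this]

theorem comp_mul' {e : ℤ} {p : MvPolynomial σ K} (hp : p ∈ hs K σ e) (d : ℤ)
    (v : MvPolynomial σ K) : comp d (p * v) = p * comp (d - e) v := by
  rw [← comp_mul hp, sub_add_cancel]

theorem Grd.comp_mem {W : Submodule K (MvPolynomial σ K)} (h : Grd W) {d : ℤ}
    {v : MvPolynomial σ K} (hv : v ∈ W) : comp d v ∈ gr W d := ⟨h d v hv, comp_mem_hs d v⟩

theorem stable_gr {W : Submodule K (MvPolynomial σ K)} {p : ℕ → MvPolynomial σ K}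
    (hp : ∀ i : ℕ, p i ∈ hs K σ (i + 1)) (hW : ∀ i, ∀ v ∈ W, p i * v ∈ W) : Stable (gr W) p :=
  fun i d v hv => ⟨hW i v hv.1, by rw [add_comm]; exact mul_mem_hs (hp i) hv.2⟩

/-- Subalgebras generated by homogeneous elements are graded. -/
theorem grd_adjoin {s : Set (MvPolynomial σ K)} (hs : ∀ v ∈ s, ∃ e : ℤ, v ∈ hs K σ e) :
    Grd (Subalgebra.toSubmodule (Algebra.adjoin K s)) := by
  intro d v hv
  rw [Subalgebra.mem_toSubmodule] at hv ⊢
  have h1 : ∀ d, comp d (1 : MvPolynomial σ K) ∈ Algebra.adjoin K s := fun d => by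
    by_cases h : d = 0
    · rw [h, comp_of_mem one_mem_hs]; exact one_mem _
    · rw [comp_of_ne one_mem_hs h]; exact zero_mem _
  have key : ∀ w : MvPolynomial σ K, (∀ d, comp d w ∈ Algebra.adjoin K s) →
      ∀ d, comp d (v * w) ∈ Algebra.adjoin K s := by
    induction hv using Algebra.adjoin_induction with
    | mem x hx =>
      obtain ⟨e, he⟩ := hs x hx
      intro w hw d
      rw [comp_mul' he]
      exact mul_mem (Algebra.subset_adjoin hx) (hw _)
    | algebraMap r =>
      intro w hw d
      rw [← Algebra.smul_def, map_smul]
      exact Subalgebra.smul_mem _ (hw d) r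
    | add x y _ _ hx hy =>
      intro w hw d
      rw [add_mul, map_add]
      exact add_mem (hx w hw d) (hy w hw d)
    | mul x y _ _ hx hy =>
      intro w hw d
      rw [mul_assoc]
      exact hx _ (hy w hw) d
  simpa using key 1 h1 d

/-- If `W` is finite modulo `(p_0, ..., p_{k-1})`, then so is every graded submodule. -/
theorem finQ_of_le {W M : Submodule K (MvPolynomial σ K)} {p : ℕ → MvPolynomial σ K} {k : ℕ}
    (hp : ∀ i : ℕ, p i ∈ hs K σ (i + 1)) (hW : ∀ i, ∀ v ∈ W, p i * v ∈ W) (hWg : Grd W)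
    [∀ d, FiniteDimensional K (gr W d)] (hF : FinQ (gr W) p k)
    (hMW : M ≤ W) (hM : ∀ i, ∀ v ∈ M, p i * v ∈ M) (hMg : Grd M) : FinQ (gr M) p k := by
  classical
  let B := Algebra.adjoin K (p '' Set.Iio k)
  have hBp : ∀ i < k, p i ∈ B := fun i hi => Algebra.subset_adjoin ⟨i, hi, rfl⟩
  have hBN : IsNoetherianRing B :=
    isNoetherianRing_of_fg (Subalgebra.fg_def.2 ⟨_, (Set.finite_Iio k).image p, rfl⟩)
  have hB : ∀ T : Submodule K (MvPolynomial σ K), (∀ i, ∀ v ∈ T, p i * v ∈ T) →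
      ∀ b ∈ B, ∀ v ∈ T, b * v ∈ T := by
    intro T hT b hb
    induction hb using Algebra.adjoin_induction with
    | mem x hx => obtain ⟨i, _, rfl⟩ := hx; exact hT i
    | algebraMap r => intro v hv; rw [← Algebra.smul_def]; exact T.smul_mem r hv
    | add x y _ _ hx hy => intro v hv; rw [add_mul]; exact add_mem (hx v hv) (hy v hv)
    | mul x y _ _ hx hy => intro v hv; rw [mul_assoc]; exact hx _ (hy v hv)
  let toB : ∀ T : Submodule K (MvPolynomial σ K), (∀ i, ∀ v ∈ T, p i * v ∈ T) →
      Submodule B (MvPolynomial σ K) := fun T hT =>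
    { T.toAddSubmonoid with smul_mem' := fun b v hv => hB T hT b.1 b.2 v hv }
  obtain ⟨d₀, hd₀⟩ := hF
  have hWfg : (toB W hW).FG := by
    have : ∀ d, ∃ S : Finset (MvPolynomial σ K), Submodule.span K (S : Set _) = gr W d := fun d =>
      (Submodule.fg_iff_finiteDimensional _).2 inferInstance
    choose S hS using this
    refine ⟨(Finset.Ico 0 d₀).biUnion S, le_antisymm ?_ ?_⟩
    · rw [Submodule.span_le]
      intro v hv
      simp only [Finset.coe_biUnion, Set.mem_iUnion] at hv
      obtain ⟨d, _, hv⟩ := hv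
      have : v ∈ gr W d := by rw [← hS d]; exact Submodule.subset_span hv
      exact this.1
    · set U := Submodule.span B ((Finset.Ico 0 d₀).biUnion S : Set (MvPolynomial σ K)) with hU
      have hgr : ∀ d, gr W d ≤ U.restrictScalars K := by
        intro d
        induction d using int_induction with
        | h0 d hd => rw [gr_neg W hd]; exact bot_le
        | h d hd ih =>
          by_cases h : d < d₀
          · rw [← hS d, Submodule.span_le]
            intro v hv
            refine Submodule.subset_span ?_
            simp only [Finset.coe_biUnion, Set.mem_iUnion]
            exact ⟨d, by simp; omega, hv⟩
          · have : ∀ j ≤ k, idl (gr W) p j d ≤ U.restrictScalars K := by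
              intro j
              induction j with
              | zero => intro _; exact bot_le
              | succ j ihj =>
                intro hj v hv
                obtain ⟨a, ha, w, hw, rfl⟩ := mem_idl_succ.1 hv
                refine add_mem (ihj (by omega) ha) ?_
                have h1 : w ∈ U := ih _ (by omega) hw
                exact U.smul_mem (⟨p j, hBp j hj⟩ : B) h1
            exact (hd₀ d (by omega)).trans (this k le_rfl)
      intro v hv
      have : v ∈ U.restrictScalars K := mem_of_comp fun d => hgr d ⟨hWg d v hv, comp_mem_hs d v⟩
      exact this
  have hWN : IsNoetherian B (toB W hW) := isNoetherian_of_fg_of_noetherian _ hWfg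
  obtain ⟨S, hS⟩ := isNoetherian_submodule.1 hWN (toB M hM) hMW
  let J : Submodule K (MvPolynomial σ K) := ⨅ d : ℤ, (idl (gr M) p k d).comap (comp d)
  have hJ : ∀ v, v ∈ J ↔ ∀ d, comp d v ∈ idl (gr M) p k d := fun v => by
    simp [J, Submodule.mem_iInf]
  have hpJ : ∀ i < k, ∀ v ∈ M, p i * v ∈ J := fun i hi v hv => by
    rw [hJ]
    intro d
    rw [comp_mul' (hp i)]
    exact idl_le_of_le hi d (mul_mem_idl_succ (hMg.comp_mem hv))
  have hJM : J ≤ M := fun v hv => mem_of_comp fun d =>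
    ((stable_gr hp hM).idl_le _ _ ((hJ v).1 hv d)).1
  have hBJ : ∀ b ∈ B, ∃ c : K, ∀ v ∈ M, b * v - c • v ∈ J := by
    intro b hb
    induction hb using Algebra.adjoin_induction with
    | mem x hx => obtain ⟨i, hi, rfl⟩ := hx; exact ⟨0, fun v hv => by simpa using hpJ i hi v hv⟩
    | algebraMap r => exact ⟨r, fun v hv => by rw [← Algebra.smul_def, sub_self]; exact zero_mem _⟩
    | add x y _ _ hx hy =>
      obtain ⟨c, hc⟩ := hx
      obtain ⟨e, he⟩ := hy
      refine ⟨c + e, fun v hv => ?_⟩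
      have := add_mem (hc v hv) (he v hv)
      rwa [show x * v - c • v + (y * v - e • v) = (x + y) * v - (c + e) • v by
        rw [add_smul]; ring] at this
    | mul x y _ hyB hx hy =>
      obtain ⟨c, hc⟩ := hx
      obtain ⟨e, he⟩ := hy
      refine ⟨c * e, fun v hv => ?_⟩
      have := add_mem (hc _ (hB M hM y hyB v hv)) (J.smul_mem c (he v hv))
      rwa [show x * (y * v) - c • (y * v) + c • (y * v - e • v) = x * y * v - (c * e) • v by
        rw [smul_sub, mul_smul]; ring] at this
  have hspan : ∀ v ∈ M, v ∈ Submodule.span K (S : Set (MvPolynomial σ K)) ⊔ J := by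
    intro v hv
    have hv' : v ∈ Submodule.span B (S : Set (MvPolynomial σ K)) := by rw [hS]; exact hv
    have hSM : Submodule.span K (S : Set (MvPolynomial σ K)) ⊔ J ≤ M := by
      refine sup_le (Submodule.span_le.2 fun u hu => ?_) hJM
      have : u ∈ toB M hM := by rw [← hS]; exact Submodule.subset_span hu
      exact this
    induction hv' using Submodule.span_induction with
    | mem x hx => exact Submodule.mem_sup_left (Submodule.subset_span hx)
    | zero => exact zero_mem _
    | add x y hx hy ihx ihy =>
      have hx' : x ∈ toB M hM := by rw [← hS]; exact hx
      have hy' : y ∈ toB M hM := by rw [← hS]; exact hy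
      exact add_mem (ihx hx') (ihy hy')
    | smul b x hx ihx =>
      have hx' : x ∈ toB M hM := by rw [← hS]; exact hx
      obtain ⟨c, hc⟩ := hBJ b.1 b.2
      have := add_mem (Submodule.smul_mem _ c (ihx hx')) (Submodule.mem_sup_right (hc x hx'))
      rwa [show c • x + (b.1 * x - c • x) = b • x by rw [add_sub_cancel]; rfl] at this
  choose D hD using fun v : MvPolynomial σ K => exists_comp_bound v
  obtain ⟨D₀, hD₀⟩ := (S.image D).bddAbove
  refine ⟨D₀, fun d hd v hv => ?_⟩
  obtain ⟨u, hu, u', hu', huv⟩ := Submodule.mem_sup.1 (hspan v hv.1)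
  have h1 : comp d u = 0 := by
    have : Submodule.span K (S : Set (MvPolynomial σ K)) ≤ LinearMap.ker (comp d) := by
      refine Submodule.span_le.2 fun s hs => hD s d ?_
      exact le_trans (hD₀ (by simpa using ⟨s, hs, rfl⟩)) hd
    exact this hu
  have h2 : v = comp d u' := by
    rw [← comp_of_mem hv.2, ← huv, map_add, h1, zero_add]
  rw [h2]
  exact (hJ u').1 hu' d

end Graded

section Free

variable {K σ : Type*} [Field K]

theorem exists_split {p : ℕ → MvPolynomial σ K} {j N : ℕ} (hj : j < N)
    (hp : ∀ i : ℕ, p i ∈ hs K σ (i + 1)) {b : MvPolynomial σ K} {e : ℤ}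
    (hb : b ∈ Algebra.adjoin K (p '' Set.Ico j N)) (hbe : b ∈ hs K σ e) :
    ∃ b₀ ∈ Algebra.adjoin K (p '' Set.Ico (j + 1) N), b₀ ∈ hs K σ e ∧
      ∃ b₁ ∈ Algebra.adjoin K (p '' Set.Ico j N), b₁ ∈ hs K σ (e - (j + 1)) ∧ b = b₀ + p j * b₁ := by
  have hle : Algebra.adjoin K (p '' Set.Ico (j + 1) N) ≤ Algebra.adjoin K (p '' Set.Ico j N) :=
    Algebra.adjoin_mono (Set.image_mono (Set.Ico_subset_Ico_left (by omega)))
  have hpj : p j ∈ Algebra.adjoin K (p '' Set.Ico j N) :=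
    Algebra.subset_adjoin ⟨j, ⟨le_rfl, hj⟩, rfl⟩
  have hg : ∀ l, Grd (Subalgebra.toSubmodule (Algebra.adjoin K (p '' Set.Ico l N))) := fun l =>
    grd_adjoin (by rintro _ ⟨i, _, rfl⟩; exact ⟨_, hp i⟩)
  have key : ∃ b₀ ∈ Algebra.adjoin K (p '' Set.Ico (j + 1) N),
      ∃ b₁ ∈ Algebra.adjoin K (p '' Set.Ico j N), b = b₀ + p j * b₁ := by
    clear hbe
    induction hb using Algebra.adjoin_induction with
    | mem x hx =>
      obtain ⟨i, hi, rfl⟩ := hx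
      rcases hi.1.eq_or_lt with rfl | h
      · exact ⟨0, zero_mem _, 1, one_mem _, by simp⟩
      · exact ⟨p i, Algebra.subset_adjoin ⟨i, ⟨h, hi.2⟩, rfl⟩, 0, zero_mem _, by simp⟩
    | algebraMap r => exact ⟨_, Subalgebra.algebraMap_mem _ r, 0, zero_mem _, by simp⟩
    | add x y _ _ hx hy =>
      obtain ⟨a, ha, c, hc, rfl⟩ := hx
      obtain ⟨a', ha', c', hc', rfl⟩ := hy
      exact ⟨a + a', add_mem ha ha', c + c', add_mem hc hc', by ring⟩
    | mul x y _ hyB hx hy =>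
      obtain ⟨a, ha, c, hc, rfl⟩ := hx
      obtain ⟨a', ha', c', hc', rfl⟩ := hy
      exact ⟨a * a', mul_mem ha ha', a * c' + c * (a' + p j * c'),
        add_mem (mul_mem (hle ha) hc') (mul_mem hc hyB), by ring⟩
  obtain ⟨b₀, h0, b₁, h1, rfl⟩ := key
  refine ⟨comp e b₀, hg _ e _ h0, comp_mem_hs _ _, comp (e - (j + 1)) b₁, hg _ _ _ h1,
    comp_mem_hs _ _, ?_⟩
  rw [← comp_mul' (hp j), ← map_add, comp_of_mem hbe]

theorem exists_homogeneous_complement (A : Submodule K (MvPolynomial σ K))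
    {p : ℕ → MvPolynomial σ K} {N : ℕ} (hs : Stable (gr A) p) (d : ℤ) :
    ∃ V ≤ gr A d, idl (gr A) p N d ⊓ V = ⊥ ∧ idl (gr A) p N d ⊔ V = gr A d := by
  obtain ⟨V, hV⟩ := Submodule.exists_isCompl (idl (gr A) p N d)
  refine ⟨V ⊓ gr A d, inf_le_right, ?_, ?_⟩
  · rw [← inf_assoc, hV.inf_eq_bot, bot_inf_eq]
  · rw [← sup_inf_assoc_of_le _ (hs.idl_le N d), hV.sup_eq_top, top_inf_eq]

/-- A graded algebra with a regular sequence `p_0, ..., p_{N-1}` over which it is finite is a free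
module over the algebra generated by the sequence. -/
theorem finite_free_of_reg (A : Submodule K (MvPolynomial σ K)) (hA : Grd A)
    {p : ℕ → MvPolynomial σ K} (hp : ∀ i : ℕ, p i ∈ hs K σ (i + 1))
    (hpA : ∀ i, ∀ v ∈ A, p i * v ∈ A) {N : ℕ} (hF : FinQ (gr A) p N)
    [∀ d, FiniteDimensional K (gr A d)] (hR : Reg (gr A) p N)
    (B : Subalgebra K (MvPolynomial σ K)) (hB : B = Algebra.adjoin K (p '' Set.Iio N))
    (AB : Submodule B (MvPolynomial σ K)) (hAB : ∀ v, v ∈ AB ↔ v ∈ A) :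
    Module.Finite B AB ∧ Module.Free B AB := by
  classical
  have hst := stable_gr hp hpA
  choose V hVM hVinf hVsup using exists_homogeneous_complement A (N := N) hst
  obtain ⟨d₀, hd₀⟩ := hF
  have hVf : ∀ d, FiniteDimensional K (V d) := fun d =>
    Submodule.finiteDimensional_of_le (hVM d)
  let ι := Σ d : Finset.Ico 0 d₀, Fin (Module.finrank K (V d))
  let deg : ι → ℤ := fun i => i.1
  let g : ι → MvPolynomial σ K := fun i => (Module.finBasis K (V i.1) i.2 : V i.1)
  have hgV : ∀ i, g i ∈ V (deg i) := fun i => (Module.finBasis K (V i.1) i.2).2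
  have hgA : ∀ i, g i ∈ A := fun i => (hVM _ (hgV i)).1
  have hghs : ∀ i, g i ∈ hs K σ (deg i) := fun i => (hVM _ (hgV i)).2
  have hdeg : ∀ i, 0 ≤ deg i := fun i => (Finset.mem_Ico.1 i.1.2).1
  have hgspan : ∀ d, V d ≤ Submodule.span K {v | ∃ i, deg i = d ∧ g i = v} := by
    intro d v hv
    by_cases hd : d ∈ Finset.Ico 0 d₀
    · have := (Module.finBasis K (V d)).sum_repr ⟨v, hv⟩
      have h2 := congrArg Subtype.val this
      simp only [AddSubmonoidClass.coe_finsetSum, SetLike.val_smul] at h2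
      rw [← h2]
      refine sum_mem fun i _ => Submodule.smul_mem _ _ (Submodule.subset_span ?_)
      exact ⟨⟨⟨d, hd⟩, i⟩, rfl, rfl⟩
    · have : v = 0 := by
        rw [Finset.mem_Ico, not_and_or] at hd
        rcases hd with hd | hd
        · have := hVM d hv
          rw [gr_neg A (by omega)] at this
          simpa using this
        · have h1 : v ∈ idl (gr A) p N d ⊓ V d := ⟨hd₀ d (by omega) (hVM d hv), hv⟩
          rw [hVinf] at h1
          simpa using h1
      rw [this]
      exact zero_mem _
  have hgli : ∀ d (c : ι → K), (∀ i, deg i ≠ d → c i = 0) → ∑ i, C (c i) * g i = 0 → ∀ i, c i = 0 := by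
    intro d c hc hsum i
    by_cases hi : deg i = d
    swap
    · exact hc i hi
    obtain ⟨⟨e, he⟩, k⟩ := i
    change e = d at hi
    subst hi
    rw [Fintype.sum_sigma, Finset.sum_eq_single ⟨e, he⟩] at hsum
    · have h1 : ∑ x, c ⟨⟨e, he⟩, x⟩ • Module.finBasis K (V e) x = 0 := by
        apply Subtype.ext
        simp only [AddSubmonoidClass.coe_finsetSum, SetLike.val_smul, ZeroMemClass.coe_zero]
        rw [← hsum]
        exact Finset.sum_congr rfl fun x _ => by rw [smul_eq_C_mul]
      exact Fintype.linearIndependent_iff.1 (Module.finBasis K (V e)).linearIndependent _ h1 k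
    · intro b _ hb
      refine Finset.sum_eq_zero fun x _ => ?_
      rw [hc ⟨b, x⟩ (fun h => hb (Subtype.ext h))]
      simp
    · simp
  have key : ∀ j ≤ N, ∀ d (b : ι → MvPolynomial σ K),
      (∀ i, b i ∈ Algebra.adjoin K (p '' Set.Ico j N)) → (∀ i, b i ∈ hs K σ (d - deg i)) →
      ∑ i, b i * g i ∈ idl (gr A) p j d → ∀ i, b i = 0 := by
    have hBA : ∀ j, ∀ b ∈ Algebra.adjoin K (p '' Set.Ico j N), ∀ v ∈ A, b * v ∈ A := by
      intro j b hb
      induction hb using Algebra.adjoin_induction with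
      | mem x hx => obtain ⟨i, _, rfl⟩ := hx; exact hpA i
      | algebraMap r => intro v hv; rw [← Algebra.smul_def]; exact A.smul_mem r hv
      | add x y _ _ hx hy => intro v hv; rw [add_mul]; exact add_mem (hx v hv) (hy v hv)
      | mul x y _ _ hx hy => intro v hv; rw [mul_assoc]; exact hx _ (hy v hv)
    have hbgr : ∀ j d (b : ι → MvPolynomial σ K),
      (∀ i, b i ∈ Algebra.adjoin K (p '' Set.Ico j N)) → (∀ i, b i ∈ hs K σ (d - deg i)) →
      ∑ i, b i * g i ∈ gr A d := fun j d b hb hbd => sum_mem fun i _ =>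
        ⟨hBA j _ (hb i) _ (hgA i), by simpa using mul_mem_hs (hbd i) (hghs i)⟩
    intro j hj
    induction hj using Nat.decreasingInduction with
    | self =>
      intro d b hb hbd hsum
      have : ∀ i, ∃ c : K, b i = C c := by
        intro i
        have := hb i
        rw [Set.Ico_self, Set.image_empty, Algebra.adjoin_empty, Algebra.mem_bot] at this
        obtain ⟨c, hc⟩ := this
        exact ⟨c, hc.symm⟩
      choose c hc using this
      have hc0 : ∀ i, deg i ≠ d → c i = 0 := by
        intro i hi
        have h1 : comp 0 (b i) = 0 := comp_of_ne (hbd i) (by omega)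
        rw [hc, comp_of_mem (C_mem_hs _)] at h1
        simpa using h1
      simp only [hc] at hsum ⊢
      have hV : ∑ i, C (c i) * g i ∈ V d := by
        refine sum_mem fun i _ => ?_
        by_cases hi : deg i = d
        · rw [← smul_eq_C_mul, ← hi]
          exact Submodule.smul_mem _ _ (hgV i)
        · rw [hc0 i hi]
          simp
      have h0 : ∑ i, C (c i) * g i = 0 := by
        rw [← Submodule.mem_bot K, ← hVinf d]
        exact ⟨hsum, hV⟩
      intro i
      rw [hgli d c hc0 h0 i, map_zero]
    | of_succ j hj ih =>
      intro d
      induction d using int_induction with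
      | h0 d hd =>
        intro b _ hbd _ i
        have := hbd i
        rw [hs_neg (by have := hdeg i; omega)] at this
        simpa using this
      | h d hd ihd =>
        intro b hb hbd hsum
        choose b₀ hb₀ hb₀d b₁ hb₁ hb₁d hbb using fun i => exists_split hj hp (hb i) (hbd i)
        have e1 : ∑ i, b i * g i = ∑ i, b₀ i * g i + p j * ∑ i, b₁ i * g i := by
          rw [Finset.mul_sum, ← Finset.sum_add_distrib]
          exact Finset.sum_congr rfl fun i _ => by rw [hbb i]; ring
        have hb₁d' : ∀ i, b₁ i ∈ hs K σ (d - (j + 1) - deg i) := fun i => by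
          have := hb₁d i
          rwa [sub_right_comm] at this
        have hm : ∑ i, b₁ i * g i ∈ gr A (d - (j + 1)) := hbgr j _ b₁ hb₁ hb₁d'
        have h0 : ∀ i, b₀ i = 0 := by
          refine ih d b₀ hb₀ hb₀d ?_
          rw [eq_sub_of_add_eq e1.symm]
          exact sub_mem (idl_le_succ _ _ hsum) (mul_mem_idl_succ hm)
        have h1 : ∀ i, b₁ i = 0 := by
          refine ihd _ (by omega) b₁ hb₁ hb₁d' (hR.mem_sub hj hm ?_)
          simp only [h0, zero_mul, Finset.sum_const_zero, zero_add] at e1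
          rwa [← e1]
        intro i
        rw [hbb, h0, h1, mul_zero, add_zero]
  have hBg : Grd (Subalgebra.toSubmodule B) := by
    rw [hB]
    exact grd_adjoin (by rintro _ ⟨i, _, rfl⟩; exact ⟨_, hp i⟩)
  have hBp : ∀ i < N, p i ∈ B := fun i hi => hB ▸ Algebra.subset_adjoin ⟨i, hi, rfl⟩
  let v : ι → AB := fun i => ⟨g i, (hAB _).2 (hgA i)⟩
  have hli : LinearIndependent B v := by
    refine LinearIndependent.of_comp AB.subtype ?_
    refine (Fintype.linearIndependent_iff (R := B) (M := MvPolynomial σ K)).2 ?_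
    intro b hb i
    have hb' : ∑ i, (b i).1 * g i = 0 := hb
    apply Subtype.ext
    refine eq_zero_of_comp fun e => ?_
    have := key 0 (Nat.zero_le N) (e + deg i) (fun i' => comp (e + deg i - deg i') (b i').1)
      (fun i' => by
        have h1 : Set.Ico 0 N = Set.Iio N := by ext; simp
        rw [h1, ← hB]
        exact hBg _ _ (b i').2)
      (fun i' => comp_mem_hs _ _) (by
        have h2 : ∑ i', comp (e + deg i - deg i') (b i').1 * g i' = 0 := by
          have := congrArg (comp (e + deg i)) hb'
          rw [map_sum, map_zero] at this
          rw [← this]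
          exact Finset.sum_congr rfl fun i' _ => by
            rw [mul_comm (b i').1, comp_mul' (hghs i'), mul_comm]
        rw [h2]
        exact zero_mem _) i
    simpa using this
  have hspan : ⊤ ≤ Submodule.span B (Set.range v) := by
    set U := (Submodule.span B (Set.range v)).map AB.subtype with hU
    have hvU : ∀ i, g i ∈ U := fun i => ⟨v i, Submodule.subset_span ⟨i, rfl⟩, rfl⟩
    have hgr : ∀ d, gr A d ≤ U.restrictScalars K := by
      intro d
      induction d using int_induction with
      | h0 d hd => rw [gr_neg A hd]; exact bot_le
      | h d hd ih =>
        have : ∀ j ≤ N, idl (gr A) p j d ≤ U.restrictScalars K := by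
          intro j
          induction j with
          | zero => intro _; exact bot_le
          | succ j ihj =>
            intro hj v hv
            obtain ⟨a, ha, w, hw, rfl⟩ := mem_idl_succ.1 hv
            refine add_mem (ihj (by omega) ha) ?_
            have h1 : w ∈ U := ih _ (by omega) hw
            exact U.smul_mem (⟨p j, hBp j hj⟩ : B) h1
        rw [← hVsup d]
        refine sup_le (this N le_rfl) ((hgspan d).trans (Submodule.span_le.2 ?_))
        rintro _ ⟨i, _, rfl⟩
        exact hvU i
    rintro ⟨a, ha⟩ -
    have h1 : a ∈ U.restrictScalars K :=
      mem_of_comp fun d => hgr d ⟨hA d a ((hAB a).1 ha), comp_mem_hs d a⟩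
    obtain ⟨u, hu, hua⟩ := h1
    have : u = ⟨a, ha⟩ := Subtype.ext hua
    rwa [← this]
  have bas := Module.Basis.mk hli hspan
  exact ⟨Module.Finite.of_basis bas, Module.Free.of_basis bas⟩

end Free

/-! ### Generating functions of power sums -/

section PowerSums

/-- `∏_{a ∈ s} (1 - v_a u)`. -/
def lin {ι A : Type*} [CommRing A] (s : Finset ι) (v : ι → A) : PowerSeries A :=
  ∏ a ∈ s, (1 - PowerSeries.C (v a) * PowerSeries.X)

/-- The geometric series `1 / (1 - l u)`. -/
def geo {A : Type*} [CommRing A] (l : A) : PowerSeries A := PowerSeries.mk fun k => l ^ k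

/-- The generating function `∑ p_{k+1} u^k` of power sums. -/
def psums {ι A : Type*} [CommRing A] (s : Finset ι) (v : ι → A) : PowerSeries A :=
  PowerSeries.mk fun k => ∑ a ∈ s, v a ^ (k + 1)

variable {ι A : Type*} [CommRing A]

theorem geo_mul (l : A) : (1 - PowerSeries.C l * PowerSeries.X) * geo l = 1 := by
  ext k
  rw [sub_mul, one_mul, mul_assoc, map_sub, PowerSeries.coeff_C_mul]
  cases k with
  | zero => simp [geo]
  | succ k =>
    rw [PowerSeries.coeff_succ_X_mul, PowerSeries.coeff_one]
    simp [geo, pow_succ']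

theorem psums_insert [DecidableEq ι] {s : Finset ι} {a : ι} (ha : a ∉ s) (v : ι → A) :
    psums (insert a s) v = PowerSeries.C (v a) * geo (v a) + psums s v := by
  ext k
  simp [psums, geo, Finset.sum_insert ha, pow_succ']

theorem coeff_zero_lin (s : Finset ι) (v : ι → A) : PowerSeries.coeff 0 (lin s v) = 1 := by
  rw [lin, PowerSeries.coeff_zero_eq_constantCoeff_apply, map_prod]
  simp

theorem derivative_lin [DecidableEq ι] (s : Finset ι) (v : ι → A) :
    PowerSeries.derivative A (lin s v) = -psums s v * lin s v := by
  induction s using Finset.induction_on with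
  | empty =>
    have : psums ∅ v = 0 := by ext; simp [psums]
    simp [lin, this]
  | insert a s ha ih =>
    have h1 : lin (insert a s) v = (1 - PowerSeries.C (v a) * PowerSeries.X) * lin s v := by
      rw [lin, Finset.prod_insert ha]; rfl
    have h2 : PowerSeries.derivative A (1 - PowerSeries.C (v a) * PowerSeries.X) =
        - PowerSeries.C (v a) := by
      rw [map_sub, Derivation.map_one_eq_zero, Derivation.leibniz, PowerSeries.derivative_C]
      simp [PowerSeries.derivative_X]
    rw [h1, Derivation.leibniz, ih, h2, psums_insert ha, smul_eq_mul, smul_eq_mul]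
    linear_combination (- PowerSeries.C (v a) * lin s v) * (1 - geo_mul (v a))

theorem coeff_succ_of_derivative {F Q : PowerSeries A} (h : PowerSeries.derivative A F = Q * F)
    (k : ℕ) : ((k : A) + 1) * PowerSeries.coeff (k + 1) F =
      ∑ x ∈ Finset.HasAntidiagonal.antidiagonal k, PowerSeries.coeff x.1 Q * PowerSeries.coeff x.2 F := by
  rw [← PowerSeries.coeff_mul, ← h, PowerSeries.coeff_derivative, mul_comm]

variable {K : Type*} [Field K] [CharZero K] [Algebra K A]

theorem mem_of_natCast_mul {W : Submodule K A} {k : ℕ} {x : A} (h : ((k : A) + 1) * x ∈ W) :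
    x ∈ W := by
  have : x = ((k : K) + 1)⁻¹ • (((k : A) + 1) * x) := by
    have h1 : ((k : A) + 1) * x = ((k : K) + 1) • x := by
      rw [Algebra.smul_def, map_add, map_natCast, map_one]
    rw [h1, smul_smul, inv_mul_cancel₀ (Nat.cast_add_one_ne_zero k), one_smul]
  rw [this]
  exact W.smul_mem _ h

theorem coeff_mem_of_derivative {F Q : PowerSeries A} (h : PowerSeries.derivative A F = Q * F)
    (h0 : PowerSeries.coeff 0 F = 1) (S : Subalgebra K A) (hQ : ∀ k, PowerSeries.coeff k Q ∈ S)
    (k : ℕ) : PowerSeries.coeff k F ∈ S := by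
  induction k using Nat.strong_induction_on with
  | _ k ih =>
    cases k with
    | zero => rw [h0]; exact one_mem _
    | succ k =>
      rw [← Subalgebra.mem_toSubmodule]
      refine mem_of_natCast_mul (k := k) ?_
      rw [coeff_succ_of_derivative h, Subalgebra.mem_toSubmodule]
      refine sum_mem fun x hx => mul_mem (hQ _) (ih _ ?_)
      have := Finset.HasAntidiagonal.mem_antidiagonal.1 hx
      omega

theorem coeff_mem_ideal_of_derivative (K : Type*) [Field K] [CharZero K] [Algebra K A] {F Q : PowerSeries A}
    (h : PowerSeries.derivative A F = Q * F) (J : Ideal A) (N : ℕ)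
    (hQ : ∀ k < N, PowerSeries.coeff k Q ∈ J) (k : ℕ) (hk : k < N) :
    PowerSeries.coeff (k + 1) F ∈ J := by
  refine mem_of_natCast_mul (K := K) (W := J.restrictScalars K) (k := k) ?_
  rw [coeff_succ_of_derivative h]
  refine (Submodule.restrictScalars_mem K J _).2
    (sum_mem fun x hx => J.mul_mem_right _ (hQ _ ?_))
  have := Finset.HasAntidiagonal.mem_antidiagonal.1 hx
  omega

/-- The coefficients of `∏ (1 - v_a u) / (1 - l u)` in degrees `≥ |s|`. -/
theorem coeff_lin_mul_geo [DecidableEq ι] (s : Finset ι) (v : ι → A) (l : A) (k : ℕ) :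
    PowerSeries.coeff (k + s.card) (lin s v * geo l) = l ^ k * ∏ a ∈ s, (l - v a) := by
  induction s using Finset.induction_on generalizing k with
  | empty => simp [lin, geo]
  | insert a s ha ih =>
    have h1 : lin (insert a s) v = (1 - PowerSeries.C (v a) * PowerSeries.X) * lin s v := by
      rw [lin, Finset.prod_insert ha]; rfl
    rw [h1, Finset.card_insert_of_notMem ha, mul_assoc, sub_mul, one_mul, map_sub, mul_assoc,
      PowerSeries.coeff_C_mul, ← add_assoc, PowerSeries.coeff_succ_X_mul, ih,
      Finset.prod_insert ha, add_right_comm, ih]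
    ring

theorem sum_coeff_lin_eq_zero [DecidableEq ι] {s : Finset ι} (v : ι → A) {a : ι} (ha : a ∈ s) :
    ∑ x ∈ Finset.HasAntidiagonal.antidiagonal s.card, PowerSeries.coeff x.1 (lin s v) * v a ^ x.2 = 0 := by
  have := coeff_lin_mul_geo s v (v a) 0
  rw [Finset.prod_eq_zero ha (sub_self _), zero_add, PowerSeries.coeff_mul] at this
  simpa [geo] using this

/-- The top coefficient of `∏ (1 - v_a u)`. -/
theorem coeff_card_lin [DecidableEq ι] (s : Finset ι) (v : ι → A) :
    PowerSeries.coeff s.card (lin s v) = (-1) ^ s.card * ∏ a ∈ s, v a := by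
  have := coeff_lin_mul_geo s v 0 0
  have h0 : geo (0 : A) = 1 := by
    ext k
    simp [geo, PowerSeries.coeff_one, zero_pow_eq]
  rw [h0, mul_one, zero_add] at this
  rw [this]
  simp [Finset.prod_neg]

theorem coeff_lin_mem (s : Finset ι) (v : ι → A) (S : Subalgebra K A)
    (h : ∀ k, ∑ a ∈ s, v a ^ (k + 1) ∈ S) (k : ℕ) : PowerSeries.coeff k (lin s v) ∈ S := by
  classical
  refine coeff_mem_of_derivative (derivative_lin s v) (coeff_zero_lin s v) S (fun k => ?_) k
  rw [map_neg]
  exact neg_mem (by simpa [psums] using h k)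

theorem prod_mem_of_psums_mem (s : Finset ι) (v : ι → A) (S : Subalgebra K A)
    (h : ∀ k, ∑ a ∈ s, v a ^ (k + 1) ∈ S) : ∏ a ∈ s, v a ∈ S := by
  classical
  have h1 := coeff_lin_mem s v S h s.card
  rw [coeff_card_lin] at h1
  have h2 := mul_mem (pow_mem (neg_mem (one_mem S)) s.card) h1
  rwa [← mul_assoc, ← mul_pow, neg_one_mul, neg_neg, one_pow, one_mul] at h2

end PowerSums

/-! ### Substitutions, variables and linear forms -/

section Substitution

variable {K σ τ : Type*} [Field K]

/-- An algebra homomorphism sending variables to linear forms. -/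
def LinHom (φ : MvPolynomial σ K →ₐ[K] MvPolynomial τ K) : Prop := ∀ v, φ (X v) ∈ hs K τ 1

theorem LinHom.mem_hs {φ : MvPolynomial σ K →ₐ[K] MvPolynomial τ K} (h : LinHom φ) {d : ℤ}
    {f : MvPolynomial σ K} (hf : f ∈ hs K σ d) : φ f ∈ hs K τ d := by
  by_cases hd : d < 0
  · rw [hs_neg hd, Submodule.mem_bot] at hf
    simp [hf]
  · obtain ⟨n, rfl⟩ := Int.eq_ofNat_of_zero_le (not_lt.1 hd)
    rw [mem_hs_iff_natCast] at hf ⊢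
    have h1 : ∀ v, (φ (X v)).IsHomogeneous 1 := fun v => by
      have := h v
      rw [← Nat.cast_one, mem_hs_iff_natCast] at this
      exact this
    have := IsHomogeneous.aeval hf (fun v => φ (X v)) h1
    rw [one_mul] at this
    have e : aeval (fun v => φ (X v)) = φ := by ext; simp
    rwa [e] at this

theorem LinHom.comp {φ : MvPolynomial σ K →ₐ[K] MvPolynomial τ K} (h : LinHom φ) (d : ℤ)
    (f : MvPolynomial σ K) : AqtCM.comp d (φ f) = φ (AqtCM.comp d f) := by
  conv_lhs => rw [← sum_comp f, finsum_eq_sum _ (comp_finite f)]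
  rw [map_sum, map_sum, Finset.sum_eq_single d]
  · exact comp_of_mem (h.mem_hs (comp_mem_hs d f))
  · intro b _ hb
    exact comp_of_ne (h.mem_hs (comp_mem_hs b f)) (Ne.symm hb)
  · intro hd
    have : AqtCM.comp d f = 0 := by simpa using hd
    simp [this]

theorem dvd_sub_of_forall_X {φ ψ : MvPolynomial σ K →ₐ[K] MvPolynomial τ K}
    {l : MvPolynomial τ K} (h : ∀ v, l ∣ φ (X v) - ψ (X v)) (f : MvPolynomial σ K) :
    l ∣ φ f - ψ f := by
  induction f using MvPolynomial.induction_on with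
  | C a =>
    rw [← algebraMap_eq, AlgHom.commutes, AlgHom.commutes, sub_self]
    exact dvd_zero _
  | add p q hp hq =>
    rw [map_add, map_add, add_sub_add_comm]
    exact dvd_add hp hq
  | mul_X p v hp =>
    rw [map_mul, map_mul, show φ p * φ (X v) - ψ p * ψ (X v) =
      (φ p - ψ p) * φ (X v) + ψ p * (φ (X v) - ψ (X v)) by ring]
    exact dvd_add (hp.mul_right _) ((h v).mul_left _)

theorem hom_congr_supported {s : Set σ} {A : Type*} [CommRing A] [Algebra K A]
    {φ ψ : MvPolynomial σ K →ₐ[K] A} (h : ∀ v ∈ s, φ (X v) = ψ (X v)) {f : MvPolynomial σ K}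
    (hf : f ∈ supported K s) : φ f = ψ f := by
  have : supported K s ≤ AlgHom.equalizer φ ψ := by
    refine Algebra.adjoin_le ?_
    rintro _ ⟨v, hv, rfl⟩
    exact h v hv
  exact this hf

open Classical in
/-- Set the variables outside `s` to zero. -/
def theta (s : Set σ) : MvPolynomial σ K →ₐ[K] MvPolynomial σ K :=
  aeval fun v => if v ∈ s then X v else 0

theorem mem_supported_iff {s : Set σ} {f : MvPolynomial σ K} :
    f ∈ supported K s ↔ theta s f = f := by
  constructor
  · intro hf
    exact hom_congr_supported (ψ := AlgHom.id K _) (fun v hv => by simp [theta, hv]) hf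
  · intro h
    rw [← h]
    have : ∀ g : MvPolynomial σ K, theta s g ∈ supported K s := fun g => by
      induction g using MvPolynomial.induction_on with
      | C a => rw [← algebraMap_eq, AlgHom.commutes]; exact Subalgebra.algebraMap_mem _ a
      | add p q hp hq => rw [map_add]; exact add_mem hp hq
      | mul_X p v hp =>
        rw [map_mul]
        refine mul_mem hp ?_
        by_cases hv : v ∈ s
        · simpa [theta, hv] using Algebra.subset_adjoin (Set.mem_image_of_mem X hv)
        · simp [theta, hv]
    exact this f

theorem X_mem_supported {s : Set σ} {v : σ} (hv : v ∈ s) : (X v : MvPolynomial σ K) ∈ supported K s :=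
  Algebra.subset_adjoin (Set.mem_image_of_mem X hv)

theorem mem_of_mul_mem_supported {s : Set σ} {p g : MvPolynomial σ K} (hp : p ∈ supported K s)
    (hp0 : p ≠ 0) (h : p * g ∈ supported K s) : g ∈ supported K s := by
  rw [mem_supported_iff] at *
  rw [map_mul, hp] at h
  exact mul_left_cancel₀ hp0 h

theorem mem_of_mul_mem_hs {p g : MvPolynomial σ K} {d e : ℤ} (hp : p ∈ hs K σ e)
    (hp0 : p ≠ 0) (h : p * g ∈ hs K σ d) : g ∈ hs K σ (d - e) := by
  have := comp_of_mem h
  rw [comp_mul' hp] at this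
  rw [← mul_left_cancel₀ hp0 this]
  exact comp_mem_hs _ _

theorem map_supported_le {φ : MvPolynomial σ K →ₐ[K] MvPolynomial τ K} {s : Set σ} {t : Set τ}
    (h : ∀ v ∈ s, φ (X v) ∈ supported K t) {f : MvPolynomial σ K} (hf : f ∈ supported K s) :
    φ f ∈ supported K t := by
  have : supported K s ≤ (supported K t).comap φ := by
    refine Algebra.adjoin_le ?_
    rintro _ ⟨v, hv, rfl⟩
    exact h v hv
  exact this hf

theorem grd_supported (s : Set σ) : Grd (Subalgebra.toSubmodule (supported K s)) :=
  grd_adjoin (by rintro _ ⟨v, _, rfl⟩; exact ⟨1, X_mem_hs v⟩)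

theorem finiteDimensional_gr_of_le {s : Set σ} (hs : s.Finite)
    {M : Submodule K (MvPolynomial σ K)} (hM : M ≤ Subalgebra.toSubmodule (supported K s)) (d : ℤ) :
    FiniteDimensional K (gr M d) := by
  classical
  by_cases hd : d < 0
  · rw [gr_neg M hd]; infer_instance
  obtain ⟨n, rfl⟩ := Int.eq_ofNat_of_zero_le (not_lt.1 hd)
  have hfin := FiniteDimensional.span_finset K
    ((Finset.finsuppAntidiag hs.toFinset n).image fun c => (monomial c (1 : K)))
  refine Submodule.finiteDimensional_of_le (S₂ := Submodule.span K
    ((Finset.finsuppAntidiag hs.toFinset n).image fun c => (monomial c (1 : K)) : Set _)) ?_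
  rintro f ⟨hfM, hfd⟩
  rw [SetLike.mem_coe, mem_hs_iff_natCast] at hfd
  have hv := mem_supported.1 (hM hfM)
  rw [f.as_sum]
  refine sum_mem fun c hc => ?_
  have : monomial c (coeff c f) = coeff c f • monomial c (1 : K) := by
    rw [smul_monomial, smul_eq_mul, mul_one]
  rw [this]
  refine Submodule.smul_mem _ _ (Submodule.subset_span ?_)
  rw [Finset.mem_coe, Finset.mem_image]
  refine ⟨c, ?_, rfl⟩
  have hsub : c.support ⊆ hs.toFinset := fun v hvc => by
    rw [Set.Finite.mem_toFinset]
    exact hv (Finset.mem_coe.2 ((mem_vars_iff_mem_support v).2 ⟨c, hc, hvc⟩))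
  rw [Finset.mem_finsuppAntidiag]
  refine ⟨?_, hsub⟩
  have h1 := hfd (d := c) (mem_support_iff.1 hc)
  rw [Finsupp.weight_apply, Finsupp.sum] at h1
  simp only [Pi.one_apply, smul_eq_mul, mul_one] at h1
  rw [← h1]
  refine (Finset.sum_subset hsub fun x _ hx => ?_).symm
  simpa using hx

theorem finrank_of_exact {M N C : Submodule K (MvPolynomial σ K)} [FiniteDimensional K M]
    (φ : MvPolynomial σ K →ₗ[K] MvPolynomial σ K) (E : MvPolynomial σ K) (hE : E ≠ 0)
    (hMN : ∀ v ∈ M, φ v ∈ N) (hNM : ∀ w ∈ N, ∃ v ∈ M, φ v = w)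
    (hCM : ∀ v ∈ C, E * v ∈ M ∧ φ (E * v) = 0)
    (hker : ∀ v ∈ M, φ v = 0 → ∃ w ∈ C, v = E * w) :
    Module.finrank K M = Module.finrank K N + Module.finrank K C := by
  let ψ : M →ₗ[K] N := φ.restrict hMN
  have hψ : LinearMap.range ψ = ⊤ := by
    rw [LinearMap.range_eq_top]
    rintro ⟨w, hw⟩
    obtain ⟨v, hv, rfl⟩ := hNM w hw
    exact ⟨⟨v, hv⟩, rfl⟩
  let χ : C →ₗ[K] LinearMap.ker ψ := LinearMap.codRestrict _
    ((LinearMap.mulLeft K E).restrict fun v hv => (hCM v hv).1)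
    fun v => Subtype.ext (hCM v.1 v.2).2
  have hχ : Function.Bijective χ := by
    constructor
    · intro u v h
      have := congrArg (fun w => w.1.1) h
      exact Subtype.ext (mul_left_cancel₀ hE this)
    · rintro ⟨⟨v, hv⟩, h⟩
      obtain ⟨w, hw, rfl⟩ := hker v hv (congrArg Subtype.val h)
      exact ⟨⟨w, hw⟩, rfl⟩
  rw [← LinearMap.finrank_range_add_finrank_ker ψ, hψ, finrank_top,
    (LinearEquiv.ofBijective χ hχ).finrank_eq]

end Substitution

/-! ### Two families of variables -/

/-- Polynomials in variables `y_0, y_1, ...` and `z_0, z_1, ...`. -/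
abbrev RR := MvPolynomial (ℕ ⊕ ℕ) ℂ

/-- The variable `y_a`. -/
abbrev yv (a : ℕ) : RR := X (Sum.inl a)

/-- The variable `z_b`. -/
abbrev zv (b : ℕ) : RR := X (Sum.inr b)

/-- The variables `y_a`, `a < n`, and `z_b`, `b < m`. -/
def V (n m : ℕ) : Set (ℕ ⊕ ℕ) := Sum.elim (· < n) (· < m)

@[simp] theorem inl_mem_V {n m a : ℕ} : Sum.inl a ∈ V n m ↔ a < n := Iff.rfl

@[simp] theorem inr_mem_V {n m b : ℕ} : Sum.inr b ∈ V n m ↔ b < m := Iff.rfl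

theorem V_finite (n m : ℕ) : (V n m).Finite := by
  refine (((Set.finite_Iio n).image Sum.inl).union ((Set.finite_Iio m).image Sum.inr)).subset ?_
  rintro (a | b) h
  · exact Or.inl ⟨a, h, rfl⟩
  · exact Or.inr ⟨b, h, rfl⟩

theorem V_mono {n m n' m' : ℕ} (hn : n ≤ n') (hm : m ≤ m') : V n m ⊆ V n' m' := by
  rintro (a | b) h
  · exact lt_of_lt_of_le h hn
  · exact lt_of_lt_of_le h hm

/-- The polynomial ring in `n` variables `y` and `m` variables `z`. -/
abbrev W (n m : ℕ) : Subalgebra ℂ RR := supported ℂ (V n m)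

theorem W_mono {n m n' m' : ℕ} (hn : n ≤ n') (hm : m ≤ m') : W n m ≤ W n' m' :=
  supported_mono (V_mono hn hm)

theorem y_mem_W {n m a : ℕ} (h : a < n) : yv a ∈ W n m := X_mem_supported h

theorem z_mem_W {n m b : ℕ} (h : b < m) : zv b ∈ W n m := X_mem_supported h

/-- Power sums of the `y_a`. -/
def py (n i : ℕ) : RR := ∑ a ∈ Finset.range n, yv a ^ (i + 1)

/-- Power sums of the `z_b`. -/
def pz (m i : ℕ) : RR := ∑ b ∈ Finset.range m, zv b ^ (i + 1)

/-- Substitution of one variable. -/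
def sb (v : ℕ ⊕ ℕ) (p : RR) : RR →ₐ[ℂ] RR := aeval (Function.update X v p)

@[simp] theorem sb_X_self (v : ℕ ⊕ ℕ) (p : RR) : sb v p (X v) = p := by simp [sb]

theorem sb_X_ne {v w : ℕ ⊕ ℕ} (p : RR) (h : w ≠ v) : sb v p (X w) = X w := by
  simp [sb, Function.update_of_ne h]

theorem sb_X (v w : ℕ ⊕ ℕ) (p : RR) : sb v p (X w) = if w = v then p else X w := by
  split_ifs with h
  · rw [h, sb_X_self]
  · exact sb_X_ne p h

theorem linHom_sb {v : ℕ ⊕ ℕ} {p : RR} (hp : p ∈ hs ℂ (ℕ ⊕ ℕ) 1) : LinHom (sb v p) := fun w => by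
  rw [sb_X]
  split_ifs
  · exact hp
  · exact X_mem_hs w

/-- Exchange of two variables. -/
def sw (u v : ℕ ⊕ ℕ) : RR →ₐ[ℂ] RR := rename (Equiv.swap u v)

@[simp] theorem sw_X (u v w : ℕ ⊕ ℕ) : sw u v (X w) = X (Equiv.swap u v w) := rename_X _ _

theorem sw_sw (u v : ℕ ⊕ ℕ) (f : RR) : sw u v (sw u v f) = f := by
  have : (sw u v).comp (sw u v) = AlgHom.id ℂ _ := by ext; simp
  exact DFunLike.congr_fun this f

theorem linHom_sw (u v : ℕ ⊕ ℕ) : LinHom (sw u v) := fun w => by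
  rw [sw_X]; exact X_mem_hs _

theorem sw_self (u : ℕ ⊕ ℕ) (f : RR) : sw u u f = f := by
  have : sw u u = AlgHom.id ℂ _ := by ext; simp
  rw [this]; rfl

theorem sw_inl_py {n i j : ℕ} (hi : i < n) (hj : j < n) (k : ℕ) :
    sw (Sum.inl i) (Sum.inl j) (py n k) = py n k := by
  simp only [py, map_sum, map_pow, sw_X]
  refine Finset.sum_equiv (Equiv.swap i j) (fun a => ?_) fun a _ => ?_
  · simp only [Finset.mem_range, Equiv.swap_apply_def]
    split_ifs <;> omega
  · simp only [Equiv.swap_apply_def, Sum.inl.injEq]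
    split_ifs <;> rfl

theorem sw_inr_pz {m i j : ℕ} (hi : i < m) (hj : j < m) (k : ℕ) :
    sw (Sum.inr i) (Sum.inr j) (pz m k) = pz m k := by
  simp only [pz, map_sum, map_pow, sw_X]
  refine Finset.sum_equiv (Equiv.swap i j) (fun a => ?_) fun a _ => ?_
  · simp only [Finset.mem_range, Equiv.swap_apply_def]
    split_ifs <;> omega
  · simp only [Equiv.swap_apply_def, Sum.inr.injEq]
    split_ifs <;> rfl

theorem sw_inl_pz (i j m k : ℕ) : sw (Sum.inl i) (Sum.inl j) (pz m k) = pz m k := by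
  simp [pz, Equiv.swap_apply_def]

theorem sw_inr_py (i j n k : ℕ) : sw (Sum.inr i) (Sum.inr j) (py n k) = py n k := by
  simp [py, Equiv.swap_apply_def]

/-- Exchanges of two variables of the same family. -/
def Sw (n m : ℕ) : Set ((ℕ ⊕ ℕ) × (ℕ ⊕ ℕ)) :=
  {e | (∃ i < n, ∃ j < n, e = (Sum.inl i, Sum.inl j)) ∨
    (∃ i < m, ∃ j < m, e = (Sum.inr i, Sum.inr j))}

theorem Sw_mono {n m n' m' : ℕ} (hn : n ≤ n') (hm : m ≤ m') : Sw n m ⊆ Sw n' m' := by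
  rintro _ (⟨i, hi, j, hj, rfl⟩ | ⟨i, hi, j, hj, rfl⟩)
  · exact Or.inl ⟨i, by omega, j, by omega, rfl⟩
  · exact Or.inr ⟨i, by omega, j, by omega, rfl⟩

/-- Polynomials symmetric in the `y_a` and in the `z_b`. -/
def Inv (n m : ℕ) : Subalgebra ℂ RR :=
  W n m ⊓ ⨅ e : Sw n m, AlgHom.equalizer (sw e.1.1 e.1.2) (AlgHom.id ℂ _)

theorem mem_Inv {n m : ℕ} {f : RR} :
    f ∈ Inv n m ↔ f ∈ W n m ∧ ∀ u v, (u, v) ∈ Sw n m → sw u v f = f := by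
  simp [Inv, Algebra.mem_inf, Algebra.mem_iInf, AlgHom.mem_equalizer]

/-- The algebra generated by the power sums of both families. -/
def S (n m : ℕ) : Subalgebra ℂ RR := Algebra.adjoin ℂ (Set.range (py n) ∪ Set.range (pz m))

theorem py_mem_S (n m i : ℕ) : py n i ∈ S n m := Algebra.subset_adjoin (Or.inl ⟨i, rfl⟩)

theorem pz_mem_S (n m i : ℕ) : pz m i ∈ S n m := Algebra.subset_adjoin (Or.inr ⟨i, rfl⟩)

theorem py_mem_hs (n i : ℕ) : py n i ∈ hs ℂ (ℕ ⊕ ℕ) (i + 1) :=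
  sum_mem fun a _ => by simpa using Xpow_mem_hs (K := ℂ) (Sum.inl a : ℕ ⊕ ℕ) (i + 1)

theorem pz_mem_hs (n i : ℕ) : pz n i ∈ hs ℂ (ℕ ⊕ ℕ) (i + 1) :=
  sum_mem fun a _ => by simpa using Xpow_mem_hs (K := ℂ) (Sum.inr a : ℕ ⊕ ℕ) (i + 1)

theorem py_mem_W {n m k : ℕ} (h : n ≤ k) (i : ℕ) : py n i ∈ W k m :=
  sum_mem fun a ha => pow_mem (y_mem_W ((Finset.mem_range.1 ha).trans_le h)) _

theorem pz_mem_W {n m k : ℕ} (h : m ≤ k) (i : ℕ) : pz m i ∈ W n k :=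
  sum_mem fun a ha => pow_mem (z_mem_W ((Finset.mem_range.1 ha).trans_le h)) _

theorem S_le_Inv (n m : ℕ) : S n m ≤ Inv n m := by
  refine Algebra.adjoin_le ?_
  rintro _ (⟨i, rfl⟩ | ⟨i, rfl⟩)
  · refine mem_Inv.2 ⟨py_mem_W le_rfl i, ?_⟩
    rintro u v (⟨a, ha, b, hb, h⟩ | ⟨a, ha, b, hb, h⟩) <;> obtain ⟨rfl, rfl⟩ := Prod.mk.inj h
    · exact sw_inl_py ha hb i
    · exact sw_inr_py _ _ _ _
  · refine mem_Inv.2 ⟨pz_mem_W le_rfl i, ?_⟩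
    rintro u v (⟨a, ha, b, hb, h⟩ | ⟨a, ha, b, hb, h⟩) <;> obtain ⟨rfl, rfl⟩ := Prod.mk.inj h
    · exact sw_inl_pz _ _ _ _
    · exact sw_inr_pz ha hb i

theorem S_le_W (n m : ℕ) : S n m ≤ W n m := fun _ hf => (mem_Inv.1 (S_le_Inv n m hf)).1

theorem grd_S (n m : ℕ) : Grd (Subalgebra.toSubmodule (S n m)) :=
  grd_adjoin (by
    rintro _ (⟨i, rfl⟩ | ⟨i, rfl⟩)
    exacts [⟨_, py_mem_hs n i⟩, ⟨_, pz_mem_hs m i⟩])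

theorem comp_mem_Inv {n m : ℕ} {f : RR} (hf : f ∈ Inv n m) (d : ℤ) : comp d f ∈ Inv n m := by
  rw [mem_Inv] at *
  refine ⟨grd_supported _ d f hf.1, fun u v h => ?_⟩
  rw [← (linHom_sw u v).comp, hf.2 u v h]

theorem sw_mem_W {n m : ℕ} {u v : ℕ ⊕ ℕ} (h : (u, v) ∈ Sw n m) {f : RR} (hf : f ∈ W n m) :
    sw u v f ∈ W n m := by
  refine map_supported_le (fun w hw => ?_) hf
  rw [sw_X]
  refine X_mem_supported ?_
  rcases h with ⟨a, ha, b, hb, h⟩ | ⟨a, ha, b, hb, h⟩ <;> obtain ⟨rfl, rfl⟩ := Prod.mk.inj h <;>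
    simp only [Equiv.swap_apply_def] <;> split_ifs <;> assumption

/-- The quotient of symmetric polynomials is symmetric. -/
theorem mem_Inv_of_mul {n m : ℕ} {E h : RR} (hE : E ∈ Inv n m) (hE0 : E ≠ 0)
    (h1 : E * h ∈ Inv n m) : h ∈ Inv n m := by
  rw [mem_Inv] at *
  refine ⟨mem_of_mul_mem_supported hE.1 hE0 h1.1, fun u v huv => ?_⟩
  have := h1.2 u v huv
  rw [map_mul, hE.2 u v huv] at this
  exact mul_left_cancel₀ hE0 this

/-! ### Divisibility by linear forms -/

/-- The linear form `z_b - c y_a`. -/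
def lf (a b : ℕ) (c : ℂ) : RR := zv b - C c * yv a

theorem lf_mem_hs (a b : ℕ) (c : ℂ) : lf a b c ∈ hs ℂ (ℕ ⊕ ℕ) 1 :=
  sub_mem (X_mem_hs _) (C_mul_mem_hs c (X_mem_hs _))

theorem lf_mem_W {n m a b : ℕ} (ha : a < n) (hb : b < m) (c : ℂ) : lf a b c ∈ W n m :=
  sub_mem (z_mem_W hb) (mul_mem (Subalgebra.algebraMap_mem _ c) (y_mem_W ha))

theorem sb_C_mul (v : ℕ ⊕ ℕ) (p : RR) (c : ℂ) (f : RR) : sb v p (C c * f) = C c * sb v p f := by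
  rw [map_mul, ← algebraMap_eq, AlgHom.commutes]

theorem sb_lf (a b : ℕ) (c : ℂ) (b' : ℕ) (p : RR) :
    sb (Sum.inr b') p (lf a b c) = if b = b' then p - C c * yv a else lf a b c := by
  rw [lf, map_sub, sb_C_mul, sb_X, sb_X_ne _ (by simp)]
  by_cases h : b = b' <;> simp [h, lf]

theorem lf_dvd_iff {a b : ℕ} {c : ℂ} {f : RR} :
    lf a b c ∣ f ↔ sb (Sum.inr b) (C c * yv a) f = 0 := by
  constructor
  · rintro ⟨g, rfl⟩
    rw [map_mul, sb_lf, if_pos rfl, sub_self, zero_mul]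
  · intro h
    have := dvd_sub_of_forall_X (φ := AlgHom.id ℂ RR) (ψ := sb (Sum.inr b) (C c * yv a))
      (l := lf a b c) (fun v => ?_) f
    · rwa [h, sub_zero] at this
    · rw [sb_X]
      split_ifs with hv
      · rw [hv]; exact dvd_rfl
      · simp

theorem lf_ne_zero (a b : ℕ) (c : ℂ) : lf a b c ≠ 0 := by
  intro h
  have := congrArg (sb (Sum.inr b) (C c * yv a + 1)) h
  rw [sb_lf, if_pos rfl, map_zero] at this
  simp at this

theorem lf_prime (a b : ℕ) (c : ℂ) : Prime (lf a b c) := by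
  refine ⟨lf_ne_zero a b c, fun h => ?_, fun f g h => ?_⟩
  · have := h.map (sb (Sum.inr b) (C c * yv a))
    rw [sb_lf, if_pos rfl, sub_self] at this
    exact not_isUnit_zero this
  · simpa only [lf_dvd_iff, map_mul, mul_eq_zero] using h

theorem not_lf_dvd {a b a' b' : ℕ} {c c' : ℂ} (h0 : c = 0 → a = 0) (h0' : c' = 0 → a' = 0)
    (h : (a, b, c) ≠ (a', b', c')) : ¬ lf a b c ∣ lf a' b' c' := by
  rw [lf_dvd_iff, sb_lf]
  have key : ∀ u v : ℕ ⊕ ℕ, ∀ k : ℂ, u ≠ v → X u - C k * X v ≠ (0 : RR) := fun u v k huv h => by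
    have := congrArg (sb u 1) (congrArg (sb v 0) h)
    simp [sb_C_mul, sb_X, huv] at this
  split_ifs with hb
  · intro he
    rw [sub_eq_zero] at he
    by_cases ha : a = a'
    · subst ha
      have := mul_right_cancel₀ (X_ne_zero _) he
      exact h (by rw [hb, C_injective _ _ this])
    · have e1 := congrArg (sb (Sum.inl a') 0) he
      have e2 := congrArg (sb (Sum.inl a) 0) he
      simp [sb_C_mul, sb_X, ha, Ne.symm ha] at e1 e2
      exact ha (by rw [h0 e1, h0' e2])
  · exact key _ _ _ (by simp)

theorem mem_gra {A : Subalgebra ℂ RR} {d : ℤ} {f : RR} :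
    f ∈ gr (Subalgebra.toSubmodule A) d ↔ f ∈ A ∧ f ∈ hs ℂ (ℕ ⊕ ℕ) d := Iff.rfl

/-- The product of the linear forms `z_b - c y_a` with `a < n` and `b < m`. -/
def EE (c : ℂ) (n m : ℕ) : RR := ∏ x ∈ Finset.range n ×ˢ Finset.range m, lf x.1 x.2 c

theorem EE_ne_zero (c : ℂ) (n m : ℕ) : EE c n m ≠ 0 :=
  Finset.prod_ne_zero_iff.2 fun _ _ => lf_ne_zero _ _ _

theorem EE_dvd {c : ℂ} {n m : ℕ} (hc : c = 0 → n ≤ 1) {f : RR}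
    (h : ∀ a < n, ∀ b < m, lf a b c ∣ f) : EE c n m ∣ f := by
  refine Finset.prod_dvd_of_isRelPrime (fun x hx y hy hxy => ?_) fun x hx => ?_
  · rw [Finset.mem_coe, Finset.mem_product, Finset.mem_range, Finset.mem_range] at hx hy
    refine ((lf_prime _ _ _).irreducible.isRelPrime_iff_not_dvd).2
      (not_lf_dvd (fun h => ?_) (fun h => ?_) fun h => hxy ?_)
    · have := hc h; omega
    · have := hc h; omega
    · simp only [Prod.mk.injEq] at h
      exact Prod.ext h.1 h.2.1
  · rw [Finset.mem_product, Finset.mem_range, Finset.mem_range] at hx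
    exact h _ hx.1 _ hx.2

theorem EE_mul_dvd {c c' : ℂ} {n n' m m' : ℕ} (hc : c = 0 → n ≤ 1) (hc' : c' = 0 → n' ≤ 1)
    (hcc : c ≠ c') {f : RR} (h : EE c n m ∣ f) (h' : EE c' n' m' ∣ f) :
    EE c n m * EE c' n' m' ∣ f := by
  refine IsRelPrime.mul_dvd ?_ h h'
  refine IsRelPrime.prod_left fun x hx => IsRelPrime.prod_right fun y hy => ?_
  rw [Finset.mem_product, Finset.mem_range, Finset.mem_range] at hx hy
  refine ((lf_prime _ _ _).irreducible.isRelPrime_iff_not_dvd).2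
    (not_lf_dvd (fun h => ?_) (fun h => ?_) fun h => hcc ?_)
  · have := hc h; omega
  · have := hc' h; omega
  · simp only [Prod.mk.injEq] at h
    exact h.2.2

theorem EE_mem_hs (c : ℂ) (n m : ℕ) : EE c n m ∈ hs ℂ (ℕ ⊕ ℕ) ((n * m : ℕ) : ℤ) := by
  have : ∀ T : Finset (ℕ × ℕ), ∏ x ∈ T, lf x.1 x.2 c ∈ hs ℂ (ℕ ⊕ ℕ) (T.card : ℤ) := fun T => by
    induction T using Finset.induction_on with
    | empty => simpa using one_mem_hs
    | insert x T hx ih =>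
      rw [Finset.prod_insert hx, Finset.card_insert_of_notMem hx, add_comm]
      push_cast
      exact mul_mem_hs (lf_mem_hs _ _ _) ih
  simpa [EE] using this (Finset.range n ×ˢ Finset.range m)

theorem sw_lf (u v : ℕ ⊕ ℕ) (a b : ℕ) (c : ℂ) :
    sw u v (lf a b c) = X (Equiv.swap u v (Sum.inr b)) - C c * X (Equiv.swap u v (Sum.inl a)) := by
  rw [lf, map_sub, map_mul, sw_X, sw_X, ← algebraMap_eq, AlgHom.commutes]

theorem swap_lt {n i j a : ℕ} (hi : i < n) (hj : j < n) : Equiv.swap i j a < n ↔ a < n := by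
  simp only [Equiv.swap_apply_def]
  split_ifs <;> omega

theorem swap_inl (i j a : ℕ) :
    Equiv.swap (Sum.inl i : ℕ ⊕ ℕ) (Sum.inl j) (Sum.inl a) = Sum.inl (Equiv.swap i j a) := by
  simp only [Equiv.swap_apply_def, Sum.inl.injEq]
  split_ifs <;> rfl

theorem swap_inr (i j a : ℕ) :
    Equiv.swap (Sum.inr i : ℕ ⊕ ℕ) (Sum.inr j) (Sum.inr a) = Sum.inr (Equiv.swap i j a) := by
  simp only [Equiv.swap_apply_def, Sum.inr.injEq]
  split_ifs <;> rfl

theorem swap_inl_inr (i j a : ℕ) :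
    Equiv.swap (Sum.inl i : ℕ ⊕ ℕ) (Sum.inl j) (Sum.inr a) = Sum.inr a := by
  simp [Equiv.swap_apply_def]

theorem swap_inr_inl (i j a : ℕ) :
    Equiv.swap (Sum.inr i : ℕ ⊕ ℕ) (Sum.inr j) (Sum.inl a) = Sum.inl a := by
  simp [Equiv.swap_apply_def]

theorem sw_inl_lf (i j a b : ℕ) (c : ℂ) :
    sw (Sum.inl i) (Sum.inl j) (lf a b c) = lf (Equiv.swap i j a) b c := by
  rw [sw_lf, swap_inl, swap_inl_inr]; rfl

theorem sw_inr_lf (i j a b : ℕ) (c : ℂ) :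
    sw (Sum.inr i) (Sum.inr j) (lf a b c) = lf a (Equiv.swap i j b) c := by
  rw [sw_lf, swap_inr, swap_inr_inl]; rfl

theorem EE_mem_Inv (c : ℂ) {n n' m : ℕ} (hn : n ≤ n') (h : n = n' ∨ c = 0) :
    EE c n m ∈ Inv n' m := by
  refine mem_Inv.2 ⟨prod_mem fun x hx => ?_, ?_⟩
  · rw [Finset.mem_product, Finset.mem_range, Finset.mem_range] at hx
    exact lf_mem_W (hx.1.trans_le hn) hx.2 c
  · rintro u v (⟨i, hi, j, hj, huv⟩ | ⟨i, hi, j, hj, huv⟩) <;> obtain ⟨rfl, rfl⟩ := Prod.mk.inj huv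
    · rw [EE, map_prod]
      simp only [sw_inl_lf]
      rcases h with rfl | rfl
      · refine Finset.prod_equiv ((Equiv.swap i j).prodCongr (Equiv.refl ℕ)) (fun x => ?_)
          fun x _ => rfl
        simp [swap_lt hi hj]
      · simp [lf]
    · rw [EE, map_prod]
      simp only [sw_inr_lf]
      refine Finset.prod_equiv ((Equiv.refl ℕ).prodCongr (Equiv.swap i j)) (fun x => ?_)
          fun x _ => rfl
      simp [swap_lt hi hj]

theorem sw_sb {u v w : ℕ ⊕ ℕ} (hu : w ≠ u) (hv : w ≠ v) (p f : RR) :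
    sw u v (sb w p f) = sb w (sw u v p) (sw u v f) := by
  have : (sw u v).comp (sb w p) = (sb w (sw u v p)).comp (sw u v) := by
    ext1 t
    simp only [AlgHom.comp_apply, sb_X, sw_X]
    have : Equiv.swap u v t = w ↔ t = w := by
      rw [Equiv.swap_apply_eq_iff, Equiv.swap_apply_of_ne_of_ne hu hv]
    by_cases h : t = w
    · rw [if_pos h, if_pos (this.2 h)]
    · rw [if_neg h, if_neg (mt this.1 h), sw_X]
  exact DFunLike.congr_fun this f

/-- Setting `z_m = 0`. -/
abbrev kz (m : ℕ) : RR →ₐ[ℂ] RR := sb (Sum.inr m) 0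

theorem linHom_kz (m : ℕ) : LinHom (kz m) := linHom_sb (zero_mem _)

theorem kz_py (m n i : ℕ) : kz m (py n i) = py n i := by
  simp [py, sb_X]

theorem kz_pz (m i : ℕ) : kz m (pz (m + 1) i) = pz m i := by
  simp only [pz, Finset.sum_range_succ, map_add, map_sum, map_pow, sb_X_self]
  rw [zero_pow (Nat.succ_ne_zero i), add_zero]
  refine Finset.sum_congr rfl fun b hb => ?_
  rw [sb_X_ne]
  simpa using (Finset.mem_range.1 hb).ne

theorem kz_mem_W {n m : ℕ} {f : RR} (hf : f ∈ W n (m + 1)) : kz m f ∈ W n m := by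
  refine map_supported_le (fun w hw => ?_) hf
  rw [sb_X]
  split_ifs with h
  · exact zero_mem _
  · refine X_mem_supported ?_
    rcases w with a | b
    · exact hw
    · have h1 : b < m + 1 := hw
      have h2 : b ≠ m := fun hb => h (by rw [hb])
      exact inr_mem_V.2 (by omega)

theorem kz_mem_Inv {n m : ℕ} {f : RR} (hf : f ∈ Inv n (m + 1)) : kz m f ∈ Inv n m := by
  rw [mem_Inv] at *
  refine ⟨kz_mem_W hf.1, fun u v h => ?_⟩
  have hne : Sum.inr m ≠ u ∧ Sum.inr m ≠ v := by
    rcases h with ⟨a, ha, b, hb, h⟩ | ⟨a, ha, b, hb, h⟩ <;> obtain ⟨rfl, rfl⟩ := Prod.mk.inj h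
    · simp
    · simp; omega
  rw [sw_sb hne.1 hne.2, map_zero, hf.2 u v (Sw_mono le_rfl (Nat.le_succ m) h)]

theorem map_kz_S (n m : ℕ) : (S n (m + 1)).map (kz m) = S n m := by
  rw [S, AlgHom.map_adjoin, Set.image_union, ← Set.range_comp, ← Set.range_comp]
  congr 2
  · congr 1; ext1 i; exact kz_py m n i
  · congr 1; ext1 i; exact kz_pz m i

theorem exists_lift_S {n m : ℕ} {d : ℤ} {f : RR} (hf : f ∈ gr (Subalgebra.toSubmodule (S n m)) d) :
    ∃ g ∈ gr (Subalgebra.toSubmodule (S n (m + 1))) d, kz m g = f := by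
  have := hf.1
  change f ∈ S n m at this
  rw [← map_kz_S] at this
  obtain ⟨g, hg, rfl⟩ := this
  refine ⟨comp d g, (grd_S n (m + 1)).comp_mem hg, ?_⟩
  rw [← (linHom_kz m).comp]
  exact comp_of_mem hf.2

theorem EE_zero_dvd {n m : ℕ} {f : RR} (hf : f ∈ Inv n (m + 1)) (h : kz m f = 0) :
    EE 0 1 (m + 1) ∣ f := by
  refine EE_dvd (fun _ => le_rfl) fun a ha b hb => ?_
  have h1 : lf a m 0 ∣ f := lf_dvd_iff.2 (by simpa using h)
  have h2 := map_dvd (sw (Sum.inr m) (Sum.inr b)) h1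
  rwa [sw_inr_lf, Equiv.swap_apply_left,
    (mem_Inv.1 hf).2 _ _ (Or.inr ⟨m, by omega, b, hb, rfl⟩)] at h2

theorem EE_zero_mem_S (n m : ℕ) : EE 0 1 m ∈ S n m := by
  have : EE 0 1 m = ∏ b ∈ Finset.range m, zv b := by
    simp [EE, lf]
  rw [this]
  exact prod_mem_of_psums_mem _ _ _ (pz_mem_S n m)

theorem Inv_le_S_succ {n m : ℕ} (h : Inv n m ≤ S n m) : Inv n (m + 1) ≤ S n (m + 1) := by
  have key : ∀ d : ℤ, ∀ f ∈ Inv n (m + 1), f ∈ hs ℂ (ℕ ⊕ ℕ) d → f ∈ S n (m + 1) := by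
    intro d
    induction d using int_induction with
    | h0 d hd =>
      intro f _ hf
      rw [hs_neg hd, Submodule.mem_bot] at hf
      rw [hf]; exact zero_mem _
    | h d hd ih =>
      intro f hf hfd
      obtain ⟨g, ⟨hg, hgd⟩, hgf⟩ := exists_lift_S (n := n) (m := m)
        (⟨h (kz_mem_Inv hf), (linHom_kz m).mem_hs hfd⟩)
      have hsub := sub_mem hf (S_le_Inv _ _ hg)
      obtain ⟨e, he⟩ := EE_zero_dvd hsub (by rw [map_sub, hgf, sub_self])
      have hE := EE_zero_mem_S n (m + 1)
      have he1 : e ∈ Inv n (m + 1) :=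
        mem_Inv_of_mul (S_le_Inv _ _ hE) (EE_ne_zero _ _ _) (he ▸ hsub)
      have he2 := mem_of_mul_mem_hs (EE_mem_hs 0 1 (m + 1)) (EE_ne_zero _ _ _)
        (he ▸ sub_mem hfd hgd)
      have := ih _ (by push_cast; omega) e he1 he2
      rw [← sub_add_cancel f g, he]
      exact add_mem (mul_mem hE this) hg
  exact fun f hf => mem_of_comp (W := Subalgebra.toSubmodule (S n (m + 1))) fun d =>
    key d _ (comp_mem_Inv hf d) (comp_mem_hs d f)

/-- Exchange of the two families of variables. -/
def tau : RR →ₐ[ℂ] RR := rename Sum.swap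

@[simp] theorem tau_X (v : ℕ ⊕ ℕ) : tau (X v) = X v.swap := rename_X _ _

theorem tau_tau (f : RR) : tau (tau f) = f := by
  have : tau.comp tau = AlgHom.id ℂ _ := by ext; simp
  exact DFunLike.congr_fun this f

theorem linHom_tau : LinHom tau := fun v => by rw [tau_X]; exact X_mem_hs _

theorem tau_mem_W {n m : ℕ} {f : RR} (hf : f ∈ W n m) : tau f ∈ W m n := by
  refine map_supported_le (fun v hv => ?_) hf
  rw [tau_X]
  refine X_mem_supported ?_
  rcases v with a | b <;> exact hv

theorem tau_sw (u v : ℕ ⊕ ℕ) (f : RR) : tau (sw u v f) = sw u.swap v.swap (tau f) := by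
  have : tau.comp (sw u v) = (sw u.swap v.swap).comp tau := by
    ext1 w
    simp only [AlgHom.comp_apply, sw_X, tau_X]
    exact congrArg X ((Equiv.sumComm ℕ ℕ).injective.map_swap u v w)
  exact DFunLike.congr_fun this f

theorem tau_mem_Inv {n m : ℕ} {f : RR} (hf : f ∈ Inv n m) : tau f ∈ Inv m n := by
  rw [mem_Inv] at *
  refine ⟨tau_mem_W hf.1, fun u v h => ?_⟩
  have : sw u.swap v.swap f = f := hf.2 _ _ (by
    rcases h with ⟨a, ha, b, hb, h⟩ | ⟨a, ha, b, hb, h⟩ <;> obtain ⟨rfl, rfl⟩ := Prod.mk.inj h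
    · exact Or.inr ⟨a, ha, b, hb, rfl⟩
    · exact Or.inl ⟨a, ha, b, hb, rfl⟩)
  conv_rhs => rw [← this]
  rw [tau_sw, Sum.swap_swap, Sum.swap_swap]

theorem tau_py (n i : ℕ) : tau (py n i) = pz n i := by simp [py, pz]

theorem tau_pz (n i : ℕ) : tau (pz n i) = py n i := by simp [py, pz]

theorem map_tau_S (n m : ℕ) : (S n m).map tau = S m n := by
  rw [S, AlgHom.map_adjoin, Set.image_union, ← Set.range_comp, ← Set.range_comp, Set.union_comm]
  congr 2
  · congr 1; ext1 i; exact tau_pz m i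
  · congr 1; ext1 i; exact tau_py n i

theorem tau_mem_S {n m : ℕ} {f : RR} (hf : f ∈ S n m) : tau f ∈ S m n := by
  rw [← map_tau_S]; exact ⟨f, hf, rfl⟩

theorem Inv_le_S_comm {n m : ℕ} (h : Inv n m ≤ S n m) : Inv m n ≤ S m n := fun f hf => by
  have := tau_mem_S (h (tau_mem_Inv hf))
  rwa [tau_tau] at this

/-- The fundamental theorem of symmetric polynomials for two families of variables. -/
theorem Inv_eq_S (n m : ℕ) : Inv n m = S n m := by
  refine le_antisymm ?_ (S_le_Inv n m)
  have h0 : Inv 0 0 ≤ S 0 0 := fun f hf => by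
    have h1 := (mem_Inv.1 hf).1
    have : V 0 0 = ∅ := by
      ext (a | b) <;> simp
    rw [W, this, supported_empty] at h1
    exact bot_le (a := S 0 0) h1
  have h1 : ∀ n, Inv n 0 ≤ S n 0 := fun n => by
    induction n with
    | zero => exact h0
    | succ n ih => exact Inv_le_S_comm (Inv_le_S_succ (Inv_le_S_comm ih))
  induction m with
  | zero => exact h1 n
  | succ m ih => exact Inv_le_S_succ ih

/-! ### Hilbert series -/

/-- The Hilbert series of a graded subspace. -/
def hilb (M : Submodule ℂ RR) : PowerSeries ℚ :=
  PowerSeries.mk fun k => (Module.finrank ℂ (gr M (k : ℤ)) : ℚ)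

theorem hilb_add {M N L : Submodule ℂ RR} {e : ℕ}
    (h : ∀ d : ℤ, Module.finrank ℂ (gr M d) =
      Module.finrank ℂ (gr N d) + Module.finrank ℂ (gr L (d - e))) :
    hilb M = hilb N + PowerSeries.X ^ e * hilb L := by
  ext k
  rw [map_add, PowerSeries.coeff_X_pow_mul']
  simp only [hilb, PowerSeries.coeff_mk]
  rw [h k, Nat.cast_add]
  split_ifs with hk
  · rw [Nat.cast_sub hk]
  · rw [gr_neg L (by omega)]
    simp

instance (n m : ℕ) (d : ℤ) : FiniteDimensional ℂ (gr (Subalgebra.toSubmodule (W n m)) d) :=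
  finiteDimensional_gr_of_le (V_finite n m) le_rfl d

instance (n m : ℕ) (d : ℤ) : FiniteDimensional ℂ (gr (Subalgebra.toSubmodule (S n m)) d) :=
  finiteDimensional_gr_of_le (V_finite n m) (S_le_W n m) d

theorem finrank_S_succ (n m : ℕ) (d : ℤ) :
    Module.finrank ℂ (gr (Subalgebra.toSubmodule (S n (m + 1))) d) =
      Module.finrank ℂ (gr (Subalgebra.toSubmodule (S n m)) d) +
      Module.finrank ℂ (gr (Subalgebra.toSubmodule (S n (m + 1))) (d - (m + 1 : ℕ))) := by
  have hE := EE_zero_mem_S n (m + 1)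
  have hE' := EE_mem_hs 0 1 (m + 1)
  rw [one_mul] at hE'
  refine finrank_of_exact (kz m).toLinearMap (EE 0 1 (m + 1)) (EE_ne_zero _ _ _) ?_ ?_ ?_ ?_
  · rintro v ⟨hv, hvd⟩
    refine ⟨?_, (linHom_kz m).mem_hs hvd⟩
    rw [← map_kz_S]
    exact ⟨v, hv, rfl⟩
  · exact fun w hw => exists_lift_S hw
  · rintro v ⟨hv, hvd⟩
    refine ⟨mem_gra.2 ⟨mul_mem hE hv, ?_⟩, ?_⟩
    · have := mul_mem_hs hE' hvd
      rwa [add_sub_cancel] at this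
    · have : EE 0 1 (m + 1) = ∏ b ∈ Finset.range (m + 1), zv b := by
        simp [EE, lf]
      simp [this, Finset.prod_range_succ]
  · rintro v ⟨hv, hvd⟩ h0
    obtain ⟨w, rfl⟩ := EE_zero_dvd (S_le_Inv _ _ hv) h0
    refine ⟨w, ⟨?_, mem_of_mul_mem_hs hE' (EE_ne_zero _ _ _) hvd⟩, rfl⟩
    change w ∈ S n (m + 1)
    rw [← Inv_eq_S]
    exact mem_Inv_of_mul (S_le_Inv _ _ hE) (EE_ne_zero _ _ _) (S_le_Inv _ _ hv)

theorem finrank_S_comm (n m : ℕ) (d : ℤ) :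
    Module.finrank ℂ (gr (Subalgebra.toSubmodule (S n m)) d) =
      Module.finrank ℂ (gr (Subalgebra.toSubmodule (S m n)) d) := by
  have h : ∀ n m, ∀ f ∈ gr (Subalgebra.toSubmodule (S n m)) d,
      tau f ∈ gr (Subalgebra.toSubmodule (S m n)) d :=
    fun n m f hf => ⟨tau_mem_S hf.1, linHom_tau.mem_hs hf.2⟩
  refine (LinearEquiv.ofLinearMap (tau.toLinearMap.restrict (h n m))
    (tau.toLinearMap.restrict (h m n)) ?_ ?_).finrank_eq <;>
  · ext1 f
    exact Subtype.ext (tau_tau _)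

/-- The product `(u;u)_m`. -/
def qp (m : ℕ) : PowerSeries ℚ := ∏ k ∈ Finset.range m, (1 - PowerSeries.X ^ (k + 1))

theorem qp_succ (m : ℕ) : qp (m + 1) = qp m * (1 - PowerSeries.X ^ (m + 1)) :=
  Finset.prod_range_succ _ _

theorem hilb_S_succ (n m : ℕ) :
    hilb (Subalgebra.toSubmodule (S n (m + 1))) * (1 - PowerSeries.X ^ (m + 1)) =
      hilb (Subalgebra.toSubmodule (S n m)) := by
  have := hilb_add (finrank_S_succ n m)
  linear_combination this

theorem hilb_S (n m : ℕ) : hilb (Subalgebra.toSubmodule (S n m)) * (qp n * qp m) = 1 := by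
  have hc : ∀ n m, hilb (Subalgebra.toSubmodule (S n m)) = hilb (Subalgebra.toSubmodule (S m n)) :=
    fun n m => by ext k; simp [hilb, finrank_S_comm n m]
  have h0 : hilb (Subalgebra.toSubmodule (S 0 0)) = 1 := by
    have hS : S 0 0 = ⊥ := by
      refine le_bot_iff.1 (Algebra.adjoin_le ?_)
      rintro _ (⟨i, rfl⟩ | ⟨i, rfl⟩) <;> simp [py, pz]
    ext k
    rw [hilb, PowerSeries.coeff_mk, PowerSeries.coeff_one, hS]
    split_ifs with hk
    · subst hk
      have : gr (Subalgebra.toSubmodule (⊥ : Subalgebra ℂ RR)) (0 : ℕ) = ℂ ∙ (1 : RR) := by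
        rw [Algebra.toSubmodule_bot, Submodule.one_eq_span, gr, inf_eq_left, Submodule.span_le]
        rintro _ rfl
        exact one_mem_hs
      rw [this, finrank_span_singleton one_ne_zero, Nat.cast_one]
    · have : gr (Subalgebra.toSubmodule (⊥ : Subalgebra ℂ RR)) (k : ℕ) = ⊥ := by
        refine (Submodule.eq_bot_iff _).2 ?_
        rintro f ⟨hf, hfd⟩
        obtain ⟨c, rfl⟩ := Algebra.mem_bot.1 hf
        rw [← comp_of_mem hfd]
        exact comp_of_ne (C_mem_hs c) (by exact_mod_cast hk)
      rw [this, finrank_bot, Nat.cast_zero]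
  have h1 : ∀ n, hilb (Subalgebra.toSubmodule (S n 0)) * qp n = 1 := fun n => by
    induction n with
    | zero => rw [h0, qp]; simp
    | succ n ih =>
      rw [qp_succ, hc]
      rw [hc] at ih
      linear_combination ih + qp n * hilb_S_succ 0 n
  induction m with
  | zero =>
    have := h1 n
    rw [show qp 0 = 1 from rfl]
    linear_combination this
  | succ m ih =>
    rw [qp_succ]
    linear_combination ih + qp n * qp m * hilb_S_succ n m

/-! ### Deformed power sums -/

/-- The deformed power sum `κ_i ∑ y_a^{i+1} + ∑ z_b^{i+1}`. -/
def P (κ : ℕ → ℂ) (n m i : ℕ) : RR := C (κ i) * py n i + pz m i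

/-- The algebra generated by the deformed power sums. -/
def Lam (κ : ℕ → ℂ) (n m : ℕ) : Subalgebra ℂ RR := Algebra.adjoin ℂ (Set.range (P κ n m))

theorem P_mem_Lam (κ : ℕ → ℂ) (n m i : ℕ) : P κ n m i ∈ Lam κ n m :=
  Algebra.subset_adjoin ⟨i, rfl⟩

theorem P_mem_hs (κ : ℕ → ℂ) (n m i : ℕ) : P κ n m i ∈ hs ℂ (ℕ ⊕ ℕ) (i + 1) :=
  add_mem (C_mul_mem_hs _ (py_mem_hs n i)) (pz_mem_hs m i)

theorem P_mem_S (κ : ℕ → ℂ) (n m i : ℕ) : P κ n m i ∈ S n m :=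
  add_mem (mul_mem (Subalgebra.algebraMap_mem _ _) (py_mem_S n m i)) (pz_mem_S n m i)

theorem Lam_le_S (κ : ℕ → ℂ) (n m : ℕ) : Lam κ n m ≤ S n m := by
  refine Algebra.adjoin_le ?_
  rintro _ ⟨i, rfl⟩
  exact P_mem_S κ n m i

theorem grd_Lam (κ : ℕ → ℂ) (n m : ℕ) : Grd (Subalgebra.toSubmodule (Lam κ n m)) :=
  grd_adjoin (by rintro _ ⟨i, rfl⟩; exact ⟨_, P_mem_hs κ n m i⟩)

theorem alg_C_mul (φ : RR →ₐ[ℂ] RR) (c : ℂ) (f : RR) : φ (C c * f) = C c * φ f := by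
  rw [map_mul, ← algebraMap_eq, AlgHom.commutes]

theorem alg_C (φ : RR →ₐ[ℂ] RR) (c : ℂ) : φ (C c) = C c := by
  rw [← algebraMap_eq, AlgHom.commutes]

theorem kz_P (κ : ℕ → ℂ) (n m i : ℕ) : kz m (P κ n (m + 1) i) = P κ n m i := by
  rw [P, map_add, alg_C_mul, kz_py, kz_pz]; rfl

theorem map_kz_Lam (κ : ℕ → ℂ) (n m : ℕ) : (Lam κ n (m + 1)).map (kz m) = Lam κ n m := by
  rw [Lam, AlgHom.map_adjoin, ← Set.range_comp]
  congr 2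
  ext1 i
  exact kz_P κ n m i

theorem exists_lift_Lam {κ : ℕ → ℂ} {n m : ℕ} {d : ℤ} {f : RR}
    (hf : f ∈ gr (Subalgebra.toSubmodule (Lam κ n m)) d) :
    ∃ g ∈ gr (Subalgebra.toSubmodule (Lam κ n (m + 1))) d, kz m g = f := by
  have : f ∈ Lam κ n m := hf.1
  rw [← map_kz_Lam] at this
  obtain ⟨g, hg, rfl⟩ := this
  refine ⟨comp d g, (grd_Lam κ n (m + 1)).comp_mem hg, ?_⟩
  rw [← (linHom_kz m).comp]
  exact comp_of_mem hf.2

theorem Lam_zero_right {κ : ℕ → ℂ} (hκ : ∀ i, κ i ≠ 0) (n : ℕ) : Lam κ n 0 = S n 0 := by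
  refine le_antisymm (Lam_le_S κ n 0) (Algebra.adjoin_le ?_)
  have h0 : ∀ i, pz 0 i = 0 := fun i => by simp [pz]
  rintro _ (⟨i, rfl⟩ | ⟨i, rfl⟩)
  · have h := mul_mem (Subalgebra.algebraMap_mem (Lam κ n 0) (κ i)⁻¹) (P_mem_Lam κ n 0 i)
    rwa [P, h0, add_zero, algebraMap_eq, ← mul_assoc, ← C_mul, inv_mul_cancel₀ (hκ i), C_1,
      one_mul] at h
  · rw [h0]; exact zero_mem _

theorem Lam_zero_left (κ : ℕ → ℂ) (m : ℕ) : Lam κ 0 m = S 0 m := by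
  refine le_antisymm (Lam_le_S κ 0 m) (Algebra.adjoin_le ?_)
  have h0 : ∀ i, py 0 i = 0 := fun i => by simp [py]
  rintro _ (⟨i, rfl⟩ | ⟨i, rfl⟩)
  · rw [h0]; exact zero_mem _
  · have h := P_mem_Lam κ 0 m i
    rwa [P, h0, mul_zero, zero_add] at h

/-- The substitution `y_a ↦ α y_a`, `z_b ↦ β y_a`. -/
def sub (α β : ℂ) (a b : ℕ) : RR →ₐ[ℂ] RR :=
  aeval (Sum.elim (fun i => if i = a then C α * yv a else yv i)
    (fun j => if j = b then C β * yv a else zv j))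

@[simp] theorem sub_y (α β : ℂ) (a b i : ℕ) :
    sub α β a b (yv i) = if i = a then C α * yv a else yv i := by simp [sub]

@[simp] theorem sub_z (α β : ℂ) (a b j : ℕ) :
    sub α β a b (zv j) = if j = b then C β * yv a else zv j := by simp [sub]

theorem linHom_sub (α β : ℂ) (a b : ℕ) : LinHom (sub α β a b) := by
  rintro (i | j)
  · rw [sub_y]
    split_ifs
    exacts [C_mul_mem_hs _ (X_mem_hs _), X_mem_hs _]
  · rw [sub_z]
    split_ifs
    exacts [C_mul_mem_hs _ (X_mem_hs _), X_mem_hs _]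

theorem sub_py (α β : ℂ) {a b n : ℕ} (ha : a < n) (i : ℕ) :
    sub α β a b (py n i) = py n i + C (α ^ (i + 1) - 1) * yv a ^ (i + 1) := by
  have h : ∀ j, sub α β a b (yv j ^ (i + 1)) =
      yv j ^ (i + 1) + if j = a then C (α ^ (i + 1) - 1) * yv a ^ (i + 1) else 0 := fun j => by
    rw [map_pow, sub_y]
    split_ifs with hj
    · rw [hj, mul_pow, ← C_pow, map_sub, C_1]; ring
    · rw [add_zero]
  rw [py, map_sum, Finset.sum_congr rfl fun j _ => h j, Finset.sum_add_distrib,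
    Finset.sum_ite_eq', if_pos (Finset.mem_range.2 ha)]

theorem sub_pz (α β : ℂ) {a b m : ℕ} (hb : b < m) (i : ℕ) :
    sub α β a b (pz m i) = pz m i - zv b ^ (i + 1) + C (β ^ (i + 1)) * yv a ^ (i + 1) := by
  have h : ∀ j, sub α β a b (zv j ^ (i + 1)) =
      zv j ^ (i + 1) + if j = b then - zv b ^ (i + 1) + C (β ^ (i + 1)) * yv a ^ (i + 1) else 0 :=
    fun j => by
      rw [map_pow, sub_z]
      split_ifs with hj
      · rw [hj, mul_pow, ← C_pow]; ring
      · rw [add_zero]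
  rw [pz, map_sum, Finset.sum_congr rfl fun j _ => h j, Finset.sum_add_distrib,
    Finset.sum_ite_eq', if_pos (Finset.mem_range.2 hb)]
  ring

theorem sub_P (κ : ℕ → ℂ) (α β : ℂ) {a b n m : ℕ} (ha : a < n) (hb : b < m) (i : ℕ) :
    sub α β a b (P κ n m i) = P κ n m i - zv b ^ (i + 1) +
      C (κ i * (α ^ (i + 1) - 1) + β ^ (i + 1)) * yv a ^ (i + 1) := by
  rw [P, map_add, alg_C_mul, sub_py α β ha, sub_pz α β hb, C_add, C_mul]
  ring

/-- Polynomials satisfying the deformed cancellation condition. -/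
def Q (q t : ℂ) (n m : ℕ) : Subalgebra ℂ RR :=
  S n m ⊓ ⨅ e : Fin n × Fin m, AlgHom.equalizer (sub 1 1 e.1 e.2) (sub t q e.1 e.2)

theorem mem_Q {q t : ℂ} {n m : ℕ} {f : RR} :
    f ∈ Q q t n m ↔ f ∈ S n m ∧ ∀ a < n, ∀ b < m, sub 1 1 a b f = sub t q a b f := by
  simp only [Q, Algebra.mem_inf, Algebra.mem_iInf, AlgHom.mem_equalizer]
  exact and_congr_right fun _ => ⟨fun h a ha b hb => h ⟨⟨a, ha⟩, ⟨b, hb⟩⟩,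
    fun h e => h _ e.1.2 _ e.2.2⟩

/-- The relation between the coefficients `κ` and the parameters. -/
def Rel (κ : ℕ → ℂ) (q t : ℂ) : Prop := ∀ i, κ i * (1 - t ^ (i + 1)) = q ^ (i + 1) - 1

theorem Rel.sub_P {κ : ℕ → ℂ} {q t : ℂ} (h : Rel κ q t) {a b n m : ℕ} (ha : a < n) (hb : b < m)
    (i : ℕ) : sub 1 1 a b (P κ n m i) = sub t q a b (P κ n m i) := by
  rw [AqtCM.sub_P κ 1 1 ha hb, AqtCM.sub_P κ t q ha hb]
  congr 3
  linear_combination (h i)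

theorem Rel.Lam_le_Q {κ : ℕ → ℂ} {q t : ℂ} (h : Rel κ q t) (n m : ℕ) : Lam κ n m ≤ Q q t n m := by
  refine Algebra.adjoin_le ?_
  rintro _ ⟨i, rfl⟩
  exact mem_Q.2 ⟨P_mem_S κ n m i, fun a ha b hb => h.sub_P ha hb i⟩

theorem rel_zero : Rel (fun _ => -1) 0 0 := fun i => by simp

theorem kz_sub (α β : ℂ) (a : ℕ) {b m : ℕ} (hb : b ≠ m) (f : RR) :
    kz m (sub α β a b f) = sub α β a b (kz m f) := by
  have : (kz m).comp (sub α β a b) = (sub α β a b).comp (kz m) := by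
    ext1 v
    simp only [AlgHom.comp_apply]
    rcases v with i | j
    · rw [sub_y, sb_X_ne _ (by simp), sub_y]
      split_ifs
      · rw [alg_C_mul, sb_X_ne _ (by simp)]
      · rw [sb_X_ne _ (by simp)]
    · rw [sub_z, sb_X]
      by_cases h : j = m
      · subst h
        rw [if_neg (Ne.symm hb), if_pos rfl, map_zero, sb_X_self]
      · have hj : (Sum.inr j : ℕ ⊕ ℕ) ≠ Sum.inr m := by simpa using h
        rw [if_neg hj, sub_z]
        split_ifs
        · rw [alg_C_mul, sb_X_ne _ (by simp)]
        · rw [sb_X_ne _ hj]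
  exact DFunLike.congr_fun this f

theorem kz_mem_Q {q t : ℂ} {n m : ℕ} {f : RR} (hf : f ∈ Q q t n (m + 1)) : kz m f ∈ Q q t n m := by
  rw [mem_Q] at *
  refine ⟨?_, fun a ha b hb => ?_⟩
  · rw [← map_kz_S]
    exact ⟨f, hf.1, rfl⟩
  · rw [← kz_sub _ _ _ hb.ne, ← kz_sub _ _ _ hb.ne, hf.2 a ha b (by omega)]

theorem sub_one_eq (c : ℂ) (a b : ℕ) : sub 1 c a b = sb (Sum.inr b) (C c * yv a) := by
  ext1 v
  rcases v with i | j
  · rw [sub_y, sb_X_ne _ (by simp)]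
    split_ifs with h
    · rw [h, C_1, one_mul]
    · rfl
  · rw [sub_z, sb_X]
    simp

/-! ### The supersymmetric case -/

/-- The generator of the ideal of supersymmetric polynomials vanishing at `z_{m-1} = 0`. -/
def superE (n m : ℕ) : RR := EE 0 1 m * EE 1 n m

theorem superE_ne_zero (n m : ℕ) : superE n m ≠ 0 := mul_ne_zero (EE_ne_zero _ _ _) (EE_ne_zero _ _ _)

theorem superE_mem_hs (n m : ℕ) : superE n m ∈ hs ℂ (ℕ ⊕ ℕ) ((m * (n + 1) : ℕ) : ℤ) := by
  have := mul_mem_hs (EE_mem_hs 0 1 m) (EE_mem_hs 1 n m)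
  rw [superE]
  convert this using 1
  push_cast
  ring

theorem superE_mem_S (n m : ℕ) : superE n m ∈ S n m := by
  refine mul_mem (EE_zero_mem_S n m) ?_
  rw [← Inv_eq_S]
  exact EE_mem_Inv 1 le_rfl (Or.inl rfl)

theorem kz_EE_zero (m : ℕ) : kz m (EE 0 1 (m + 1)) = 0 := by
  have : EE 0 1 (m + 1) = ∏ b ∈ Finset.range (m + 1), zv b := by
    simp [EE, lf]
  simp [this, Finset.prod_range_succ]

theorem exists_eq_superE_mul {n m : ℕ} {f : RR} (hf : f ∈ Q 0 0 n (m + 1)) (h0 : kz m f = 0) :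
    ∃ h ∈ S n (m + 1), f = superE n (m + 1) * h := by
  rw [mem_Q] at hf
  have h1 := EE_zero_dvd (S_le_Inv _ _ hf.1) h0
  have h2 : EE 1 n (m + 1) ∣ f := EE_dvd (by simp) fun a ha b hb => by
    rw [lf_dvd_iff, ← sub_one_eq, hf.2 a ha b hb]
    have h3 : lf 0 b 0 ∣ f := by
      refine dvd_trans ?_ h1
      exact Finset.dvd_prod_of_mem (fun x : ℕ × ℕ => lf x.1 x.2 0) (a := (0, b))
        (Finset.mem_product.2 ⟨Finset.mem_range.2 one_pos, Finset.mem_range.2 hb⟩)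
    obtain ⟨g, rfl⟩ := h3
    rw [map_mul, lf, map_sub, alg_C_mul, sub_z, if_pos rfl]
    simp
  obtain ⟨h, rfl⟩ := EE_mul_dvd (fun _ => le_rfl) (by simp) zero_ne_one h1 h2
  refine ⟨h, ?_, rfl⟩
  rw [← Inv_eq_S]
  exact mem_Inv_of_mul (S_le_Inv _ _ (superE_mem_S n (m + 1))) (superE_ne_zero _ _)
    (S_le_Inv _ _ hf.1)

/-- The generating function `∏ (1 - y_a u) / ∏ (1 - z_b u)`. -/
def FF (n m : ℕ) : PowerSeries RR := lin (Finset.range n) yv * ∏ b ∈ Finset.range m, geo (zv b)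

theorem lin_mul_prod_geo (s : Finset ℕ) (v : ℕ → RR) : lin s v * ∏ b ∈ s, geo (v b) = 1 := by
  rw [lin, ← Finset.prod_mul_distrib]
  exact Finset.prod_eq_one fun b _ => geo_mul _

theorem derivative_FF (n m : ℕ) : PowerSeries.derivative RR (FF n m) =
    (psums (Finset.range m) zv - psums (Finset.range n) yv) * FF n m := by
  have h1 : lin (Finset.range m) zv * FF n m = lin (Finset.range n) yv := by
    rw [FF, mul_left_comm, lin_mul_prod_geo, mul_one]
  have h2 := congrArg (PowerSeries.derivative RR) h1
  rw [Derivation.leibniz, derivative_lin, derivative_lin, smul_eq_mul, smul_eq_mul] at h2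
  have h3 := lin_mul_prod_geo (Finset.range m) zv
  have h4 : FF n m = lin (Finset.range n) yv * ∏ b ∈ Finset.range m, geo (zv b) := rfl
  linear_combination (∏ b ∈ Finset.range m, geo (zv b)) * h2 -
    (PowerSeries.derivative RR (FF n m)) * h3
    + psums (Finset.range m) zv * FF n m * h3
    + psums (Finset.range n) yv * h4

theorem coeff_FF_mem (n m k : ℕ) : PowerSeries.coeff k (FF n m) ∈ Lam (fun _ => -1) n m := by
  refine coeff_mem_of_derivative (derivative_FF n m) ?_ _ (fun k => ?_) k
  · rw [FF, PowerSeries.coeff_zero_eq_constantCoeff_apply, map_mul, map_prod,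
      ← PowerSeries.coeff_zero_eq_constantCoeff_apply, coeff_zero_lin]
    simp [geo]
  · have := P_mem_Lam (fun _ => -1) n m k
    have e : PowerSeries.coeff k (psums (Finset.range m) zv - psums (Finset.range n) yv) =
        P (fun _ => -1) n m k := by
      simp only [psums, map_sub, PowerSeries.coeff_mk, P, py, pz, C_neg, C_1]
      ring
    rwa [e]

/-- Coefficients of `∏_{c ≠ b} (1 - z_c u)`. -/
def linMat (m : ℕ) : Matrix (Fin m) (Fin m) RR :=
  fun j b => PowerSeries.coeff j.1 (lin ((Finset.range m).erase b) zv)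

theorem sum_linMat {m : ℕ} (F : PowerSeries RR) (N : ℕ) (b : Fin m) :
    ∑ j : Fin m, PowerSeries.coeff N (PowerSeries.X ^ j.1 * F) * linMat m j b =
      PowerSeries.coeff N (lin ((Finset.range m).erase b) zv * F) := by
  have h : lin ((Finset.range m).erase b) zv =
      ∑ j : Fin m, PowerSeries.C (linMat m j b) * PowerSeries.X ^ j.1 := by
    have hdeg : ∀ s : Finset ℕ, ∃ p : Polynomial RR, p.natDegree ≤ s.card ∧
        (p : PowerSeries RR) = lin s zv := fun s => by
      refine ⟨∏ a ∈ s, (1 - Polynomial.C (zv a) * Polynomial.X), ?_, ?_⟩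
      · refine (Polynomial.natDegree_prod_le _ _).trans ?_
        refine (Finset.sum_le_card_nsmul _ _ 1 fun a _ => ?_).trans (by simp)
        compute_degree
      · rw [lin, ← Polynomial.coeToPowerSeries.ringHom_apply, map_prod]
        simp
    obtain ⟨p, hp, hpl⟩ := hdeg ((Finset.range m).erase b)
    rw [Finset.card_erase_of_mem (Finset.mem_range.2 b.2), Finset.card_range] at hp
    have hlt : p.natDegree < m := by have := b.2; omega
    have := p.as_sum_range' m hlt
    rw [← hpl]
    refine PowerSeries.ext fun k => ?_
    rw [map_sum]
    simp only [PowerSeries.coeff_C_mul, PowerSeries.coeff_X_pow, linMat, ← hpl,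
      Polynomial.coeff_coe, mul_ite, mul_one, mul_zero]
    by_cases hk : k < m
    · rw [Finset.sum_eq_single ⟨k, hk⟩]
      · simp
      · intro c _ hc
        rw [if_neg fun h => hc (Fin.ext h.symm)]
      · simp
    · rw [Polynomial.coeff_eq_zero_of_natDegree_lt (by omega)]
      exact (Finset.sum_eq_zero fun c _ => by rw [if_neg]; have := c.2; omega).symm
  conv_rhs => rw [h]
  rw [Finset.sum_mul, map_sum]
  refine Finset.sum_congr rfl fun j _ => ?_
  rw [mul_assoc, PowerSeries.coeff_C_mul, mul_comm]

theorem lin_erase_mul (n : ℕ) {m : ℕ} (b : Fin m) :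
    lin ((Finset.range m).erase b) zv * FF n m = lin (Finset.range n) yv * geo (zv b) := by
  have h1 := lin_mul_prod_geo ((Finset.range m).erase b) zv
  rw [FF, ← Finset.mul_prod_erase _ _ (Finset.mem_range.2 b.2)]
  linear_combination (lin (Finset.range n) yv * geo (zv b)) * h1

theorem det_linMat (m : ℕ) :
    (linMat m).det = (Matrix.vandermonde fun b : Fin m => zv b).det := by
  let U : Matrix (Fin m) (Fin m) RR := fun i j => PowerSeries.coeff i.1 (PowerSeries.X ^ j.1 * FF 0 m)
  have hU : U.det = 1 := by
    rw [Matrix.det_of_isLowerTriangular]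
    · refine Finset.prod_eq_one fun i _ => ?_
      simp only [U]
      rw [PowerSeries.coeff_X_pow_mul', if_pos le_rfl, Nat.sub_self, FF,
        PowerSeries.coeff_zero_eq_constantCoeff_apply, map_mul, map_prod,
        ← PowerSeries.coeff_zero_eq_constantCoeff_apply, coeff_zero_lin]
      simp [geo]
    · intro i j hij
      have : i < j := hij
      simp only [U]
      rw [PowerSeries.coeff_X_pow_mul', if_neg (by omega)]
  have h : U * linMat m = (Matrix.vandermonde fun b : Fin m => zv b).transpose := by
    ext1 i b
    rw [Matrix.mul_apply, sum_linMat, lin_erase_mul]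
    have := coeff_lin_mul_geo (Finset.range 0) yv (zv b) i
    simpa [lin] using this
  have := congrArg Matrix.det h
  rwa [Matrix.det_mul, hU, one_mul, Matrix.det_transpose] at this

theorem superE_mul_mem (n m : ℕ) (g : Polynomial ℂ) :
    superE n m * ∏ b ∈ Finset.range m, Polynomial.aeval (zv b) g ∈ Lam (fun _ => -1) n m := by
  let U : Matrix (Fin m) (Fin m) RR := fun i j => ∑ k ∈ Finset.range (g.natDegree + 1),
    g.coeff k • PowerSeries.coeff (i.1 + 1 + k + n) (PowerSeries.X ^ j.1 * FF n m)
  have hU : U.det ∈ Lam (fun _ => -1) n m := by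
    rw [Matrix.det_apply]
    refine sum_mem fun e _ => ?_
    have : ∏ i, U (e i) i ∈ Lam (fun _ => -1) n m := prod_mem fun i _ =>
      sum_mem fun k _ => Subalgebra.smul_mem _ (by
        rw [PowerSeries.coeff_X_pow_mul']
        split_ifs
        · exact coeff_FF_mem n m _
        · exact zero_mem _) _
    rcases Int.units_eq_one_or (Equiv.Perm.sign e) with h | h <;> rw [h]
    · simpa using this
    · simpa using this
  let D : Fin m → RR := fun b => zv b * Polynomial.aeval (zv b) g *
    ∏ a ∈ Finset.range n, (zv b - yv a)
  have h : U * linMat m = (Matrix.vandermonde fun b : Fin m => zv b).transpose *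
      Matrix.diagonal D := by
    ext1 i b
    rw [Matrix.mul_apply, Matrix.mul_diagonal, Matrix.transpose_apply, Matrix.vandermonde_apply]
    simp only [U, Finset.sum_mul, smul_mul_assoc]
    rw [Finset.sum_comm]
    have : ∀ k, ∑ j : Fin m, g.coeff k • (PowerSeries.coeff (i.1 + 1 + k + n)
        (PowerSeries.X ^ j.1 * FF n m) * linMat m j b) =
        g.coeff k • (zv b ^ (i.1 + 1 + k) * ∏ a ∈ Finset.range n, (zv b - yv a)) := fun k => by
      rw [← Finset.smul_sum, sum_linMat, lin_erase_mul]
      have := coeff_lin_mul_geo (Finset.range n) yv (zv b) (i.1 + 1 + k)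
      rw [Finset.card_range] at this
      rw [this]
    rw [Finset.sum_congr rfl fun k _ => this k]
    simp only [D]
    rw [Polynomial.aeval_eq_sum_range, Finset.mul_sum, Finset.sum_mul, Finset.mul_sum]
    refine Finset.sum_congr rfl fun k _ => ?_
    simp only [Algebra.smul_def]
    ring
  have hD : ∏ b : Fin m, D b =
      superE n m * ∏ b ∈ Finset.range m, Polynomial.aeval (zv b) g := by
    have e1 : EE 0 1 m = ∏ b ∈ Finset.range m, zv b := by
      simp [EE, lf]
    have e2 : EE 1 n m = ∏ b ∈ Finset.range m, ∏ a ∈ Finset.range n, (zv b - yv a) := by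
      simp [EE, lf, Finset.prod_product_right]
    rw [superE, e1, e2, ← Finset.prod_mul_distrib, ← Finset.prod_mul_distrib,
      ← Fin.prod_univ_eq_prod_range
        (fun b => zv b * (∏ a ∈ Finset.range n, (zv b - yv a)) * Polynomial.aeval (zv b) g)]
    exact Finset.prod_congr rfl fun b _ => by simp only [D]; ring
  have h2 := congrArg Matrix.det h
  rw [Matrix.det_mul, Matrix.det_mul, Matrix.det_transpose, Matrix.det_diagonal, hD, det_linMat,
    mul_comm] at h2
  have h3 : (Matrix.vandermonde fun b : Fin m => zv b).det ≠ 0 := by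
    rw [Matrix.det_vandermonde_ne_zero_iff]
    intro a b hab
    have := Sum.inr_injective (X_injective hab)
    exact Fin.ext this
  rwa [← mul_left_cancel₀ h3 h2]

/-- A subspace containing all values of a polynomial contains its coefficients. -/
theorem coeff_mem_of_eval_mem {A : Type*} [CommRing A] [Algebra ℂ A] (U : Submodule ℂ A)
    (F : Polynomial A) (h : ∀ s : ℂ, F.eval (algebraMap ℂ A s) ∈ U) (k : ℕ) : F.coeff k ∈ U := by
  by_contra hk
  obtain ⟨φ, hφ, hU⟩ := Submodule.exists_le_ker_of_notMem hk
  let f : Polynomial ℂ := ∑ i ∈ Finset.range (F.natDegree + 1), Polynomial.monomial i (φ (F.coeff i))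
  have hf : ∀ s, f.eval s = φ (F.eval (algebraMap ℂ A s)) := fun s => by
    rw [Polynomial.eval_eq_sum_range (p := F), map_sum, Polynomial.eval_finsetSum]
    refine Finset.sum_congr rfl fun i _ => ?_
    rw [Polynomial.eval_monomial, ← map_pow, mul_comm (F.coeff i), ← Algebra.smul_def, map_smul,
      smul_eq_mul, mul_comm]
  have hf0 : f = 0 := Polynomial.funext fun s => by
    rw [hf, Polynomial.eval_zero]
    exact hU (h s)
  have hc : f.coeff k = φ (F.coeff k) := by
    simp only [f, Polynomial.finsetSum_coeff, Polynomial.coeff_monomial]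
    rw [Finset.sum_ite_eq']
    split_ifs with hk'
    · rfl
    · rw [Polynomial.coeff_eq_zero_of_natDegree_lt (by simpa using hk'), map_zero]
  rw [hf0, Polynomial.coeff_zero] at hc
  exact hφ hc.symm

theorem coeff_one_prod {A : Type*} [CommRing A] (s : Finset ℕ) (v : ℕ → A) :
    (∏ b ∈ s, (1 + Polynomial.C (v b) * Polynomial.X)).coeff 0 = 1 ∧
    (∏ b ∈ s, (1 + Polynomial.C (v b) * Polynomial.X)).coeff 1 = ∑ b ∈ s, v b := by
  induction s using Finset.induction_on with
  | empty => simp [Polynomial.coeff_one]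
  | insert a s ha ih =>
    rw [Finset.prod_insert ha, Finset.sum_insert ha, add_mul, one_mul, mul_assoc]
    simp [Polynomial.coeff_X_mul, ih.1, ih.2, add_comm]

/-- The products `∏ g(z_b)`. -/
def multProd (m : ℕ) : Submonoid RR where
  carrier := {f | ∃ g : Polynomial ℂ, f = ∏ b ∈ Finset.range m, Polynomial.aeval (zv b) g}
  one_mem' := ⟨1, by simp⟩
  mul_mem' := by
    rintro _ _ ⟨g, rfl⟩ ⟨h, rfl⟩
    exact ⟨g * h, by simp [Finset.prod_mul_distrib]⟩

theorem pz_mem_span (m i : ℕ) : pz m i ∈ Submodule.span ℂ (multProd m : Set RR) := by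
  have h := coeff_mem_of_eval_mem (Submodule.span ℂ (multProd m : Set RR))
    (∏ b ∈ Finset.range m, (1 + Polynomial.C (zv b ^ (i + 1)) * Polynomial.X)) (fun s => by
      refine Submodule.subset_span ⟨1 + Polynomial.C s * Polynomial.X ^ (i + 1), ?_⟩
      rw [Polynomial.eval_prod]
      refine Finset.prod_congr rfl fun b _ => ?_
      simp only [map_add, map_mul, map_pow, map_one, Polynomial.aeval_C, Polynomial.aeval_X,
        Polynomial.eval_add, Polynomial.eval_one, Polynomial.eval_mul, Polynomial.eval_C,
        Polynomial.eval_X, Polynomial.eval_pow, mul_comm]) 1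
  rwa [(coeff_one_prod _ _).2] at h

theorem superE_mul_mem_Lam {n m : ℕ} {f : RR} (hf : f ∈ S n m) :
    superE n m * f ∈ Lam (fun _ => -1) n m := by
  let L := Lam (fun _ => -1) n m
  let T : Submonoid RR := L.toSubmonoid ⊔ multProd m
  have hT : (Submonoid.closure (T : Set RR)) = T := Submonoid.closure_eq T
  have hS : S n m ≤ Algebra.adjoin ℂ (T : Set RR) := by
    have hpz : ∀ i, pz m i ∈ Algebra.adjoin ℂ (T : Set RR) := fun i => by
      have h1 : Submodule.span ℂ (multProd m : Set RR) ≤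
          Subalgebra.toSubmodule (Algebra.adjoin ℂ (T : Set RR)) :=
        Submodule.span_le.2 fun x hx => Algebra.subset_adjoin
          ((le_sup_right : multProd m ≤ T) hx)
      exact h1 (pz_mem_span m i)
    refine Algebra.adjoin_le ?_
    rintro _ (⟨i, rfl⟩ | ⟨i, rfl⟩)
    · have h1 : P (fun _ => -1) n m i ∈ Algebra.adjoin ℂ (T : Set RR) :=
        Algebra.subset_adjoin ((le_sup_left : L.toSubmonoid ≤ T) (P_mem_Lam _ n m i))
      have h2 : py n i = pz m i - P (fun _ => -1) n m i := by
        simp [P]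
      exact h2 ▸ sub_mem (hpz i) h1
    · exact hpz i
  have h := hS hf
  rw [← Subalgebra.mem_toSubmodule, Algebra.adjoin_eq_span, hT] at h
  clear hf
  induction h using Submodule.span_induction with
  | mem x hx =>
    obtain ⟨a, ha, _, ⟨g, rfl⟩, rfl⟩ := Submonoid.mem_sup.1 hx
    rw [mul_left_comm]
    exact mul_mem ha (superE_mul_mem n m g)
  | zero => rw [mul_zero]; exact zero_mem _
  | add x y _ _ hx hy => rw [mul_add]; exact add_mem hx hy
  | smul c x _ hx => rw [mul_smul_comm]; exact Subalgebra.smul_mem _ hx c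

/-- Supersymmetric polynomials are generated by the super power sums. -/
theorem Q_zero_eq_Lam (n m : ℕ) : Q 0 0 n m = Lam (fun _ => -1) n m := by
  refine le_antisymm ?_ (rel_zero.Lam_le_Q n m)
  induction m with
  | zero =>
    rw [Lam_zero_right (fun _ => by simp)]
    exact fun f hf => (mem_Q.1 hf).1
  | succ m ih =>
    intro f hf
    have h1 := ih (kz_mem_Q hf)
    rw [← map_kz_Lam] at h1
    obtain ⟨g, hg, hgf⟩ := h1
    have hg' : g ∈ Lam (fun _ => -1) n (m + 1) := hg
    obtain ⟨h, hh, he⟩ := exists_eq_superE_mul (sub_mem hf (rel_zero.Lam_le_Q _ _ hg'))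
      (by rw [map_sub, sub_eq_zero]; exact hgf.symm)
    rw [← sub_add_cancel f g, he]
    exact add_mem (superE_mul_mem_Lam hh) hg'

instance (κ : ℕ → ℂ) (n m : ℕ) (d : ℤ) :
    FiniteDimensional ℂ (gr (Subalgebra.toSubmodule (Lam κ n m)) d) :=
  finiteDimensional_gr_of_le (V_finite n m) ((Lam_le_S κ n m).trans (S_le_W n m)) d

instance (q t : ℂ) (n m : ℕ) (d : ℤ) :
    FiniteDimensional ℂ (gr (Subalgebra.toSubmodule (Q q t n m)) d) :=
  finiteDimensional_gr_of_le (V_finite n m)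
    (fun _ hf => S_le_W n m (mem_Q.1 hf).1) d

theorem finrank_Lam_zero_succ (n m : ℕ) (d : ℤ) :
    Module.finrank ℂ (gr (Subalgebra.toSubmodule (Lam (fun _ => -1) n (m + 1))) d) =
      Module.finrank ℂ (gr (Subalgebra.toSubmodule (Lam (fun _ => -1) n m)) d) +
      Module.finrank ℂ (gr (Subalgebra.toSubmodule (S n (m + 1)))
        (d - ((m + 1) * (n + 1) : ℕ))) := by
  have hE := superE_mem_hs n (m + 1)
  refine finrank_of_exact (kz m).toLinearMap (superE n (m + 1)) (superE_ne_zero _ _) ?_ ?_ ?_ ?_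
  · rintro v ⟨hv, hvd⟩
    refine ⟨?_, (linHom_kz m).mem_hs hvd⟩
    rw [← map_kz_Lam]
    exact ⟨v, hv, rfl⟩
  · exact fun w hw => exists_lift_Lam hw
  · rintro v ⟨hv, hvd⟩
    refine ⟨⟨superE_mul_mem_Lam hv, ?_⟩, ?_⟩
    · have := mul_mem_hs hE hvd
      rwa [add_sub_cancel] at this
    · rw [superE]
      simp [kz_EE_zero]
  · rintro v ⟨hv, hvd⟩ h0
    obtain ⟨w, hw, rfl⟩ := exists_eq_superE_mul (rel_zero.Lam_le_Q _ _ hv) h0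
    exact ⟨w, ⟨hw, mem_of_mul_mem_hs hE (superE_ne_zero _ _) hvd⟩, rfl⟩

theorem hilb_Lam_zero (n m : ℕ) :
    hilb (Subalgebra.toSubmodule (Lam (fun _ => -1) n m)) * (qp n * qp m) =
      ∑ i ∈ Finset.range (m + 1), PowerSeries.X ^ (i * (n + 1)) *
        ∏ k ∈ Finset.Ico i m, (1 - PowerSeries.X ^ (k + 1)) := by
  induction m with
  | zero =>
    have := hilb_S n 0
    rw [Lam_zero_right fun _ => by simp]
    rw [this]
    simp
  | succ m ih =>
    have h1 := hilb_add (finrank_Lam_zero_succ n m)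
    have h2 := hilb_S n (m + 1)
    rw [Finset.sum_range_succ, Finset.Ico_self, Finset.prod_empty, mul_one]
    have h3 : ∑ i ∈ Finset.range (m + 1), PowerSeries.X ^ (i * (n + 1)) *
        ∏ k ∈ Finset.Ico i (m + 1), (1 - PowerSeries.X ^ (k + 1)) =
        (∑ i ∈ Finset.range (m + 1), PowerSeries.X ^ (i * (n + 1)) *
        ∏ k ∈ Finset.Ico i m, (1 - PowerSeries.X ^ (k + 1))) *
          ((1 - PowerSeries.X ^ (m + 1)) : PowerSeries ℚ) := by
      rw [Finset.sum_mul]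
      refine Finset.sum_congr rfl fun i hi => ?_
      rw [Finset.prod_Ico_succ_top (by have := Finset.mem_range.1 hi; omega), mul_assoc]
    rw [h3, ← ih, h1]
    rw [qp_succ] at h2 ⊢
    linear_combination PowerSeries.X ^ ((m + 1) * (n + 1)) * h2

section

/-! ### Adjoining a variable -/

theorem mem_W_of_forall_mem {s : Set RR} {n m : ℕ} (hs : ∀ f ∈ s, f ∈ W n m) :
    Subalgebra.toSubmodule (Algebra.adjoin ℂ s) ≤ Subalgebra.toSubmodule (W n m) :=
  Algebra.adjoin_le (S := W n m) hs

theorem exists_eq_add_X_mul {s : Set RR} {v : ℕ ⊕ ℕ} {f : RR}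
    (hf : f ∈ Algebra.adjoin ℂ (insert (X v) s)) :
    ∃ a ∈ Algebra.adjoin ℂ s, ∃ g ∈ Algebra.adjoin ℂ (insert (X v) s), f = a + X v * g := by
  have hle : Algebra.adjoin ℂ s ≤ Algebra.adjoin ℂ (insert (X v) s) :=
    Algebra.adjoin_mono (Set.subset_insert _ _)
  have hX : (X v : RR) ∈ Algebra.adjoin ℂ (insert (X v) s) :=
    Algebra.subset_adjoin (Set.mem_insert _ _)
  induction hf using Algebra.adjoin_induction with
  | mem x hx =>
    rcases hx with rfl | hx
    · exact ⟨0, zero_mem _, 1, one_mem _, by simp⟩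
    · exact ⟨x, Algebra.subset_adjoin hx, 0, zero_mem _, by simp⟩
  | algebraMap c => exact ⟨_, Subalgebra.algebraMap_mem _ c, 0, zero_mem _, by simp⟩
  | add x y _ _ hx hy =>
    obtain ⟨a, ha, g, hg, rfl⟩ := hx
    obtain ⟨b, hb, k, hk, rfl⟩ := hy
    exact ⟨a + b, add_mem ha hb, g + k, add_mem hg hk, by ring⟩
  | mul x y _ _ hx hy =>
    obtain ⟨a, ha, g, hg, rfl⟩ := hx
    obtain ⟨b, hb, k, hk, rfl⟩ := hy
    refine ⟨a * b, mul_mem ha hb, a * k + g * b + X v * (g * k), ?_, by ring⟩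
    exact add_mem (add_mem (mul_mem (hle ha) hk) (mul_mem hg (hle hb))) (mul_mem hX (mul_mem hg hk))

theorem sb_zero_of_mem_adjoin {s : Set RR} {v : ℕ ⊕ ℕ} (hv : ∀ f ∈ s, sb v 0 f = f) {f : RR}
    (hf : f ∈ Algebra.adjoin ℂ s) : sb v 0 f = f := by
  have : Algebra.adjoin ℂ s ≤ AlgHom.equalizer (sb v 0) (AlgHom.id ℂ _) := Algebra.adjoin_le hv
  exact this hf

theorem exists_eq_X_mul {s : Set RR} {v : ℕ ⊕ ℕ} (hv : ∀ f ∈ s, sb v 0 f = f) {f : RR}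
    (hf : f ∈ Algebra.adjoin ℂ (insert (X v) s)) (h0 : sb v 0 f = 0) :
    ∃ g ∈ Algebra.adjoin ℂ (insert (X v) s), f = X v * g := by
  obtain ⟨a, ha, g, hg, rfl⟩ := exists_eq_add_X_mul hf
  rw [map_add, sb_zero_of_mem_adjoin hv ha, map_mul, sb_X_self, zero_mul, add_zero] at h0
  exact ⟨g, hg, by rw [h0, zero_add]⟩

/-- Regular sequences extend to the algebra with one more variable adjoined. -/
theorem reg_adjoin_X {s : Set RR} {v : ℕ ⊕ ℕ} {n m k : ℕ} {p p' : ℕ → RR}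
    (hv : ∀ f ∈ s, sb v 0 f = f) (hs : ∀ f ∈ s, ∃ e : ℤ, f ∈ hs ℂ (ℕ ⊕ ℕ) e)
    (hsW : ∀ f ∈ s, f ∈ W n m) (hvW : v ∈ V n m)
    (hp' : ∀ i : ℕ, p' i ∈ AqtCM.hs ℂ (ℕ ⊕ ℕ) (i + 1))
    (hpA' : ∀ i, p' i ∈ Algebra.adjoin ℂ (insert (X v) s)) (hpp : ∀ i, sb v 0 (p' i) = p i)
    (hR : Reg (gr (Subalgebra.toSubmodule (Algebra.adjoin ℂ s))) p k)
    (hF : FinQ (gr (Subalgebra.toSubmodule (Algebra.adjoin ℂ s))) p k)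
    (hF' : FinQ (gr (Subalgebra.toSubmodule (Algebra.adjoin ℂ (insert (X v) s)))) p' (k + 1)) :
    Reg (gr (Subalgebra.toSubmodule (Algebra.adjoin ℂ (insert (X v) s)))) p' (k + 1) := by
  have hle : Algebra.adjoin ℂ s ≤ Algebra.adjoin ℂ (insert (X v) s) :=
    Algebra.adjoin_mono (Set.subset_insert _ _)
  have hX : (X v : RR) ∈ Algebra.adjoin ℂ (insert (X v) s) :=
    Algebra.subset_adjoin (Set.mem_insert _ _)
  have hlin : LinHom (sb v 0) := linHom_sb (zero_mem _)
  have hfd : ∀ d, FiniteDimensional ℂ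
      (gr (Subalgebra.toSubmodule (Algebra.adjoin ℂ (insert (X v) s))) d) :=
    finiteDimensional_gr_of_le (V_finite n m) (mem_W_of_forall_mem (by
      rintro f (rfl | hf)
      exacts [X_mem_supported hvW, hsW f hf]))
  refine Reg.add_variable (M := gr (Subalgebra.toSubmodule (Algebra.adjoin ℂ s))) (p := p)
    (sb v 0).toLinearMap (X v) (fun w hw => (mul_eq_zero.1 hw).resolve_left (X_ne_zero v))
    ?_ ?_ ?_ ?_ ?_ ?_ (fun d hd => gr_neg _ hd) ?_ hR hF hF'
  · rintro d f ⟨hf, hfd⟩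
    refine mem_gra.2 ⟨?_, hlin.mem_hs hfd⟩
    obtain ⟨a, ha, g, hg, rfl⟩ := exists_eq_add_X_mul hf
    change sb v 0 _ ∈ _
    rwa [map_add, sb_zero_of_mem_adjoin hv ha, map_mul, sb_X_self, zero_mul, add_zero]
  · rintro d f ⟨hf, hfd⟩
    exact ⟨f, ⟨hle hf, hfd⟩, sb_zero_of_mem_adjoin hv hf⟩
  · intro i d f _
    simp [hpp]
  · intro f
    simp
  · rintro d f ⟨hf, hfd⟩ h0
    obtain ⟨g, hg, rfl⟩ := exists_eq_X_mul hv hf h0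
    exact ⟨g, ⟨hg, mem_of_mul_mem_hs (X_mem_hs v) (X_ne_zero v) hfd⟩, rfl⟩
  · rintro d f ⟨hf, hfd⟩
    refine mem_gra.2 ⟨mul_mem hX hf, ?_⟩
    rw [add_comm]
    exact mul_mem_hs (X_mem_hs v) hfd
  · exact stable_gr hp' fun i f hf => Subalgebra.mul_mem _ (hpA' i) hf

/-- The images of the deformed power sums under the identification of `y_n` and `z_m`. -/
def Px (κ : ℕ → ℂ) (n m i : ℕ) : RR := P κ n m i + C (κ i + 1) * yv n ^ (i + 1)

theorem P_mem_W (κ : ℕ → ℂ) {n m n' m' : ℕ} (hn : n ≤ n') (hm : m ≤ m') (i : ℕ) :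
    P κ n m i ∈ W n' m' :=
  W_mono hn hm (S_le_W n m (P_mem_S κ n m i))

theorem Px_mem_hs (κ : ℕ → ℂ) (n m i : ℕ) : Px κ n m i ∈ hs ℂ (ℕ ⊕ ℕ) (i + 1) :=
  add_mem (P_mem_hs κ n m i) (C_mul_mem_hs _ (by
    simpa using Xpow_mem_hs (K := ℂ) (Sum.inl n : ℕ ⊕ ℕ) (i + 1)))

theorem Px_mem_W (κ : ℕ → ℂ) (n m i : ℕ) : Px κ n m i ∈ W (n + 1) m :=
  add_mem (P_mem_W κ (Nat.le_succ n) le_rfl i)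
    (mul_mem (Subalgebra.algebraMap_mem _ _) (pow_mem (y_mem_W (Nat.lt_succ_self n)) _))

theorem P_succ_right (κ : ℕ → ℂ) (n m i : ℕ) :
    P κ n (m + 1) i = P κ n m i + zv m ^ (i + 1) := by
  simp only [P, pz, Finset.sum_range_succ]
  ring

theorem P_succ_left (κ : ℕ → ℂ) (n m i : ℕ) :
    P κ (n + 1) m i = P κ n m i + C (κ i) * yv n ^ (i + 1) := by
  simp only [P, py, Finset.sum_range_succ]
  ring

/-- The genericity conditions on the parameters. -/
structure Good (κ : ℕ → ℂ) (q t : ℂ) : Prop where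
  rel : Rel κ q t
  ne_zero : ∀ i, κ i ≠ 0
  q_pow : ∀ n : ℕ, 1 ≤ n → q ^ n ≠ 1
  q_ne : q ≠ 0
  t_ne : t ≠ 0
  ne : q ≠ t
  Q_eq : ∀ n m, Q q t n m = Lam κ n m
  finrank_eq : ∀ n m d, Module.finrank ℂ (gr (Subalgebra.toSubmodule (Lam κ n m)) d) =
    Module.finrank ℂ (gr (Subalgebra.toSubmodule (Lam (fun _ => -1) n m)) d)
  finQ : ∀ n m, FinQ (gr (Subalgebra.toSubmodule (W n m))) (P κ n m) (n + m)
  finQx : ∀ n m, FinQ (gr (Subalgebra.toSubmodule (W (n + 1) m))) (Px κ n m) (n + m + 1)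

variable {κ : ℕ → ℂ} {q t : ℂ}

theorem Good.finQ_of_le (h : Good κ q t) {n m : ℕ} {M : Submodule ℂ RR}
    (hM : M ≤ Subalgebra.toSubmodule (W n m)) (hP : ∀ i, ∀ v ∈ M, P κ n m i * v ∈ M) (hMg : Grd M) :
    FinQ (gr M) (P κ n m) (n + m) :=
  AqtCM.finQ_of_le (P_mem_hs κ n m) (fun i _ hv => Subalgebra.mul_mem _ (P_mem_W κ le_rfl le_rfl i) hv)
    (grd_supported _) (h.finQ n m) hM hP hMg

theorem Good.finQx_of_le (h : Good κ q t) {n m : ℕ} {M : Submodule ℂ RR}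
    (hM : M ≤ Subalgebra.toSubmodule (W (n + 1) m)) (hP : ∀ i, ∀ v ∈ M, Px κ n m i * v ∈ M)
    (hMg : Grd M) : FinQ (gr M) (Px κ n m) (n + m + 1) :=
  AqtCM.finQ_of_le (Px_mem_hs κ n m) (fun i _ hv => Subalgebra.mul_mem _ (Px_mem_W κ n m i) hv)
    (grd_supported _) (h.finQx n m) hM hP hMg

theorem W_succ_right (n m : ℕ) :
    W n (m + 1) = Algebra.adjoin ℂ (insert (zv m) (X '' V n m)) := by
  have : V n (m + 1) = insert (Sum.inr m) (V n m) := by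
    ext (a | b)
    · simp
    · simp; omega
  rw [W, supported, this, Set.image_insert_eq]

theorem W_succ_left (n m : ℕ) :
    W (n + 1) m = Algebra.adjoin ℂ (insert (yv n) (X '' V n m)) := by
  have : V (n + 1) m = insert (Sum.inl n) (V n m) := by
    ext (a | b)
    · simp; omega
    · simp
  rw [W, supported, this, Set.image_insert_eq]

theorem Good.reg_W (h : Good κ q t) (n m : ℕ) :
    Reg (gr (Subalgebra.toSubmodule (W n m))) (P κ n m) (n + m) := by
  have key : ∀ n m v, v ∉ V n m → ∀ f ∈ (X '' V n m : Set RR), sb v 0 f = f := by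
    rintro n m v hv _ ⟨w, hw, rfl⟩
    exact sb_X_ne _ (by rintro rfl; exact hv hw)
  have hX : ∀ n m, ∀ f ∈ (X '' V n m : Set RR), ∃ e : ℤ, f ∈ hs ℂ (ℕ ⊕ ℕ) e := by
    rintro n m _ ⟨w, _, rfl⟩
    exact ⟨1, X_mem_hs w⟩
  induction m with
  | zero =>
    induction n with
    | zero => intro j hj; omega
    | succ n ih =>
      have hW := W_succ_left n 0
      have hF := h.finQ (n + 1) 0
      rw [hW] at hF ⊢
      refine reg_adjoin_X (n := n + 1) (m := 0) (p := P κ n 0) (key n 0 _ (by simp)) (hX n 0) ?_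
        (by simp) (P_mem_hs κ _ _) (fun i => ?_) (fun i => ?_) ih (h.finQ n 0) hF
      · rintro _ ⟨w, hw, rfl⟩
        exact X_mem_supported (V_mono (Nat.le_succ n) le_rfl hw)
      · rw [← hW]; exact P_mem_W κ le_rfl le_rfl i
      · rw [P_succ_left, map_add, alg_C_mul, map_pow, sb_X_self, zero_pow (Nat.succ_ne_zero i),
          mul_zero, add_zero]
        exact sb_zero_of_mem_adjoin (key n 0 _ (by simp)) (P_mem_W κ le_rfl le_rfl i)
  | succ m ih =>
    have hW := W_succ_right n m
    have hF := h.finQ n (m + 1)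
    rw [hW] at hF ⊢
    refine reg_adjoin_X (n := n) (m := m + 1) (p := P κ n m) (key n m _ (by simp)) (hX n m) ?_
      (by simp) (P_mem_hs κ _ _) (fun i => ?_) (fun i => kz_P κ n m i) ih (h.finQ n m) hF
    · rintro _ ⟨w, hw, rfl⟩
      exact X_mem_supported (V_mono le_rfl (Nat.le_succ m) hw)
    · rw [← hW]; exact P_mem_W κ le_rfl le_rfl i

/-! ### Averaging -/

theorem sw_comm (u v : ℕ ⊕ ℕ) : sw u v = sw v u := by rw [sw, sw, Equiv.swap_comm]

theorem sw_conj (u v w x : ℕ ⊕ ℕ) (f : RR) :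
    sw u v (sw w x f) = sw (Equiv.swap u v w) (Equiv.swap u v x) (sw u v f) := by
  have : (sw u v).comp (sw w x) = (sw (Equiv.swap u v w) (Equiv.swap u v x)).comp (sw u v) := by
    ext1 a
    simp only [AlgHom.comp_apply, sw_X]
    exact congrArg X ((Equiv.swap u v).injective.map_swap w x a)
  exact DFunLike.congr_fun this f

/-- Symmetry in the variables `ι 0, ..., ι (l-1)`. -/
def Sym (ι : ℕ → ℕ ⊕ ℕ) (l : ℕ) (f : RR) : Prop := ∀ i < l, ∀ j < l, sw (ι i) (ι j) f = f

/-- The average of `f` over the exchanges of `ι l` with `ι b`, `b ≤ l`. -/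
def av (ι : ℕ → ℕ ⊕ ℕ) (l : ℕ) : RR →ₗ[ℂ] RR :=
  ((l : ℂ) + 1)⁻¹ • ∑ b ∈ Finset.range (l + 1), (sw (ι b) (ι l)).toLinearMap

theorem av_apply (ι : ℕ → ℕ ⊕ ℕ) (l : ℕ) (f : RR) :
    av ι l f = ((l : ℂ) + 1)⁻¹ • ∑ b ∈ Finset.range (l + 1), sw (ι b) (ι l) f := by
  simp [av]

theorem av_of_sym {ι : ℕ → ℕ ⊕ ℕ} {l : ℕ} {f : RR} (h : Sym ι (l + 1) f) : av ι l f = f := by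
  rw [av_apply, Finset.sum_congr rfl fun b hb =>
    h b (Finset.mem_range.1 hb) l (Nat.lt_succ_self l), Finset.sum_const, Finset.card_range,
    ← Nat.cast_smul_eq_nsmul ℂ, smul_smul, Nat.cast_add, Nat.cast_one,
    inv_mul_cancel₀ (Nat.cast_add_one_ne_zero l), one_smul]

theorem av_mul {ι : ℕ → ℕ ⊕ ℕ} {l : ℕ} {p : RR} (h : Sym ι (l + 1) p) (f : RR) :
    av ι l (p * f) = p * av ι l f := by
  rw [av_apply, av_apply, mul_smul_comm, Finset.mul_sum]
  congr 1
  refine Finset.sum_congr rfl fun b hb => ?_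
  rw [map_mul, h b (Finset.mem_range.1 hb) l (Nat.lt_succ_self l)]

theorem sym_av {ι : ℕ → ℕ ⊕ ℕ} (hι : Function.Injective ι) {l : ℕ} {f : RR} (h : Sym ι l f) :
    Sym ι (l + 1) (av ι l f) := by
  have h1 : ∀ i < l, ∀ j < l, ∀ b ≤ l, sw (ι i) (ι j) (sw (ι b) (ι l) f) =
      sw (ι (Equiv.swap i j b)) (ι l) f := fun i hi j hj b _ => by
    rw [sw_conj, h i hi j hj, hι.map_swap i j b,
      Equiv.swap_apply_of_ne_of_ne (hι.ne (show l ≠ i by omega)) (hι.ne (show l ≠ j by omega))]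
  have h2 : ∀ i < l, ∀ b ≤ l, sw (ι i) (ι l) (sw (ι b) (ι l) f) =
      sw (ι (Equiv.swap i l b)) (ι l) f := fun i hi b hb => by
    by_cases hbi : b = i
    · rw [hbi, sw_sw, Equiv.swap_apply_left, sw_self]
    by_cases hbl : b = l
    · rw [hbl, sw_self, Equiv.swap_apply_right]
    rw [Equiv.swap_apply_of_ne_of_ne hbi hbl]
    conv_rhs => rw [← h i hi b (by omega), sw_conj]
    rw [Equiv.swap_apply_left, Equiv.swap_apply_of_ne_of_ne (hι.ne (Ne.symm hbi))
      (hι.ne (by omega))]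
  have h3 : ∀ i < l + 1, ∀ j < l + 1, ∀ b ≤ l, sw (ι i) (ι j) (sw (ι b) (ι l) f) =
      sw (ι (Equiv.swap i j b)) (ι l) f := fun i hi j hj b hb => by
    by_cases hij : i = j
    · subst hij; rw [sw_self, Equiv.swap_self, Equiv.refl_apply]
    by_cases hil : i = l
    · rw [hil, sw_comm, Equiv.swap_comm]
      exact h2 j (by omega) b hb
    by_cases hjl : j = l
    · rw [hjl]
      exact h2 i (by omega) b hb
    exact h1 i (by omega) j (by omega) b hb
  intro i hi j hj
  rw [av_apply, map_smul, map_sum]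
  congr 1
  refine Finset.sum_equiv (Equiv.swap i j) (fun b => ?_) fun b hb => ?_
  · rw [Finset.mem_range, Finset.mem_range, swap_lt hi hj]
  · exact h3 i hi j hj b (by have := Finset.mem_range.1 hb; omega)

theorem sym_av_of_disjoint {ι ι' : ℕ → ℕ ⊕ ℕ} (hd : ∀ i j, ι i ≠ ι' j) {k l : ℕ} {f : RR}
    (h : Sym ι' k f) : Sym ι' k (av ι l f) := by
  intro i hi j hj
  rw [av_apply, map_smul, map_sum]
  congr 1
  refine Finset.sum_congr rfl fun b _ => ?_
  rw [sw_conj, h i hi j hj, Equiv.swap_apply_of_ne_of_ne (hd _ _) (hd _ _),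
    Equiv.swap_apply_of_ne_of_ne (hd _ _) (hd _ _)]

theorem av_mem_hs (ι : ℕ → ℕ ⊕ ℕ) (l : ℕ) {d : ℤ} {f : RR} (h : f ∈ hs ℂ (ℕ ⊕ ℕ) d) :
    av ι l f ∈ hs ℂ (ℕ ⊕ ℕ) d := by
  rw [av_apply]
  exact Submodule.smul_mem _ _ (sum_mem fun b _ => (linHom_sw _ _).mem_hs h)

theorem av_mem_W {ι : ℕ → ℕ ⊕ ℕ} {l n m : ℕ} (h : ∀ b ≤ l, ι b ∈ V n m) {f : RR}
    (hf : f ∈ W n m) : av ι l f ∈ W n m := by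
  rw [av_apply]
  refine Subalgebra.smul_mem _ (sum_mem fun b hb => map_supported_le (fun w hw => ?_) hf) _
  rw [sw_X]
  refine X_mem_supported ?_
  have := Finset.mem_range.1 hb
  simp only [Equiv.swap_apply_def]
  split_ifs
  exacts [h l le_rfl, h b (by omega), hw]

theorem mem_Inv_iff_sym {n m : ℕ} {f : RR} :
    f ∈ Inv n m ↔ f ∈ W n m ∧ Sym Sum.inl n f ∧ Sym Sum.inr m f := by
  rw [mem_Inv]
  refine and_congr_right fun _ => ⟨fun h => ⟨fun i hi j hj => h _ _ (Or.inl ⟨i, hi, j, hj, rfl⟩),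
    fun i hi j hj => h _ _ (Or.inr ⟨i, hi, j, hj, rfl⟩)⟩, ?_⟩
  rintro ⟨h1, h2⟩ u v (⟨i, hi, j, hj, h⟩ | ⟨i, hi, j, hj, h⟩) <;> obtain ⟨rfl, rfl⟩ := Prod.mk.inj h
  exacts [h1 i hi j hj, h2 i hi j hj]

/-- Polynomials symmetric in some of the variables. -/
def PS (n m k l : ℕ) : Submodule ℂ RR where
  carrier := {f | f ∈ W n m ∧ Sym Sum.inl k f ∧ Sym Sum.inr l f}
  zero_mem' := ⟨zero_mem _, fun _ _ _ _ => map_zero _, fun _ _ _ _ => map_zero _⟩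
  add_mem' := fun ha hb => ⟨add_mem ha.1 hb.1,
    fun i hi j hj => by rw [map_add, ha.2.1 i hi j hj, hb.2.1 i hi j hj],
    fun i hi j hj => by rw [map_add, ha.2.2 i hi j hj, hb.2.2 i hi j hj]⟩
  smul_mem' := fun c _ ha => ⟨Subalgebra.smul_mem _ ha.1 c,
    fun i hi j hj => by rw [map_smul, ha.2.1 i hi j hj],
    fun i hi j hj => by rw [map_smul, ha.2.2 i hi j hj]⟩

theorem PS_eq (n m : ℕ) : PS n m n m = Subalgebra.toSubmodule (S n m) := by
  ext f
  rw [Subalgebra.mem_toSubmodule, ← Inv_eq_S, mem_Inv_iff_sym]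
  rfl

theorem Sym.mono {ι : ℕ → ℕ ⊕ ℕ} {k l : ℕ} {f : RR} (h : Sym ι l f) (hk : k ≤ l) : Sym ι k f :=
  fun i hi j hj => h i (by omega) j (by omega)

theorem sym_P (κ : ℕ → ℂ) (n m i : ℕ) :
    Sym Sum.inl n (P κ n m i) ∧ Sym Sum.inr m (P κ n m i) :=
  (mem_Inv_iff_sym.1 (S_le_Inv n m (P_mem_S κ n m i))).2

/-- Membership in the ideals generated by deformed power sums descends to symmetric polynomials. -/
theorem pure_S {n m : ℕ} {j : ℕ} {d : ℤ} {f : RR}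
    (hf : f ∈ gr (Subalgebra.toSubmodule (S n m)) d)
    (h : f ∈ idl (gr (Subalgebra.toSubmodule (W n m))) (P κ n m) j d) :
    f ∈ idl (gr (Subalgebra.toSubmodule (S n m))) (P κ n m) j d := by
  have hk : ∀ k ≤ n, ∀ f ∈ gr (PS n m k 0) d,
      f ∈ idl (gr (Subalgebra.toSubmodule (W n m))) (P κ n m) j d →
      f ∈ idl (gr (PS n m k 0)) (P κ n m) j d := by
    intro k
    induction k with
    | zero =>
      intro _ f _ hfi
      refine idl_mono (fun d v hv => ?_) _ _ hfi
      exact ⟨⟨hv.1, fun i hi => by omega, fun i hi => by omega⟩, hv.2⟩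
    | succ k ih =>
      intro hk f hf hfi
      have h1 := ih (by omega) f ⟨⟨hf.1.1, hf.1.2.1.mono (by omega), hf.1.2.2⟩, hf.2⟩ hfi
      have := idl_map_zero (M := gr (PS n m k 0)) (N := gr (PS n m (k + 1) 0))
        (p := P κ n m) (p' := P κ n m) (av Sum.inl k) (fun d v (hv : v ∈ gr (PS n m k 0) d) =>
        ⟨⟨av_mem_W (fun b hb => inl_mem_V.2 (by omega)) hv.1.1, sym_av Sum.inl_injective hv.1.2.1,
          sym_av_of_disjoint (fun _ _ => by simp) hv.1.2.2⟩, av_mem_hs _ _ hv.2⟩)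
          (fun i d v _ => av_mul ((sym_P κ n m i).1.mono hk) v) j d f h1
      rwa [av_of_sym hf.1.2.1] at this
  have hl : ∀ l ≤ m, ∀ f ∈ gr (PS n m n l) d,
      f ∈ idl (gr (Subalgebra.toSubmodule (W n m))) (P κ n m) j d →
      f ∈ idl (gr (PS n m n l)) (P κ n m) j d := by
    intro l
    induction l with
    | zero => intro _; exact hk n le_rfl
    | succ l ih =>
      intro hl f hf hfi
      have h1 := ih (by omega) f ⟨⟨hf.1.1, hf.1.2.1, hf.1.2.2.mono (by omega)⟩, hf.2⟩ hfi
      have := idl_map_zero (M := gr (PS n m n l)) (N := gr (PS n m n (l + 1)))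
        (p := P κ n m) (p' := P κ n m) (av Sum.inr l) (fun d v (hv : v ∈ gr (PS n m n l) d) =>
        ⟨⟨av_mem_W (fun b hb => inr_mem_V.2 (by omega)) hv.1.1,
          sym_av_of_disjoint (fun _ _ => by simp) hv.1.2.1,
          sym_av Sum.inr_injective hv.1.2.2⟩, av_mem_hs _ _ hv.2⟩)
          (fun i d v _ => av_mul ((sym_P κ n m i).2.mono hl) v) j d f h1
      rwa [av_of_sym hf.1.2.2] at this
  rw [← PS_eq] at hf ⊢
  exact hl m le_rfl f hf h

theorem Good.reg_S (h : Good κ q t) (n m : ℕ) :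
    Reg (gr (Subalgebra.toSubmodule (S n m))) (P κ n m) (n + m) := by
  intro j hj d v hv hp
  have hle : ∀ d, gr (Subalgebra.toSubmodule (S n m)) d ≤ gr (Subalgebra.toSubmodule (W n m)) d :=
    fun d f hf => ⟨S_le_W n m hf.1, hf.2⟩
  exact pure_S hv (h.reg_W n m j hj d v (hle d hv) (idl_mono hle _ _ hp))

end

section

/-! ### Regular sequences in the algebras of deformed power sums -/

theorem idl_shift {K R : Type*} [Field K] [CommRing R] [Algebra K R] (M : ℤ → Submodule K R)
    (p : ℕ → R) (e : ℤ) (j : ℕ) (d : ℤ) :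
    idl (fun d => M (d - e)) p j d = idl M p j (d - e) := by
  induction j with
  | zero => rfl
  | succ j ih => rw [idl, idl, ih, show d - (j + 1) - e = d - e - (j + 1) by ring]

theorem Reg.shift {K R : Type*} [Field K] [CommRing R] [Algebra K R] {M : ℤ → Submodule K R}
    {p : ℕ → R} {k : ℕ} (h : Reg M p k) (e : ℤ) : Reg (fun d => M (d - e)) p k := by
  intro j hj d v hv hp
  rw [idl_shift] at hp ⊢
  refine h j hj (d - e) v hv ?_
  rwa [show d - e + (j + 1) = d + (j + 1) - e by ring]

theorem eq_of_mem_adjoin {s : Set RR} {φ ψ : RR →ₐ[ℂ] RR} (h : ∀ f ∈ s, φ f = ψ f) {f : RR}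
    (hf : f ∈ Algebra.adjoin ℂ s) : φ f = ψ f := by
  have : Algebra.adjoin ℂ s ≤ AlgHom.equalizer φ ψ := Algebra.adjoin_le h
  exact this hf

theorem sub_sw_inr (α β : ℂ) (a b j k : ℕ) (f : RR) :
    sub α β a b (sw (Sum.inr j) (Sum.inr k) f) =
      sw (Sum.inr j) (Sum.inr k) (sub α β a (Equiv.swap j k b) f) := by
  have : (sub α β a b).comp (sw (Sum.inr j) (Sum.inr k)) =
      (sw (Sum.inr j) (Sum.inr k)).comp (sub α β a (Equiv.swap j k b)) := by
    ext1 v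
    simp only [AlgHom.comp_apply]
    rcases v with i | i
    · rw [sw_X, swap_inr_inl, sub_y, sub_y]
      split_ifs <;> simp [swap_inr_inl]
    · rw [sw_X, swap_inr, sub_z, sub_z]
      have : Equiv.swap j k i = b ↔ i = Equiv.swap j k b := Equiv.swap_apply_eq_iff
      by_cases h : i = Equiv.swap j k b
      · rw [if_pos h, if_pos (this.2 h), alg_C_mul, sw_X, swap_inr_inl]
      · rw [if_neg h, if_neg (mt this.1 h), sw_X, swap_inr]
  exact DFunLike.congr_fun this f

theorem sub_sw_inl (α β : ℂ) (a b j k : ℕ) (f : RR) :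
    sub α β a b (sw (Sum.inl j) (Sum.inl k) f) =
      sw (Sum.inl j) (Sum.inl k) (sub α β (Equiv.swap j k a) b f) := by
  have : (sub α β a b).comp (sw (Sum.inl j) (Sum.inl k)) =
      (sw (Sum.inl j) (Sum.inl k)).comp (sub α β (Equiv.swap j k a) b) := by
    ext1 v
    simp only [AlgHom.comp_apply]
    rcases v with i | i
    · rw [sw_X, swap_inl, sub_y, sub_y]
      have : Equiv.swap j k i = a ↔ i = Equiv.swap j k a := Equiv.swap_apply_eq_iff
      by_cases h : i = Equiv.swap j k a
      · rw [if_pos h, if_pos (this.2 h), alg_C_mul, sw_X, swap_inl, Equiv.swap_apply_self]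
      · rw [if_neg h, if_neg (mt this.1 h), sw_X, swap_inl]
    · rw [sw_X, swap_inl_inr, sub_z, sub_z]
      split_ifs
      · rw [alg_C_mul, sw_X, swap_inl, Equiv.swap_apply_self]
      · rw [sw_X, swap_inl_inr]
  exact DFunLike.congr_fun this f

theorem sub_of_mem_W (α β : ℂ) {n m : ℕ} {f : RR} (hf : f ∈ W n m) : sub α β n m f = f := by
  have h : sub α β n m f = AlgHom.id ℂ RR f := by
    refine hom_congr_supported (fun v hv => ?_) hf
    rcases v with i | j
    · rw [sub_y, if_neg (inl_mem_V.1 hv).ne]; rfl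
    · rw [sub_z, if_neg (inr_mem_V.1 hv).ne]; rfl
  exact h

theorem sb_zero_sub (α β : ℂ) (a b : ℕ) (f : RR) :
    sb (Sum.inl a) 0 (sub α β a b f) = sb (Sum.inl a) 0 (sub 1 1 a b f) := by
  have : (sb (Sum.inl a) 0).comp (sub α β a b) = (sb (Sum.inl a) 0).comp (sub 1 1 a b) := by
    ext1 v
    simp only [AlgHom.comp_apply]
    rcases v with i | j
    · rw [sub_y, sub_y]
      split_ifs
      · rw [alg_C_mul, alg_C_mul, sb_X_self, mul_zero, mul_zero]
      · rfl
    · rw [sub_z, sub_z]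
      split_ifs
      · rw [alg_C_mul, alg_C_mul, sb_X_self, mul_zero, mul_zero]
      · rfl
  exact DFunLike.congr_fun this f

variable {κ : ℕ → ℂ} {q t : ℂ} {n m : ℕ}

/-- Generators of an intermediate algebra containing the variable `z_m`. -/
abbrev zGen (κ : ℕ → ℂ) (n m : ℕ) : Set RR := insert (zv m) (Set.range (P κ n m))

/-- Generators of an intermediate algebra containing the variable `y_n`. -/
abbrev yGen (κ : ℕ → ℂ) (n m : ℕ) : Set RR := insert (yv n) (Set.range (P κ n m))

theorem zGen_mem_W : ∀ f ∈ zGen κ n m, f ∈ W n (m + 1) := by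
  rintro f (rfl | ⟨i, rfl⟩)
  exacts [z_mem_W (Nat.lt_succ_self m), P_mem_W κ le_rfl (Nat.le_succ m) i]

theorem yGen_mem_W : ∀ f ∈ yGen κ n m, f ∈ W (n + 1) m := by
  rintro f (rfl | ⟨i, rfl⟩)
  exacts [y_mem_W (Nat.lt_succ_self n), P_mem_W κ (Nat.le_succ n) le_rfl i]

theorem zGen_homogeneous : ∀ f ∈ zGen κ n m, ∃ e : ℤ, f ∈ hs ℂ (ℕ ⊕ ℕ) e := by
  rintro f (rfl | ⟨i, rfl⟩)
  exacts [⟨1, X_mem_hs _⟩, ⟨_, P_mem_hs κ n m i⟩]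

theorem yGen_homogeneous : ∀ f ∈ yGen κ n m, ∃ e : ℤ, f ∈ hs ℂ (ℕ ⊕ ℕ) e := by
  rintro f (rfl | ⟨i, rfl⟩)
  exacts [⟨1, X_mem_hs _⟩, ⟨_, P_mem_hs κ n m i⟩]

theorem P_succ_mem_zGen (i : ℕ) : P κ n (m + 1) i ∈ Algebra.adjoin ℂ (zGen κ n m) := by
  rw [P_succ_right]
  exact add_mem (Algebra.subset_adjoin (Or.inr ⟨i, rfl⟩))
    (pow_mem (Algebra.subset_adjoin (Set.mem_insert _ _)) _)

theorem C_mem (A : Subalgebra ℂ RR) (c : ℂ) : C c ∈ A := Subalgebra.algebraMap_mem A c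

theorem yv_mem_yGen : yv n ∈ Algebra.adjoin ℂ (yGen κ n m) :=
  Algebra.subset_adjoin (Set.mem_insert _ _)

theorem Px_mem_yGen (i : ℕ) : Px κ n m i ∈ Algebra.adjoin ℂ (yGen κ n m) :=
  add_mem (Algebra.subset_adjoin (Or.inr ⟨i, rfl⟩)) (mul_mem (C_mem _ _) (pow_mem yv_mem_yGen _))

theorem sb_y_P (i : ℕ) : sb (Sum.inl n) 0 (P κ n m i) = P κ n m i := by
  have h : sb (Sum.inl n) 0 (P κ n m i) = AlgHom.id ℂ RR (P κ n m i) :=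
    hom_congr_supported (fun v hv => sb_X_ne _ (by rintro rfl; simp at hv))
      (P_mem_W κ le_rfl le_rfl i)
  exact h

theorem sb_z_P (i : ℕ) : sb (Sum.inr m) 0 (P κ n m i) = P κ n m i := by
  have h : sb (Sum.inr m) 0 (P κ n m i) = AlgHom.id ℂ RR (P κ n m i) :=
    hom_congr_supported (fun v hv => sb_X_ne _ (by rintro rfl; simp at hv))
      (P_mem_W κ le_rfl le_rfl i)
  exact h

theorem Good.reg_zGen (h : Good κ q t)
    (hR : Reg (gr (Subalgebra.toSubmodule (Lam κ n m))) (P κ n m) (n + m)) :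
    Reg (gr (Subalgebra.toSubmodule (Algebra.adjoin ℂ (zGen κ n m)))) (P κ n (m + 1))
      (n + m + 1) := by
  refine reg_adjoin_X (n := n) (m := m + 1) (p := P κ n m) ?_ ?_ ?_ (by simp) (P_mem_hs κ _ _)
    P_succ_mem_zGen (fun i => kz_P κ n m i) hR
    (h.finQ_of_le (fun f hf => S_le_W n m (Lam_le_S κ n m hf))
      (fun i v hv => Subalgebra.mul_mem _ (P_mem_Lam κ n m i) hv) (grd_Lam κ n m))
    (h.finQ_of_le (mem_W_of_forall_mem zGen_mem_W)
      (fun i v hv => Subalgebra.mul_mem _ (P_succ_mem_zGen i) hv) (grd_adjoin zGen_homogeneous))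
  · rintro _ ⟨i, rfl⟩; exact sb_z_P i
  · exact fun f hf => zGen_homogeneous (κ := κ) (n := n) (m := m) f (Or.inr hf)
  · exact fun f hf => zGen_mem_W (κ := κ) (n := n) (m := m) f (Or.inr hf)

theorem Good.reg_yGen (h : Good κ q t)
    (hR : Reg (gr (Subalgebra.toSubmodule (Lam κ n m))) (P κ n m) (n + m)) :
    Reg (gr (Subalgebra.toSubmodule (Algebra.adjoin ℂ (yGen κ n m)))) (Px κ n m)
      (n + m + 1) := by
  refine reg_adjoin_X (n := n + 1) (m := m) (p := P κ n m) ?_ ?_ ?_ (by simp) (Px_mem_hs κ _ _)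
    Px_mem_yGen (fun i => ?_) hR
    (h.finQ_of_le (fun f hf => S_le_W n m (Lam_le_S κ n m hf))
      (fun i v hv => Subalgebra.mul_mem _ (P_mem_Lam κ n m i) hv) (grd_Lam κ n m))
    (h.finQx_of_le (mem_W_of_forall_mem yGen_mem_W)
      (fun i v hv => Subalgebra.mul_mem _ (Px_mem_yGen i) hv) (grd_adjoin yGen_homogeneous))
  · rintro _ ⟨i, rfl⟩; exact sb_y_P i
  · exact fun f hf => yGen_homogeneous (κ := κ) (n := n) (m := m) f (Or.inr hf)
  · exact fun f hf => yGen_mem_W (κ := κ) (n := n) (m := m) f (Or.inr hf)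
  · rw [Px, map_add, sb_y_P, alg_C_mul, map_pow, sb_X_self, zero_pow (Nat.succ_ne_zero i),
      mul_zero, add_zero]

/-- The difference of the two substitutions in the deformed cancellation condition. -/
def dl (q t : ℂ) (n m : ℕ) : RR →ₗ[ℂ] RR :=
  (sub 1 1 n m).toLinearMap - (sub t q n m).toLinearMap

theorem dl_apply (q t : ℂ) (n m : ℕ) (f : RR) :
    dl q t n m f = sub 1 1 n m f - sub t q n m f := rfl

theorem dl_mul {f g : RR} {n m : ℕ} (hg : sub 1 1 n m g = sub t q n m g) :
    dl q t n m (g * f) = sub 1 1 n m g * dl q t n m f := by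
  rw [dl_apply, dl_apply, map_mul, map_mul, ← hg, mul_sub]

theorem sub_one_P (κ : ℕ → ℂ) (n m i : ℕ) : sub 1 1 n m (P κ (n + 1) (m + 1) i) = Px κ n m i := by
  rw [sub_P κ 1 1 (Nat.lt_succ_self n) (Nat.lt_succ_self m), P_succ_right, P_succ_left, Px]
  simp only [one_pow, sub_self, mul_zero, zero_add, C_add, C_1]
  ring

theorem sub_mem_yGen (α β : ℂ) {f : RR} (hf : f ∈ Algebra.adjoin ℂ (zGen κ (n + 1) m)) :
    sub α β n m f ∈ Algebra.adjoin ℂ (yGen κ n m) := by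
  have : Algebra.adjoin ℂ (zGen κ (n + 1) m) ≤
      (Algebra.adjoin ℂ (yGen κ n m)).comap (sub α β n m) := by
    refine Algebra.adjoin_le ?_
    rintro _ (rfl | ⟨i, rfl⟩)
    · change sub α β n m (zv m) ∈ Algebra.adjoin ℂ (yGen κ n m)
      rw [sub_z, if_pos rfl]
      exact mul_mem (C_mem _ _) yv_mem_yGen
    · change sub α β n m (P κ (n + 1) m i) ∈ Algebra.adjoin ℂ (yGen κ n m)
      rw [P_succ_left, map_add, sub_of_mem_W α β (P_mem_W κ le_rfl le_rfl i), alg_C_mul, map_pow,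
        sub_y, if_pos rfl]
      exact add_mem (Algebra.subset_adjoin (Or.inr ⟨i, rfl⟩))
        (mul_mem (C_mem _ _) (pow_mem (mul_mem (C_mem _ _) yv_mem_yGen) _))
  exact this hf

theorem dl_mem {f : RR} (hf : f ∈ Algebra.adjoin ℂ (zGen κ (n + 1) m)) :
    ∃ g ∈ Algebra.adjoin ℂ (yGen κ n m), dl q t n m f = yv n * g := by
  refine exists_eq_X_mul ?_ (sub_mem (sub_mem_yGen 1 1 hf) (sub_mem_yGen t q hf)) ?_
  · rintro _ ⟨i, rfl⟩; exact sb_y_P i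
  · rw [dl_apply, map_sub, sb_zero_sub t q, sub_self]

theorem exists_dl_eq (h : Good κ q t) {g : RR} (hg : g ∈ Algebra.adjoin ℂ (yGen κ n m)) :
    ∃ f ∈ Algebra.adjoin ℂ (zGen κ (n + 1) m), dl q t n m f = yv n * g := by
  have h1 : Algebra.adjoin ℂ (yGen κ n m) ≤
      Algebra.adjoin ℂ ({yv n} ∪ Set.range (Px κ n m)) := by
    have hy : yv n ∈ Algebra.adjoin ℂ ({yv n} ∪ Set.range (Px κ n m)) :=
      Algebra.subset_adjoin (Or.inl rfl)
    refine Algebra.adjoin_le ?_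
    rintro _ (rfl | ⟨i, rfl⟩)
    · exact hy
    · have := sub_mem (Algebra.subset_adjoin (R := ℂ) (s := {yv n} ∪ Set.range (Px κ n m))
        (Or.inr ⟨i, rfl⟩)) (mul_mem (C_mem _ (κ i + 1)) (pow_mem hy (i + 1)))
      rwa [Px, add_sub_cancel_right] at this
  have h2 := h1 hg
  rw [← Subalgebra.mem_toSubmodule, Algebra.adjoin_union_coe_submodule] at h2
  have hP : ∀ b ∈ Algebra.adjoin ℂ (Set.range (Px κ n m)),
      ∃ b' ∈ Lam κ (n + 1) (m + 1), sub 1 1 n m b' = b := by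
    intro b hb
    have : (Lam κ (n + 1) (m + 1)).map (sub 1 1 n m) = Algebra.adjoin ℂ (Set.range (Px κ n m)) := by
      rw [Lam, AlgHom.map_adjoin, ← Set.range_comp]
      congr 2
      ext1 i
      exact sub_one_P κ n m i
    rwa [← this] at hb
  clear hg
  induction h2 using Submodule.mul_induction_on' with
  | mem_mul_mem a ha b hb =>
    obtain ⟨b', hb', rfl⟩ := hP b hb
    have hbQ := (mem_Q.1 (h.rel.Lam_le_Q _ _ hb')).2 n (Nat.lt_succ_self n) m (Nat.lt_succ_self m)
    have hbz : b' ∈ Algebra.adjoin ℂ (zGen κ (n + 1) m) := by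
      have : Lam κ (n + 1) (m + 1) ≤ Algebra.adjoin ℂ (zGen κ (n + 1) m) := by
        refine Algebra.adjoin_le ?_
        rintro _ ⟨i, rfl⟩
        exact P_succ_mem_zGen i
      exact this hb'
    rw [Subalgebra.mem_toSubmodule, Algebra.adjoin_singleton_eq_range_aeval] at ha
    obtain ⟨p, rfl⟩ := ha
    suffices ∃ f ∈ Algebra.adjoin ℂ (zGen κ (n + 1) m),
        dl q t n m f = yv n * Polynomial.aeval (yv n) p by
      obtain ⟨f, hf, hfe⟩ := this
      refine ⟨b' * f, mul_mem hbz hf, ?_⟩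
      rw [dl_mul hbQ, hfe]
      simp only [AlgHom.toRingHom_eq_coe, RingHom.coe_coe]
      ring
    clear * - h
    induction p using Polynomial.induction_on' with
    | add p r hp hr =>
      obtain ⟨f, hf, hfe⟩ := hp
      obtain ⟨g, hg, hge⟩ := hr
      exact ⟨f + g, add_mem hf hg, by rw [map_add, map_add, hfe, hge, mul_add]⟩
    | monomial k c =>
      have hq : 1 - q ^ (k + 1) ≠ 0 := sub_ne_zero.2 (h.q_pow _ (Nat.succ_pos k)).symm
      refine ⟨C (c / (1 - q ^ (k + 1))) * zv m ^ (k + 1), mul_mem (C_mem _ _)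
        (pow_mem (Algebra.subset_adjoin (Set.mem_insert _ _)) _), ?_⟩
      rw [dl_apply, alg_C_mul, alg_C_mul, map_pow, map_pow, sub_z, sub_z, if_pos rfl, if_pos rfl,
        Polynomial.aeval_monomial, C_1, one_mul, mul_pow, ← C_pow, ← mul_sub,
        show yv n ^ (k + 1) - C (q ^ (k + 1)) * yv n ^ (k + 1) =
          C (1 - q ^ (k + 1)) * yv n ^ (k + 1) by rw [C_sub, C_1]; ring, ← mul_assoc, ← C_mul,
        div_mul_cancel₀ _ hq, algebraMap_eq]
      ring
  | add x _ y _ hx hy =>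
    obtain ⟨f, hf, hfe⟩ := hx
    obtain ⟨g, hg, hge⟩ := hy
    exact ⟨f + g, add_mem hf hg, by rw [map_add, hfe, hge, mul_add]⟩

theorem comp_dl (d : ℤ) (f : RR) : comp d (dl q t n m f) = dl q t n m (comp d f) := by
  rw [dl_apply, map_sub, (linHom_sub _ _ _ _).comp, (linHom_sub _ _ _ _).comp]; rfl

theorem Lam_le_zGen : Lam κ n (m + 1) ≤ Algebra.adjoin ℂ (zGen κ n m) := by
  refine Algebra.adjoin_le ?_
  rintro _ ⟨i, rfl⟩
  exact P_succ_mem_zGen i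

theorem sym_of_mem_zGen {f : RR} (hf : f ∈ Algebra.adjoin ℂ (zGen κ n m)) :
    Sym Sum.inl n f ∧ Sym Sum.inr m f := by
  refine ⟨fun i hi j hj => eq_of_mem_adjoin (ψ := AlgHom.id ℂ RR) ?_ hf,
    fun i hi j hj => eq_of_mem_adjoin (ψ := AlgHom.id ℂ RR) ?_ hf⟩
  · rintro _ (rfl | ⟨k, rfl⟩)
    · rw [sw_X, swap_inl_inr]; rfl
    · exact (sym_P κ n m k).1 i hi j hj
  · rintro _ (rfl | ⟨k, rfl⟩)
    · rw [sw_X, swap_inr, Equiv.swap_apply_of_ne_of_ne hi.ne' hj.ne']; rfl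
    · exact (sym_P κ n m k).2 i hi j hj

theorem av_mem_Q (h : Good κ q t) {f : RR} (hf : f ∈ Algebra.adjoin ℂ (zGen κ (n + 1) m))
    (h0 : dl q t n m f = 0) : av Sum.inr m f ∈ Q q t (n + 1) (m + 1) := by
  have hsym := sym_of_mem_zGen hf
  have hW : f ∈ W (n + 1) (m + 1) := mem_W_of_forall_mem zGen_mem_W hf
  refine mem_Q.2 ⟨?_, fun a ha b hb => ?_⟩
  · rw [← Inv_eq_S, mem_Inv_iff_sym]
    exact ⟨av_mem_W (fun b hb => inr_mem_V.2 (by omega)) hW,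
      sym_av_of_disjoint (fun _ _ => by simp) hsym.1, sym_av Sum.inr_injective hsym.2⟩
  · have key : ∀ b ≤ m, sub 1 1 a b f = sub t q a b f := by
      intro b hb
      rcases hb.lt_or_eq with hb | rfl
      · refine eq_of_mem_adjoin ?_ hf
        rintro _ (rfl | ⟨i, rfl⟩)
        · rw [sub_z, sub_z, if_neg hb.ne', if_neg hb.ne']
        · exact h.rel.sub_P ha hb i
      · have hs := hsym.1 a ha n (Nat.lt_succ_self n)
        rw [← hs, sub_sw_inl, sub_sw_inl, Equiv.swap_apply_left]
        exact congrArg _ (sub_eq_zero.1 h0)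
    rw [av_apply, map_smul, map_smul, map_sum, map_sum]
    congr 1
    refine Finset.sum_congr rfl fun j hj => ?_
    rw [sub_sw_inr, sub_sw_inr, key]
    exact Nat.lt_succ_iff.1 ((swap_lt (Finset.mem_range.1 hj) (Nat.lt_succ_self m)).2 hb)

/-- The deformed power sums form a regular sequence in the algebra they generate. -/
theorem Good.reg_Lam (h : Good κ q t) (n m : ℕ) :
    Reg (gr (Subalgebra.toSubmodule (Lam κ n m))) (P κ n m) (n + m) := by
  induction m generalizing n with
  | zero => rw [Lam_zero_right h.ne_zero]; exact h.reg_S n 0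
  | succ m ih =>
    cases n with
    | zero => rw [Lam_zero_left]; exact h.reg_S 0 (m + 1)
    | succ n =>
      set M := Subalgebra.toSubmodule (Algebra.adjoin ℂ (zGen κ (n + 1) m)) with hM
      set N := Subalgebra.toSubmodule (Algebra.adjoin ℂ (yGen κ n m)) with hN
      have hreg : Reg (gr M) (P κ (n + 1) (m + 1)) (n + m + 1 + 1) := by
        have := h.reg_zGen (ih (n + 1))
        rwa [show n + 1 + m = n + m + 1 by ring] at this
      have hyN : Reg (gr (N.map (LinearMap.mulLeft ℂ (yv n)))) (Px κ n m) (n + m + 1) := by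
        refine Reg.transport (M := fun d => gr N (d - 1)) (p := Px κ n m)
          (LinearMap.mulLeft ℂ (yv n)) (fun a b hab => mul_left_cancel₀ (X_ne_zero _) hab) ?_ ?_
          (fun i d v _ => by simp only [LinearMap.mulLeft_apply]; ring) ((h.reg_yGen (ih n)).shift 1)
        · rintro d v ⟨hv, hvd⟩
          refine ⟨⟨v, hv, rfl⟩, ?_⟩
          have := mul_mem_hs (X_mem_hs (K := ℂ) (Sum.inl n : ℕ ⊕ ℕ)) hvd
          rwa [add_sub_cancel] at this
        · rintro d _ ⟨⟨v, hv, rfl⟩, hvd⟩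
          exact ⟨v, ⟨hv, mem_of_mul_mem_hs (X_mem_hs _) (X_ne_zero _) hvd⟩, rfl⟩
      have hK := Reg.ker (M := gr M) (p := P κ (n + 1) (m + 1)) (dl q t n m)
        (fun d f (hf : f ∈ gr M d) => ?_) (fun d w hw => ?_) (fun i d f _ => ?_)
        (stable_gr (P_mem_hs κ _ _) fun i f hf => Subalgebra.mul_mem _ (P_succ_mem_zGen i) hf)
        hreg hyN
      · have hQ : ∀ f ∈ Q q t (n + 1) (m + 1), dl q t n m f = 0 := fun f hf =>
          sub_eq_zero.2 ((mem_Q.1 hf).2 n (Nat.lt_succ_self n) m (Nat.lt_succ_self m))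
        have hsym : ∀ f ∈ Lam κ (n + 1) (m + 1), Sym Sum.inr (m + 1) f := fun f hf =>
          (mem_Inv_iff_sym.1 (S_le_Inv _ _ (Lam_le_S κ _ _ hf))).2.2
        rw [show n + 1 + (m + 1) = n + m + 1 + 1 by ring]
        refine Reg.summand (av Sum.inr m) (fun d f hf => ?_)
          (fun d f (hf : f ∈ gr M d ⊓ LinearMap.ker (dl q t n m)) => ?_) (fun d f hf => ?_)
          (fun i d f _ => av_mul (hsym _ (P_mem_Lam κ _ _ i)) f) hK
        · exact ⟨⟨Lam_le_zGen hf.1, hf.2⟩, hQ f (h.rel.Lam_le_Q _ _ hf.1)⟩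
        · refine mem_gra.2 ⟨?_, av_mem_hs _ _ hf.1.2⟩
          rw [← h.Q_eq]
          exact av_mem_Q h hf.1.1 hf.2
        · exact av_of_sym (hsym f hf.1)
      · obtain ⟨g, hg, hge⟩ := dl_mem (q := q) (t := t) hf.1
        exact ⟨⟨g, hg, hge.symm⟩, sub_mem ((linHom_sub _ _ _ _).mem_hs hf.2)
          ((linHom_sub _ _ _ _).mem_hs hf.2)⟩
      · obtain ⟨⟨g, hg, rfl⟩, hwd⟩ := hw
        obtain ⟨f, hf, hfe⟩ := exists_dl_eq h hg
        refine ⟨comp d f, (grd_adjoin zGen_homogeneous).comp_mem hf, ?_⟩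
        rw [← comp_dl, hfe]
        exact comp_of_mem hwd
      · rw [dl_mul (h.rel.sub_P (Nat.lt_succ_self n) (Nat.lt_succ_self m) i), sub_one_P]

end

section

/-! ### Identifying two variables -/

variable {κ : ℕ → ℂ} {q t : ℂ} {n m : ℕ}

theorem sb_mem_W (c : ℂ) {f : RR} (hf : f ∈ W (n + 1) (m + 1)) :
    sb (Sum.inr m) (C c * yv n) f ∈ W (n + 1) m := by
  refine map_supported_le (fun v hv => ?_) hf
  rw [sb_X]
  split_ifs with h
  · exact mul_mem (C_mem _ c) (y_mem_W (Nat.lt_succ_self n))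
  · refine X_mem_supported ?_
    rcases v with a | b
    · exact hv
    · have := inr_mem_V.1 hv
      have : b ≠ m := fun hb => h (by rw [hb])
      exact inr_mem_V.2 (by omega)

theorem sb_of_mem_W (p : RR) {f : RR} (hf : f ∈ W n m) : sb (Sum.inr m) p f = f := by
  have h : sb (Sum.inr m) p f = AlgHom.id ℂ RR f :=
    hom_congr_supported (fun v hv => sb_X_ne _ (by rintro rfl; simp at hv)) hf
  exact h

theorem sb_P (κ : ℕ → ℂ) (c : ℂ) (n m i : ℕ) :
    sb (Sum.inr m) (C c * yv n) (P κ (n + 1) (m + 1) i) =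
      P κ n m i + C (κ i + c ^ (i + 1)) * yv n ^ (i + 1) := by
  rw [P_succ_right, map_add, sb_of_mem_W _ (P_mem_W κ le_rfl le_rfl i), map_pow, sb_X_self,
    P_succ_left, mul_pow, C_add, C_pow]
  ring

theorem stable_W (κ : ℕ → ℂ) (n m : ℕ) : Stable (gr (Subalgebra.toSubmodule (W n m))) (P κ n m) :=
  stable_gr (P_mem_hs κ n m) fun i _ hv => Subalgebra.mul_mem _ (P_mem_W κ le_rfl le_rfl i) hv

theorem mul_mem_gr {A : Subalgebra ℂ RR} {f g : RR} {d e : ℤ} (hf : f ∈ A)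
    (hfe : f ∈ hs ℂ (ℕ ⊕ ℕ) e) (hg : g ∈ gr (Subalgebra.toSubmodule A) d) :
    f * g ∈ gr (Subalgebra.toSubmodule A) (d + e) :=
  mem_gra.2 ⟨mul_mem hf hg.1, by rw [add_comm]; exact mul_mem_hs hfe hg.2⟩

/-- `D` of degree `e` is regular modulo the ideal of the first `k` deformed power sums. -/
def RegMod (κ : ℕ → ℂ) (n m k : ℕ) (D : RR) (e : ℤ) : Prop :=
  ∀ d, ∀ v ∈ gr (Subalgebra.toSubmodule (W n m)) d,
    D * v ∈ idl (gr (Subalgebra.toSubmodule (W n m))) (P κ n m) k (d + e) →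
      v ∈ idl (gr (Subalgebra.toSubmodule (W n m))) (P κ n m) k d

theorem Good.regMod_lf (h : Good κ q t) {c : ℂ}
    (hF : FinQ (gr (Subalgebra.toSubmodule (W (n + 1) m)))
      (fun i => P κ n m i + C (κ i + c ^ (i + 1)) * yv n ^ (i + 1)) (n + m + 1)) :
    RegMod κ (n + 1) (m + 1) (n + m + 1) (lf n m c) 1 := by
  set G := gr (Subalgebra.toSubmodule (W (n + 1) (m + 1))) with hG
  set p := P κ (n + 1) (m + 1) with hp
  have hst := stable_W κ (n + 1) (m + 1)
  have hfd : ∀ d, FiniteDimensional ℂ (G d) := fun d => inferInstance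
  have hlW : lf n m c ∈ W (n + 1) (m + 1) := lf_mem_W (Nat.lt_succ_self n) (Nat.lt_succ_self m) c
  obtain ⟨d₁, h₁⟩ := h.finQ (n + 1) (m + 1)
  obtain ⟨d₂, h₂⟩ := hF
  have hN : n + 1 + (m + 1) = n + m + 1 + 1 := by ring
  rw [hN] at h₁
  have hcast : ((n + m + 1 + 1 : ℕ) : ℤ) = ((n + m + 1 : ℕ) : ℤ) + 1 := by push_cast; ring
  have := injective_of_eventually_surjective (G := G) (I := fun d => idl G p (n + m + 1) d)
    (p (n + m + 1)) (n + m + 1 + 1) (by omega)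
    (fun d v hv => by rw [hcast]; exact hst _ _ _ hv)
    (fun d v hv => by rw [hcast]; exact hst.mul_mem_idl _ hv)
    (fun d v hv hx => by
      rw [hcast] at hx; exact h.reg_W (n + 1) (m + 1) (n + m + 1) (by omega) d v hv hx)
    (lf n m c) 1 (fun d v hv => mul_mem_gr hlW (lf_mem_hs _ _ _) hv)
    (fun d v hv => mul_mem_idl _ _ (fun d v hv => mul_mem_gr hlW (lf_mem_hs _ _ _) hv) hv)
    (max d₁ d₂) (fun d hd v hv => ?_) (fun d hd v hv => ?_)
  · intro d v hv hD
    exact this d v hv (by simpa using hD)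
  · obtain ⟨a, ha, w, hw, rfl⟩ := mem_idl_succ.1 (h₁ _ (by
      have := le_trans (le_max_left d₁ d₂) hd
      rw [hcast]; omega) hv)
    rw [hcast, add_sub_cancel_right] at hw
    exact ⟨w, hw, by rwa [add_sub_cancel_right]⟩
  · have hlin : LinHom (sb (Sum.inr m) (C c * yv n)) := linHom_sb (C_mul_mem_hs c (X_mem_hs _))
    have hu := h₂ (d + (1 : ℕ)) (by
      have := le_trans (le_max_right d₁ d₂) hd
      push_cast; omega) (mem_gra.2 ⟨sb_mem_W c hv.1, hlin.mem_hs hv.2⟩)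
    obtain ⟨v', hv', hvv⟩ := idl_lift (M := G) (p := p) (sb (Sum.inr m) (C c * yv n)).toLinearMap
      (fun d w (hw : w ∈ gr (Subalgebra.toSubmodule (W (n + 1) m)) d) =>
        ⟨w, mem_gra.2 ⟨W_mono le_rfl (Nat.le_succ m) hw.1, hw.2⟩,
          sb_of_mem_W _ (W_mono le_rfl le_rfl hw.1)⟩)
      (fun i d v _ => by
        change sb _ _ (_ * v) = _ * sb _ _ v
        rw [map_mul, hp, sb_P]) _ _ _ hu
    have hdvd : lf n m c ∣ v - v' := by
      rw [lf_dvd_iff, map_sub]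
      exact sub_eq_zero.2 hvv.symm
    obtain ⟨w, hw⟩ := hdvd
    have hvG : v - v' ∈ G (d + (1 : ℕ)) := sub_mem hv (hst.idl_le _ _ hv')
    rw [hw] at hvG
    refine ⟨w, mem_gra.2 ⟨mem_of_mul_mem_supported hlW (lf_ne_zero _ _ _) hvG.1, ?_⟩, ?_⟩
    · have := mem_of_mul_mem_hs (lf_mem_hs n m c) (lf_ne_zero _ _ _) hvG.2
      simpa using this
    · rwa [← hw, sub_sub_cancel]

theorem RegMod.sw {k : ℕ} {D : RR} {e : ℤ} {u v : ℕ ⊕ ℕ} (huv : (u, v) ∈ Sw n m)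
    (h : RegMod κ n m k (sw u v D) e) : RegMod κ n m k D e := by
  have hfix : ∀ i, AqtCM.sw u v (P κ n m i) = P κ n m i := fun i =>
    (mem_Inv.1 (S_le_Inv n m (P_mem_S κ n m i))).2 u v huv
  have key : ∀ d f, f ∈ idl (gr (Subalgebra.toSubmodule (W n m))) (P κ n m) k d →
      AqtCM.sw u v f ∈ idl (gr (Subalgebra.toSubmodule (W n m))) (P κ n m) k d := fun d f hf =>
    idl_map_zero (AqtCM.sw u v).toLinearMap
      (fun d g (hg : g ∈ gr (Subalgebra.toSubmodule (W n m)) d) => mem_gra.2 ⟨sw_mem_W huv hg.1, (linHom_sw u v).mem_hs hg.2⟩)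
      (fun i d g _ => by
        change AqtCM.sw u v (_ * g) = _ * AqtCM.sw u v g
        rw [map_mul, hfix]) _ _ _ hf
  intro d f hf hD
  have := key _ _ hD
  rw [map_mul] at this
  have := key _ _ (h d _ (mem_gra.2 ⟨sw_mem_W huv hf.1, (linHom_sw u v).mem_hs hf.2⟩) this)
  rwa [sw_sw] at this

theorem regMod_lf_of_last {c : ℂ} {k : ℕ} (h : RegMod κ (n + 1) (m + 1) k (lf n m c) 1) {a b : ℕ}
    (ha : a < n + 1) (hb : b < m + 1) : RegMod κ (n + 1) (m + 1) k (lf a b c) 1 := by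
  refine RegMod.sw (u := Sum.inl a) (v := Sum.inl n)
    (Or.inl ⟨a, ha, n, Nat.lt_succ_self n, rfl⟩) ?_
  refine RegMod.sw (u := Sum.inr b) (v := Sum.inr m)
    (Or.inr ⟨b, hb, m, Nat.lt_succ_self m, rfl⟩) ?_
  rwa [sw_inl_lf, sw_inr_lf, Equiv.swap_apply_left, Equiv.swap_apply_left]

theorem RegMod.mul {k : ℕ} {D D' : RR} {e e' : ℤ} (h : RegMod κ n m k D e)
    (h' : RegMod κ n m k D' e') (hW : D' ∈ W n m) (he : D' ∈ hs ℂ (ℕ ⊕ ℕ) e') :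
    RegMod κ n m k (D * D') (e + e') := by
  intro d v hv hD
  refine h' d v hv (h (d + e') _ (mul_mem_gr hW he hv) ?_)
  rwa [← mul_assoc, add_assoc, add_comm e']

theorem regMod_EE {c : ℂ} {k : ℕ} (h : RegMod κ (n + 1) (m + 1) k (lf n m c) 1) :
    RegMod κ (n + 1) (m + 1) k (EE c (n + 1) (m + 1)) (((n + 1) * (m + 1) : ℕ) : ℤ) := by
  have key : ∀ T : Finset (ℕ × ℕ), T ⊆ Finset.range (n + 1) ×ˢ Finset.range (m + 1) →
      RegMod κ (n + 1) (m + 1) k (∏ x ∈ T, lf x.1 x.2 c) (T.card : ℤ) ∧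
      ∏ x ∈ T, lf x.1 x.2 c ∈ W (n + 1) (m + 1) ∧
      ∏ x ∈ T, lf x.1 x.2 c ∈ hs ℂ (ℕ ⊕ ℕ) (T.card : ℤ) := by
    intro T
    induction T using Finset.induction_on with
    | empty => exact fun _ => ⟨fun d v _ hD => by simpa using hD, by simp, by simpa using one_mem_hs⟩
    | insert x T hx ih =>
      intro hT
      obtain ⟨h1, h2, h3⟩ := ih fun y hy => hT (Finset.mem_insert_of_mem hy)
      have hx' := hT (Finset.mem_insert_self x T)
      rw [Finset.mem_product, Finset.mem_range, Finset.mem_range] at hx'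
      rw [Finset.prod_insert hx, Finset.card_insert_of_notMem hx, Nat.cast_succ,
        add_comm (T.card : ℤ) 1]
      exact ⟨(regMod_lf_of_last h hx'.1 hx'.2).mul h1 h2 h3,
        mul_mem (lf_mem_W hx'.1 hx'.2 c) h2, mul_mem_hs (lf_mem_hs _ _ _) h3⟩
  have := (key _ subset_rfl).1
  rwa [Finset.card_product, Finset.card_range, Finset.card_range] at this

theorem Good.regMod_one (h : Good κ q t) (n m : ℕ) :
    RegMod κ (n + 1) (m + 1) (n + m + 1) (lf n m 1) 1 := by
  refine h.regMod_lf ?_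
  simp only [one_pow]
  exact h.finQx n m

theorem linHom_scale (c : ℂ) (a : ℕ) : LinHom (sb (Sum.inl a) (C c * yv a)) :=
  linHom_sb (C_mul_mem_hs c (X_mem_hs _))

theorem scale_mem_W (c : ℂ) {a : ℕ} (ha : a < n) {f : RR} (hf : f ∈ W n m) :
    sb (Sum.inl a) (C c * yv a) f ∈ W n m := by
  refine map_supported_le (fun v hv => ?_) hf
  rw [sb_X]
  split_ifs with h
  · exact mul_mem (C_mem _ c) (y_mem_W ha)
  · exact X_mem_supported hv

theorem scale_scale {c : ℂ} (hc : c ≠ 0) (a : ℕ) (f : RR) :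
    sb (Sum.inl a) (C c * yv a) (sb (Sum.inl a) (C c⁻¹ * yv a) f) = f := by
  have : (sb (Sum.inl a) (C c * yv a)).comp (sb (Sum.inl a) (C c⁻¹ * yv a)) = AlgHom.id ℂ RR := by
    ext1 v
    simp only [AlgHom.comp_apply, AlgHom.id_apply]
    by_cases h : v = Sum.inl a
    · rw [h, sb_X_self, sb_C_mul, sb_X_self, ← mul_assoc, ← C_mul, inv_mul_cancel₀ hc, C_1, one_mul]
    · rw [sb_X_ne _ h, sb_X_ne _ h]
  exact DFunLike.congr_fun this f

theorem Good.regMod_div (h : Good κ q t) (n m : ℕ) :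
    RegMod κ (n + 1) (m + 1) (n + m + 1) (lf n m (q / t)) 1 := by
  refine h.regMod_lf (FinQ.map (sb (Sum.inl n) (C t⁻¹ * yv n)).toLinearMap
    (fun d v (hv : v ∈ gr (Subalgebra.toSubmodule (W (n + 1) m)) d) => mem_gra.2 ⟨scale_mem_W _ (Nat.lt_succ_self n) hv.1,
      (linHom_scale _ n).mem_hs hv.2⟩)
    (fun d v (hv : v ∈ gr (Subalgebra.toSubmodule (W (n + 1) m)) d) => ⟨sb (Sum.inl n) (C t * yv n) v, mem_gra.2
      ⟨scale_mem_W _ (Nat.lt_succ_self n) hv.1, (linHom_scale _ n).mem_hs hv.2⟩, ?_⟩)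
    (fun i d v _ => ?_) (h.finQx n m))
  · have := scale_scale (inv_ne_zero h.t_ne) n v
    rwa [inv_inv] at this
  · change sb _ _ (_ * v) = _ * sb _ _ v
    have hP : sb (Sum.inl n) (C t⁻¹ * yv n) (P κ n m i) = AlgHom.id ℂ RR (P κ n m i) :=
      hom_congr_supported (fun v hv => sb_X_ne _ (by rintro rfl; simp at hv))
        (P_mem_W κ le_rfl le_rfl i)
    have hk : (κ i + 1) * t⁻¹ ^ (i + 1) = κ i + (q / t) ^ (i + 1) := by
      have := pow_ne_zero (i + 1) h.t_ne
      rw [div_pow, inv_pow]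
      field_simp
      linear_combination (h.rel i)
    rw [map_mul, Px, map_add, hP, sb_C_mul, map_pow, sb_X_self, mul_pow, ← mul_assoc, ← C_pow,
      ← C_mul, hk, AlgHom.id_apply]

end

section

/-! ### The image algebra -/

variable {κ : ℕ → ℂ} {q t : ℂ} {n m : ℕ}

/-- The image of `Lam κ (n + 1) (m + 1)` under the identification of the last two variables. -/
def AA (κ : ℕ → ℂ) (n m : ℕ) : Subalgebra ℂ RR := Algebra.adjoin ℂ (Set.range (Px κ n m))

theorem Px_mem_AA (κ : ℕ → ℂ) (n m i : ℕ) : Px κ n m i ∈ AA κ n m :=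
  Algebra.subset_adjoin ⟨i, rfl⟩

theorem AA_le_W (κ : ℕ → ℂ) (n m : ℕ) : AA κ n m ≤ W (n + 1) m := by
  refine Algebra.adjoin_le ?_
  rintro _ ⟨i, rfl⟩
  exact Px_mem_W κ n m i

theorem grd_AA (κ : ℕ → ℂ) (n m : ℕ) : Grd (Subalgebra.toSubmodule (AA κ n m)) := by
  refine grd_adjoin ?_
  rintro _ ⟨i, rfl⟩
  exact ⟨_, Px_mem_hs κ n m i⟩

theorem map_sub_Lam (κ : ℕ → ℂ) (n m : ℕ) :
    (Lam κ (n + 1) (m + 1)).map (sub 1 1 n m) = AA κ n m := by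
  rw [Lam, AlgHom.map_adjoin, ← Set.range_comp, AA]
  congr 2
  ext1 i
  exact sub_one_P κ n m i

/-- The generator of the kernel of the identification. -/
def DD (q t : ℂ) (n m : ℕ) : RR := EE 1 (n + 1) (m + 1) * EE (q / t) (n + 1) (m + 1)

theorem DD_mem_hs (q t : ℂ) (n m : ℕ) :
    DD q t n m ∈ hs ℂ (ℕ ⊕ ℕ) ((2 * (n + 1) * (m + 1) : ℕ) : ℤ) := by
  have := mul_mem_hs (EE_mem_hs 1 (n + 1) (m + 1)) (EE_mem_hs (q / t) (n + 1) (m + 1))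
  have he : ((2 * (n + 1) * (m + 1) : ℕ) : ℤ) =
      (((n + 1) * (m + 1) : ℕ) : ℤ) + (((n + 1) * (m + 1) : ℕ) : ℤ) := by push_cast; ring
  rwa [he]

theorem DD_mem_S (q t : ℂ) (n m : ℕ) : DD q t n m ∈ S (n + 1) (m + 1) := by
  rw [← Inv_eq_S]
  exact mul_mem (EE_mem_Inv _ le_rfl (Or.inl rfl)) (EE_mem_Inv _ le_rfl (Or.inl rfl))

theorem DD_ne_zero (q t : ℂ) (n m : ℕ) : DD q t n m ≠ 0 :=
  mul_ne_zero (EE_ne_zero _ _ _) (EE_ne_zero _ _ _)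

theorem sub_eq_scale (ht : t ≠ 0) (a b : ℕ) (f : RR) :
    sub t q a b f = sb (Sum.inl a) (C t * yv a) (sub 1 (q / t) a b f) := by
  have : sub t q a b = (sb (Sum.inl a) (C t * yv a)).comp (sub 1 (q / t) a b) := by
    ext1 v
    rw [AlgHom.comp_apply]
    rcases v with i | j
    · rw [sub_y, sub_y]
      split_ifs with h
      · rw [C_1, one_mul, sb_X_self]
      · rw [sb_X_ne _ (by simpa using h)]
    · rw [sub_z, sub_z]
      split_ifs with h
      · rw [sb_C_mul, sb_X_self, ← mul_assoc, ← C_mul, div_mul_cancel₀ _ ht]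
      · rw [sb_X_ne _ (by simp)]
  rw [this, AlgHom.comp_apply]

theorem sub_eq_zero_iff_lf_dvd (ht : t ≠ 0) (a b : ℕ) (f : RR) :
    sub t q a b f = 0 ↔ lf a b (q / t) ∣ f := by
  rw [sub_eq_scale ht, lf_dvd_iff, ← sub_one_eq]
  refine ⟨fun h => ?_, fun h => by rw [h, map_zero]⟩
  have := congrArg (sb (Sum.inl a) (C t⁻¹ * yv a)) h
  have h2 := scale_scale (inv_ne_zero ht) a (sub 1 (q / t) a b f)
  rw [inv_inv] at h2
  rwa [h2, map_zero] at this

theorem EE_dvd_iff (c : ℂ) {a b : ℕ} (ha : a < n) (hb : b < m) {f : RR} (h : EE c n m ∣ f) :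
    lf a b c ∣ f := by
  refine dvd_trans ?_ h
  exact Finset.dvd_prod_of_mem (fun x : ℕ × ℕ => lf x.1 x.2 c) (a := (a, b))
    (Finset.mem_product.2 ⟨Finset.mem_range.2 ha, Finset.mem_range.2 hb⟩)

theorem DD_mul_mem (h : Good κ q t) {f : RR} (hf : f ∈ S (n + 1) (m + 1)) :
    DD q t n m * f ∈ Lam κ (n + 1) (m + 1) := by
  rw [← h.Q_eq]
  refine mem_Q.2 ⟨mul_mem (DD_mem_S q t n m) hf, fun a ha b hb => ?_⟩
  have h1 : lf a b 1 ∣ DD q t n m * f := EE_dvd_iff 1 ha hb ⟨EE (q / t) (n + 1) (m + 1) * f, by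
    rw [DD, mul_assoc]⟩
  have h2 : lf a b (q / t) ∣ DD q t n m * f := EE_dvd_iff _ ha hb ⟨EE 1 (n + 1) (m + 1) * f, by
    rw [DD]; ring⟩
  rw [lf_dvd_iff, ← sub_one_eq] at h1
  rw [h1, (sub_eq_zero_iff_lf_dvd h.t_ne a b _).2 h2]

theorem sub_DD_mul (q t : ℂ) (n m : ℕ) (f : RR) : sub 1 1 n m (DD q t n m * f) = 0 := by
  rw [sub_one_eq, ← lf_dvd_iff]
  exact EE_dvd_iff 1 (Nat.lt_succ_self n) (Nat.lt_succ_self m)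
    ⟨EE (q / t) (n + 1) (m + 1) * f, by rw [DD, mul_assoc]⟩

theorem exists_eq_DD_mul (h : Good κ q t) {f : RR} (hf : f ∈ Lam κ (n + 1) (m + 1))
    (h0 : sub 1 1 n m f = 0) : ∃ g ∈ S (n + 1) (m + 1), f = DD q t n m * g := by
  have hS := Lam_le_S κ _ _ hf
  have hI := hS
  rw [← Inv_eq_S] at hI
  have hsym := (mem_Inv_iff_sym.1 hI).2
  have hQ := (mem_Q.1 (h.rel.Lam_le_Q _ _ hf)).2
  have h1 : ∀ a < n + 1, ∀ b < m + 1, sub 1 1 a b f = 0 := by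
    intro a ha b hb
    rw [← hsym.1 a ha n (Nat.lt_succ_self n), sub_sw_inl, Equiv.swap_apply_left,
      ← hsym.2 b hb m (Nat.lt_succ_self m), sub_sw_inr, Equiv.swap_apply_left, h0, map_zero, map_zero]
  have hd : DD q t n m ∣ f := by
    refine EE_mul_dvd (fun h => absurd h one_ne_zero)
      (fun h' => absurd h' (div_ne_zero h.q_ne h.t_ne)) ?_ (EE_dvd (fun h => absurd h one_ne_zero) ?_)
      (EE_dvd (fun h' => absurd h' (div_ne_zero h.q_ne h.t_ne)) ?_)
    · intro h1
      exact h.ne ((div_eq_one_iff_eq h.t_ne).1 h1.symm)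
    · intro a ha b hb
      rw [lf_dvd_iff, ← sub_one_eq, h1 a ha b hb]
    · intro a ha b hb
      rw [← sub_eq_zero_iff_lf_dvd h.t_ne, ← hQ a ha b hb, h1 a ha b hb]
  obtain ⟨g, rfl⟩ := hd
  have hD := DD_mem_S q t n m
  rw [← Inv_eq_S] at hD
  refine ⟨g, ?_, rfl⟩
  rw [← Inv_eq_S]
  exact mem_Inv_of_mul hD (DD_ne_zero q t n m) hI

theorem Good.descend_DD (h : Good κ q t) (n m : ℕ) {j : ℕ} (hj : j ≤ n + m + 1) (d : ℤ) (v : RR)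
    (hv : v ∈ gr (Subalgebra.toSubmodule (S (n + 1) (m + 1))) d)
    (hD : DD q t n m * v ∈ idl (gr (Subalgebra.toSubmodule (S (n + 1) (m + 1))))
      (P κ (n + 1) (m + 1)) j (d + ((2 * (n + 1) * (m + 1) : ℕ) : ℤ))) :
    v ∈ idl (gr (Subalgebra.toSubmodule (S (n + 1) (m + 1)))) (P κ (n + 1) (m + 1)) j d := by
  have hR := (h.reg_S (n + 1) (m + 1)).mono (l := n + m + 1) (by omega)
  refine hR.descend (stable_gr (P_mem_hs κ _ _) fun i _ hv =>
    Subalgebra.mul_mem _ (P_mem_S κ _ _ i) hv) (fun d hd => gr_neg _ hd) _ _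
    (fun d v hv => mul_mem_gr (DD_mem_S q t n m) (DD_mem_hs q t n m) hv)
    (fun d v hv hD => ?_) j hj d v hv hD
  have hle : ∀ d, gr (Subalgebra.toSubmodule (S (n + 1) (m + 1))) d ≤
      gr (Subalgebra.toSubmodule (W (n + 1) (m + 1))) d := fun d f hf => ⟨S_le_W _ _ hf.1, hf.2⟩
  have hmod : RegMod κ (n + 1) (m + 1) (n + m + 1) (DD q t n m)
      ((2 * (n + 1) * (m + 1) : ℕ) : ℤ) := by
    have := (regMod_EE (h.regMod_one n m)).mul (regMod_EE (h.regMod_div n m))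
      (mem_Inv.1 (EE_mem_Inv (q / t) le_rfl (Or.inl rfl))).1 (EE_mem_hs _ _ _)
    have he : ((2 * (n + 1) * (m + 1) : ℕ) : ℤ) =
        (((n + 1) * (m + 1) : ℕ) : ℤ) + (((n + 1) * (m + 1) : ℕ) : ℤ) := by push_cast; ring
    rwa [he]
  exact pure_S hv (hmod d v (hle d hv) (idl_mono hle _ _ hD))

theorem exists_sub_eq {d : ℤ} {w : RR} (hw : w ∈ gr (Subalgebra.toSubmodule (AA κ n m)) d) :
    ∃ v ∈ gr (Subalgebra.toSubmodule (Lam κ (n + 1) (m + 1))) d, sub 1 1 n m v = w := by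
  obtain ⟨hw, hwd⟩ := mem_gra.1 hw
  rw [← map_sub_Lam] at hw
  obtain ⟨v, hv, hvw⟩ := hw
  refine ⟨comp d v, (grd_Lam κ _ _).comp_mem hv, ?_⟩
  rw [← (linHom_sub 1 1 n m).comp]
  exact (congrArg (comp d) hvw).trans (comp_of_mem hwd)

theorem sub_mem_gr_AA {d : ℤ} {v : RR}
    (hv : v ∈ gr (Subalgebra.toSubmodule (Lam κ (n + 1) (m + 1))) d) :
    sub 1 1 n m v ∈ gr (Subalgebra.toSubmodule (AA κ n m)) d := by
  refine mem_gra.2 ⟨?_, (linHom_sub 1 1 n m).mem_hs hv.2⟩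
  rw [← map_sub_Lam]
  exact ⟨v, hv.1, rfl⟩

theorem exists_eq_DD_mul_gr (h : Good κ q t) {d : ℤ} {v : RR}
    (hv : v ∈ gr (Subalgebra.toSubmodule (Lam κ (n + 1) (m + 1))) d)
    (h0 : sub 1 1 n m v = 0) :
    ∃ s ∈ gr (Subalgebra.toSubmodule (S (n + 1) (m + 1))) (d - ((2 * (n + 1) * (m + 1) : ℕ) : ℤ)),
      v = DD q t n m * s := by
  obtain ⟨s, hs, rfl⟩ := exists_eq_DD_mul h hv.1 h0
  refine ⟨s, mem_gra.2 ⟨hs, mem_of_mul_mem_hs (DD_mem_hs q t n m) (DD_ne_zero q t n m) ?_⟩, rfl⟩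
  exact hv.2

theorem DD_mul_mem_gr (h : Good κ q t) {d : ℤ} {v : RR}
    (hv : v ∈ gr (Subalgebra.toSubmodule (S (n + 1) (m + 1)))
      (d - ((2 * (n + 1) * (m + 1) : ℕ) : ℤ))) :
    DD q t n m * v ∈ gr (Subalgebra.toSubmodule (Lam κ (n + 1) (m + 1))) d := by
  have := mul_mem_hs (DD_mem_hs q t n m) hv.2
  rw [add_sub_cancel] at this
  exact mem_gra.2 ⟨DD_mul_mem h hv.1, this⟩

/-- The generators of the image algebra form a regular sequence in it. -/
theorem Good.reg_AA (h : Good κ q t) (n m : ℕ) :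
    Reg (gr (Subalgebra.toSubmodule (AA κ n m))) (Px κ n m) (n + m + 1) := by
  refine Reg.coker (p := P κ (n + 1) (m + 1)) (sub 1 1 n m).toLinearMap (DD q t n m)
    ((2 * (n + 1) * (m + 1) : ℕ) : ℤ) (fun d v (hv : v ∈ gr (Subalgebra.toSubmodule (Lam κ (n + 1) (m + 1))) d) =>
      (⟨Lam_le_S κ _ _ hv.1, hv.2⟩ : v ∈ gr (Subalgebra.toSubmodule (S (n + 1) (m + 1))) d))
    (fun d v hv => DD_mul_mem_gr h hv) (fun d v _ => sub_DD_mul q t n m v)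
    (fun d v hv h0 => exists_eq_DD_mul_gr h hv h0)
    (fun j hj d v hv hD => h.descend_DD n m hj d v hv hD) (fun d v hv => sub_mem_gr_AA hv)
    (fun d w hw => exists_sub_eq hw) (fun i d v _ => ?_)
    (stable_gr (P_mem_hs κ _ _) fun i _ hv => Subalgebra.mul_mem _ (P_mem_Lam κ _ _ i) hv)
    ((h.reg_Lam (n + 1) (m + 1)).mono (by omega))
  change sub 1 1 n m (_ * v) = _ * sub 1 1 n m v
  rw [map_mul, sub_one_P]

theorem Good.finrank_AA (h : Good κ q t) (n m : ℕ) (d : ℤ) :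
    Module.finrank ℂ (gr (Subalgebra.toSubmodule (Lam κ (n + 1) (m + 1))) d) =
      Module.finrank ℂ (gr (Subalgebra.toSubmodule (AA κ n m)) d) +
      Module.finrank ℂ (gr (Subalgebra.toSubmodule (S (n + 1) (m + 1)))
        (d - ((2 * (n + 1) * (m + 1) : ℕ) : ℤ))) :=
  finrank_of_exact (sub 1 1 n m).toLinearMap (DD q t n m) (DD_ne_zero q t n m)
    (fun _ hv => sub_mem_gr_AA hv) (fun _ hw => exists_sub_eq hw)
    (fun v hv => ⟨DD_mul_mem_gr h hv, sub_DD_mul q t n m v⟩)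
    (fun _ hv h0 => exists_eq_DD_mul_gr h hv h0)

theorem Good.hilb_AA (h : Good κ q t) (n m : ℕ) :
    hilb (Subalgebra.toSubmodule (AA κ n m)) * (qp (n + 1) * qp (m + 1)) =
      (∑ i ∈ Finset.range (m + 2), PowerSeries.X ^ (i * (n + 2)) *
        ∏ k ∈ Finset.Ico i (m + 1), (1 - PowerSeries.X ^ (k + 1))) -
      PowerSeries.X ^ (2 * (n + 1) * (m + 1)) := by
  have h1 := hilb_add (h.finrank_AA n m)
  have h2 := hilb_S (n + 1) (m + 1)
  have h3 := hilb_Lam_zero (n + 1) (m + 1)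
  have h4 : hilb (Subalgebra.toSubmodule (Lam κ (n + 1) (m + 1))) =
      hilb (Subalgebra.toSubmodule (Lam (fun _ => -1) (n + 1) (m + 1))) := by
    ext k
    simp only [hilb, PowerSeries.coeff_mk]
    rw [h.finrank_eq]
  rw [← h4] at h3
  rw [← h3, h1]
  linear_combination -(PowerSeries.X ^ (2 * (n + 1) * (m + 1))) * h2

end

/-! ### Weil generic parameters -/

/-- `A q t` holds for Weil generic `(q, t)`. -/
def Gen (A : ℂ → ℂ → Prop) : Prop :=
  ∃ Z : ℕ → MvPolynomial (Fin 2) ℂ, (∀ k, Z k ≠ 0) ∧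
    ∀ q t, (∀ k, eval ![q, t] (Z k) ≠ 0) → A q t

theorem Gen.of_poly {p : MvPolynomial (Fin 2) ℂ} (hp : p ≠ 0) {A : ℂ → ℂ → Prop}
    (h : ∀ q t, eval ![q, t] p ≠ 0 → A q t) : Gen A :=
  ⟨fun _ => p, fun _ => hp, fun q t hZ => h q t (hZ 0)⟩

theorem Gen.of_eval {p : MvPolynomial (Fin 2) ℂ} (q₀ t₀ : ℂ) (hp : eval ![q₀, t₀] p ≠ 0)
    {A : ℂ → ℂ → Prop} (h : ∀ q t, eval ![q, t] p ≠ 0 → A q t) : Gen A :=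
  Gen.of_poly (fun h0 => hp (by rw [h0, map_zero])) h

theorem Gen.of_forall {A : ℂ → ℂ → Prop} (h : ∀ q t, A q t) : Gen A :=
  Gen.of_poly one_ne_zero fun q t _ => h q t

theorem Gen.mono {A B : ℂ → ℂ → Prop} (h : Gen A) (hAB : ∀ q t, A q t → B q t) : Gen B := by
  obtain ⟨Z, hZ, h⟩ := h
  exact ⟨Z, hZ, fun q t hq => hAB q t (h q t hq)⟩

theorem Gen.all {ι : Type*} [Countable ι] {A : ι → ℂ → ℂ → Prop} (h : ∀ i, Gen (A i)) :
    Gen fun q t => ∀ i, A i q t := by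
  choose Z hZ hA using h
  obtain ⟨e, he⟩ := exists_injective_nat ι
  classical
  refine ⟨fun k => if hk : ∃ i, e i = k.unpair.1 then Z hk.choose k.unpair.2 else 1,
    fun k => ?_, fun q t hq i => hA i q t fun j => ?_⟩
  · dsimp only
    split_ifs
    · exact hZ _ _
    · exact one_ne_zero
  · have := hq (Nat.pair (e i) j)
    have hk : ∃ i', e i' = (Nat.pair (e i) j).unpair.1 := ⟨i, by rw [Nat.unpair_pair]⟩
    dsimp only at this
    rw [dif_pos hk] at this
    have hi : hk.choose = i := he (by rw [hk.choose_spec, Nat.unpair_pair])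
    rwa [hi, Nat.unpair_pair] at this

theorem Gen.and {A B : ℂ → ℂ → Prop} (hA : Gen A) (hB : Gen B) : Gen fun q t => A q t ∧ B q t := by
  have : Gen fun q t => ∀ b : Bool, bif b then A q t else B q t := Gen.all fun b => by
    cases b
    · exact hB
    · exact hA
  exact this.mono fun q t h => ⟨h true, h false⟩

/-- Families of polynomials depending polynomially on two parameters. -/
def PF (u : ℂ → ℂ → RR) : Prop :=
  ∃ v : MvPolynomial (ℕ ⊕ ℕ) (MvPolynomial (Fin 2) ℂ), ∀ q t, u q t = map (eval ![q, t]) v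

theorem PF.const (f : RR) : PF fun _ _ => f :=
  ⟨map C f, fun q t => by
    rw [map_map, show (eval ![q, t]).comp C = RingHom.id ℂ by ext; simp, map_id]⟩

theorem PF.coeff (p : MvPolynomial (Fin 2) ℂ) : PF fun q t => C (eval ![q, t] p) :=
  ⟨C p, fun q t => by rw [map_C]⟩

theorem PF.fst_pow (k : ℕ) : PF fun q _ => C (q ^ k) := by
  have := PF.coeff (X 0 ^ k)
  simpa using this

theorem PF.snd_pow (k : ℕ) : PF fun _ t => C (t ^ k) := by
  have := PF.coeff (X 1 ^ k)
  simpa using this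

theorem PF.add {u v : ℂ → ℂ → RR} (hu : PF u) (hv : PF v) : PF fun q t => u q t + v q t := by
  obtain ⟨a, ha⟩ := hu
  obtain ⟨b, hb⟩ := hv
  exact ⟨a + b, fun q t => by simp only [ha, hb, map_add]⟩

theorem PF.mul {u v : ℂ → ℂ → RR} (hu : PF u) (hv : PF v) : PF fun q t => u q t * v q t := by
  obtain ⟨a, ha⟩ := hu
  obtain ⟨b, hb⟩ := hv
  exact ⟨a * b, fun q t => by simp only [ha, hb, map_mul]⟩

theorem PF.sub {u v : ℂ → ℂ → RR} (hu : PF u) (hv : PF v) : PF fun q t => u q t - v q t := by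
  obtain ⟨a, ha⟩ := hu
  obtain ⟨b, hb⟩ := hv
  exact ⟨a - b, fun q t => by simp only [ha, hb, map_sub]⟩

theorem map_eq_sum (e : MvPolynomial (Fin 2) ℂ →+* ℂ)
    (v : MvPolynomial (ℕ ⊕ ℕ) (MvPolynomial (Fin 2) ℂ)) :
    map e v = ∑ c ∈ v.support, e (MvPolynomial.coeff c v) • monomial c (1 : ℂ) := by
  conv_lhs => rw [v.as_sum, map_sum]
  refine Finset.sum_congr rfl fun c _ => ?_
  rw [map_monomial, smul_monomial, smul_eq_mul, mul_one]

theorem PF.linear {u : ℂ → ℂ → RR} (hu : PF u) (φ : RR →ₗ[ℂ] RR) : PF fun q t => φ (u q t) := by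
  obtain ⟨v, hv⟩ := hu
  refine ⟨∑ c ∈ v.support, C (MvPolynomial.coeff c v) * map C (φ (monomial c 1)), fun q t => ?_⟩
  beta_reduce
  rw [hv, map_eq_sum, map_sum, map_sum]
  refine Finset.sum_congr rfl fun c _ => ?_
  rw [map_smul, map_mul, map_C, map_map, show (eval ![q, t]).comp C = RingHom.id ℂ by ext; simp,
    map_id, smul_eq_C_mul]

theorem PF.functional {u : ℂ → ℂ → RR} (hu : PF u) (φ : RR →ₗ[ℂ] ℂ) :
    ∃ p : MvPolynomial (Fin 2) ℂ, ∀ q t, eval ![q, t] p = φ (u q t) := by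
  obtain ⟨v, hv⟩ := hu
  refine ⟨∑ c ∈ v.support, MvPolynomial.coeff c v * C (φ (monomial c 1)), fun q t => ?_⟩
  rw [hv, map_eq_sum, map_sum, map_sum]
  refine Finset.sum_congr rfl fun c _ => ?_
  rw [map_smul, map_mul, eval_C, smul_eq_mul]

theorem PF.sub_hom (a b : ℕ) (f : RR) : PF fun q t => AqtCM.sub t q a b f := by
  induction f using MvPolynomial.induction_on with
  | C c =>
    simp only [alg_C]
    exact PF.const _
  | add f g hf hg =>
    simp only [map_add]
    exact hf.add hg
  | mul_X f v hf =>
    simp only [map_mul]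
    refine hf.mul ?_
    rcases v with i | j
    · simp only [sub_y]
      split_ifs
      · have := (PF.snd_pow 1).mul (PF.const (yv a))
        simpa using this
      · exact PF.const _
    · simp only [sub_z]
      split_ifs
      · have := (PF.fst_pow 1).mul (PF.const (yv a))
        simpa using this
      · exact PF.const _

theorem PF.dl (n m : ℕ) (f : RR) : PF fun q t => dl q t n m f :=
  (PF.const _).sub (PF.sub_hom n m f)

/-- Linear independence is an open condition. -/
theorem PF.linearIndependent {J : Type*} [Fintype J] {u : J → ℂ → ℂ → RR} (hu : ∀ j, PF (u j))
    {q₀ t₀ : ℂ} (h : LinearIndependent ℂ fun j => u j q₀ t₀) :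
    ∃ p : MvPolynomial (Fin 2) ℂ, eval ![q₀, t₀] p ≠ 0 ∧
      ∀ q t, eval ![q, t] p ≠ 0 → LinearIndependent ℂ fun j => u j q t := by
  classical
  have hφ : ∃ φ : J → RR →ₗ[ℂ] ℂ, ∀ i j, φ j (u i q₀ t₀) = if i = j then 1 else 0 := by
    let b := Module.Basis.extend (h.linearIndepOn_id)
    have hmem : ∀ j, u j q₀ t₀ ∈ (h.linearIndepOn_id).extend (Set.subset_univ _) := fun j =>
      Module.Basis.subset_extend h.linearIndepOn_id ⟨j, rfl⟩
    refine ⟨fun j => b.coord ⟨u j q₀ t₀, hmem j⟩, fun i j => ?_⟩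
    have hb : b ⟨u i q₀ t₀, hmem i⟩ = u i q₀ t₀ := Module.Basis.extend_apply_self _ _
    rw [← hb, Module.Basis.coord_apply, Module.Basis.repr_self, Finsupp.single_apply]
    refine if_congr ?_ rfl rfl
    rw [Subtype.mk.injEq, h.injective.eq_iff]
  obtain ⟨φ, hφ⟩ := hφ
  choose p hp using fun i j => (hu i).functional (φ j)
  have hdet : ∀ q t, eval ![q, t] (Matrix.of p).det =
      (Matrix.of fun i j => φ j (u i q t)).det := fun q t => by
    rw [RingHom.map_det]
    congr 1
    ext i j
    exact hp i j q t
  refine ⟨(Matrix.of p).det, ?_, fun q t hq => ?_⟩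
  · rw [hdet]
    have : (Matrix.of fun i j => φ j (u i q₀ t₀)) = 1 := by
      ext i j
      rw [Matrix.of_apply, hφ, Matrix.one_apply]
    rw [this, Matrix.det_one]
    exact one_ne_zero
  · rw [hdet] at hq
    have hrow := Matrix.linearIndependent_rows_of_det_ne_zero hq
    exact LinearIndependent.of_comp (LinearMap.pi φ) hrow

theorem gen_finrank_le {M₀ : Submodule ℂ RR} [FiniteDimensional ℂ M₀]
    {M : ℂ → ℂ → Submodule ℂ RR} {T : ℂ → ℂ → Prop} (q₀ t₀ : ℂ)
    (h : ∀ f ∈ M₀, ∃ u, PF u ∧ u q₀ t₀ = f ∧ ∀ q t, T q t → u q t ∈ M q t)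
    (hfd : ∀ q t, FiniteDimensional ℂ (M q t)) :
    Gen fun q t => T q t → Module.finrank ℂ M₀ ≤ Module.finrank ℂ (M q t) := by
  let b := Module.finBasis ℂ M₀
  choose u hu hu0 huM using fun j => h (b j) (b j).2
  have hli : LinearIndependent ℂ fun j => u j q₀ t₀ := by
    simp only [hu0]
    exact b.linearIndependent.map' M₀.subtype (Submodule.ker_subtype _)
  obtain ⟨p, hp, hpu⟩ := PF.linearIndependent hu hli
  refine Gen.of_eval q₀ t₀ hp fun q t hq hT => ?_
  have := hfd q t
  have hl : LinearIndependent ℂ fun j => (⟨u j q t, huM j q t hT⟩ : M q t) :=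
    LinearIndependent.of_comp (M q t).subtype (hpu q t hq)
  simpa using hl.fintype_card_le_finrank

section

/-! ### Generic equality of the deformed algebra and the quasi-invariants -/

variable {κ : ℕ → ℂ} {q t : ℂ} {n m : ℕ}

/-- The coefficients of the deformed power sums. -/
def kap (q t : ℂ) (i : ℕ) : ℂ := (q ^ (i + 1) - 1) / (1 - t ^ (i + 1))

/-- `t` is not a root of unity. -/
def NRU (t : ℂ) : Prop := ∀ i : ℕ, t ^ (i + 1) ≠ 1

theorem NRU.ne_zero (h : NRU t) (i : ℕ) : 1 - t ^ (i + 1) ≠ 0 := sub_ne_zero.2 (h i).symm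

theorem NRU.rel (h : NRU t) (q : ℂ) : Rel (kap q t) q t := fun i =>
  div_mul_cancel₀ _ (h.ne_zero i)

theorem NRU.mul_P (h : NRU t) (q : ℂ) (n m i : ℕ) :
    (C (q ^ (i + 1)) - 1) * py n i + (1 - C (t ^ (i + 1))) * pz m i =
      C (1 - t ^ (i + 1)) * P (kap q t) n m i := by
  rw [P, mul_add, ← mul_assoc, ← C_mul, mul_comm (1 - t ^ (i + 1)), h.rel q i, C_sub, C_sub, C_1]

theorem PF.num (n m i : ℕ) : PF fun q t =>
    (C (q ^ (i + 1)) - 1) * py n i + (1 - C (t ^ (i + 1))) * pz m i :=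
  (((PF.fst_pow _).sub (PF.const 1)).mul (PF.const _)).add
    (((PF.const 1).sub (PF.snd_pow _)).mul (PF.const _))

theorem exists_family_Lam {f : RR} (hf : f ∈ Lam (fun _ => -1) n m) :
    ∃ u, PF u ∧ u 0 0 = f ∧ ∀ q t, NRU t → u q t ∈ Lam (kap q t) n m := by
  induction hf using Algebra.adjoin_induction with
  | mem f hf =>
    obtain ⟨i, rfl⟩ := hf
    refine ⟨_, PF.num n m i, ?_, fun q t h => ?_⟩
    · simp [P]
    · rw [h.mul_P]
      exact mul_mem (C_mem _ _) (P_mem_Lam _ _ _ i)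
  | algebraMap c => exact ⟨_, PF.const _, rfl, fun q t _ => Subalgebra.algebraMap_mem _ c⟩
  | add f g _ _ hf hg =>
    obtain ⟨u, hu, rfl, hu'⟩ := hf
    obtain ⟨v, hv, rfl, hv'⟩ := hg
    exact ⟨_, hu.add hv, rfl, fun q t h => add_mem (hu' q t h) (hv' q t h)⟩
  | mul f g _ _ hf hg =>
    obtain ⟨u, hu, rfl, hu'⟩ := hf
    obtain ⟨v, hv, rfl, hv'⟩ := hg
    exact ⟨_, hu.mul hv, rfl, fun q t h => mul_mem (hu' q t h) (hv' q t h)⟩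

theorem gen_finrank_Lam (n m : ℕ) (d : ℤ) : Gen fun q t => NRU t →
    Module.finrank ℂ (gr (Subalgebra.toSubmodule (Lam (fun _ => -1) n m)) d) ≤
      Module.finrank ℂ (gr (Subalgebra.toSubmodule (Lam (kap q t) n m)) d) := by
  refine gen_finrank_le (T := fun _ t => NRU t) 0 0 (fun f hf => ?_) fun q t => inferInstance
  obtain ⟨u, hu, rfl, h⟩ := exists_family_Lam hf.1
  exact ⟨_, hu.linear (comp d), comp_of_mem hf.2, fun q t ht => (grd_Lam _ _ _).comp_mem (h q t ht)⟩

theorem mem_Q_succ {f : RR} :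
    f ∈ Q q t (n + 1) (m + 1) ↔ f ∈ S (n + 1) (m + 1) ∧ dl q t n m f = 0 := by
  rw [mem_Q]
  refine and_congr_right fun hS => ⟨fun h => sub_eq_zero.2
    (h n (Nat.lt_succ_self n) m (Nat.lt_succ_self m)), fun h a ha b hb => ?_⟩
  rw [← Inv_eq_S] at hS
  have hsym := (mem_Inv_iff_sym.1 hS).2
  rw [dl_apply, sub_eq_zero] at h
  rw [← hsym.1 a ha n (Nat.lt_succ_self n), sub_sw_inl, sub_sw_inl, Equiv.swap_apply_left,
    ← hsym.2 b hb m (Nat.lt_succ_self m), sub_sw_inr, sub_sw_inr, Equiv.swap_apply_left, h]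

theorem finrank_map_add_inf_ker {K V V' : Type*} [Field K] [AddCommGroup V] [Module K V]
    [AddCommGroup V'] [Module K V'] (φ : V →ₗ[K] V') (M : Submodule K V) [FiniteDimensional K M] :
    Module.finrank K (M.map φ) + Module.finrank K (M ⊓ LinearMap.ker φ : Submodule K V) =
      Module.finrank K M := by
  have h := (φ.domRestrict M).finrank_range_add_finrank_ker
  rw [LinearMap.range_domRestrict] at h
  have e : (LinearMap.ker (φ.domRestrict M)).map M.subtype = M ⊓ LinearMap.ker φ := by
    ext v
    simp only [Submodule.mem_map, LinearMap.mem_ker, Submodule.mem_inf]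
    constructor
    · rintro ⟨w, hw, rfl⟩
      exact ⟨w.2, hw⟩
    · rintro ⟨hv, h0⟩
      exact ⟨⟨v, hv⟩, h0, rfl⟩
  rwa [← e, Submodule.finrank_map_subtype_eq]

theorem gen_finrank_Q (n m : ℕ) (d : ℤ) : Gen fun q t =>
    Module.finrank ℂ (gr (Subalgebra.toSubmodule (Q q t n m)) d) ≤
      Module.finrank ℂ (gr (Subalgebra.toSubmodule (Q 0 0 n m)) d) := by
  rcases n with _ | n
  · have : ∀ q t, Q q t 0 m = S 0 m := fun q t => by ext f; simp [mem_Q]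
    exact Gen.of_forall fun q t => by rw [this, this]
  rcases m with _ | m
  · have : ∀ q t, Q q t (n + 1) 0 = S (n + 1) 0 := fun q t => by ext f; simp [mem_Q]
    exact Gen.of_forall fun q t => by rw [this, this]
  set M := gr (Subalgebra.toSubmodule (S (n + 1) (m + 1))) d with hM
  have hQ : ∀ q t, gr (Subalgebra.toSubmodule (Q q t (n + 1) (m + 1))) d =
      M ⊓ LinearMap.ker (dl q t n m) := fun q t => by
    ext f
    rw [mem_gra, mem_Q_succ, Submodule.mem_inf, hM, mem_gra, LinearMap.mem_ker]
    tauto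
  have := gen_finrank_le (M₀ := M.map (dl 0 0 n m)) (M := fun q t => M.map (dl q t n m))
    (T := fun _ _ => True) 0 0 (fun f hf => ?_) fun q t => inferInstance
  · refine this.mono fun q t h => ?_
    rw [hQ, hQ]
    refine le_of_add_le_add_left (a := Module.finrank ℂ (M.map (dl q t n m))) ?_
    refine (finrank_map_add_inf_ker (dl q t n m) M).trans_le
      ((finrank_map_add_inf_ker (dl 0 0 n m) M).symm.trans_le ?_)
    exact Nat.add_le_add_right (h trivial) _
  · obtain ⟨g, hg, rfl⟩ := hf
    exact ⟨_, PF.dl n m g, rfl, fun q t _ => ⟨g, hg, rfl⟩⟩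

theorem grd_Q (q t : ℂ) (n m : ℕ) : Grd (Subalgebra.toSubmodule (Q q t n m)) := by
  intro d f hf
  obtain ⟨hS, h⟩ := mem_Q.1 hf
  refine mem_Q.2 ⟨grd_S n m d f hS, fun a ha b hb => ?_⟩
  rw [← (linHom_sub _ _ _ _).comp, ← (linHom_sub _ _ _ _).comp, h a ha b hb]

theorem gen_Q_eq (n m : ℕ) : Gen fun q t => NRU t → Q q t n m = Lam (kap q t) n m ∧
    ∀ d, Module.finrank ℂ (gr (Subalgebra.toSubmodule (Lam (kap q t) n m)) d) =
      Module.finrank ℂ (gr (Subalgebra.toSubmodule (Lam (fun _ => -1) n m)) d) := by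
  have h : Gen fun q t => ∀ d, _ := Gen.all fun d => (gen_finrank_Lam n m d).and (gen_finrank_Q n m d)
  refine h.mono fun q t h ht => ?_
  have hle : ∀ d, gr (Subalgebra.toSubmodule (Lam (kap q t) n m)) d ≤
      gr (Subalgebra.toSubmodule (Q q t n m)) d := fun d f hf =>
    ⟨(ht.rel q).Lam_le_Q n m hf.1, hf.2⟩
  have h0 : ∀ d, Module.finrank ℂ (gr (Subalgebra.toSubmodule (Q 0 0 n m)) d) =
      Module.finrank ℂ (gr (Subalgebra.toSubmodule (Lam (fun _ => -1) n m)) d) := fun d => by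
    rw [Q_zero_eq_Lam]
  have h1 : ∀ d, Module.finrank ℂ (gr (Subalgebra.toSubmodule (Lam (kap q t) n m)) d) ≤
      Module.finrank ℂ (gr (Subalgebra.toSubmodule (Q q t n m)) d) := fun d =>
    Submodule.finrank_mono (hle d)
  refine ⟨le_antisymm (fun f hf => ?_) ((ht.rel q).Lam_le_Q n m), fun d => ?_⟩
  · refine mem_of_comp (W := Subalgebra.toSubmodule (Lam (kap q t) n m)) fun d => ?_
    have := Submodule.eq_of_le_of_finrank_le (hle d) (by
      have := (h d).1 ht
      have := (h d).2
      have := h0 d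
      omega)
    have hc := (grd_Q q t n m).comp_mem (d := d) hf
    rw [← this] at hc
    exact hc.1
  · have := (h d).1 ht
    have := (h d).2
    have := h0 d
    have := h1 d
    omega

end

/-! ### Finiteness at a special point -/

section

variable {K σ : Type*} [Field K]

/-- A homogeneous polynomial of degree `d` in the variables of `s` lies in the `d`-th power of
the ideal they generate. -/
theorem mem_span_X_pow {s : Set σ} {d : ℕ} {f : MvPolynomial σ K} (hf : f ∈ supported K s)
    (hd : f ∈ hs K σ d) : f ∈ Ideal.span ((X : σ → MvPolynomial σ K) '' s) ^ d := by
  rw [mem_hs_iff_natCast] at hd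
  rw [f.as_sum]
  refine sum_mem fun c hc => ?_
  have hcd : ∑ v ∈ c.support, c v = d := by
    have := hd (mem_support_iff.1 hc)
    rw [Finsupp.weight_apply, Finsupp.sum] at this
    simpa only [Pi.one_apply, smul_eq_mul, mul_one] using this
  rw [monomial_eq]
  refine Ideal.mul_mem_left _ _ ?_
  rw [Finsupp.prod, ← hcd, ← Finset.prod_pow_eq_pow_sum]
  refine Ideal.prod_mem_prod fun v hv => Ideal.pow_mem_pow ?_ _
  exact Ideal.subset_span ⟨v, mem_supported.1 hf ((mem_vars_iff_mem_support v).2 ⟨c, hc, hv⟩), rfl⟩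

theorem comp_theta_mem_idl {s : Set σ} {p : ℕ → MvPolynomial σ K}
    (hp : ∀ i : ℕ, p i ∈ hs K σ (i + 1)) (hps : ∀ i, p i ∈ supported K s) (k : ℕ)
    {f : MvPolynomial σ K} (hf : f ∈ Ideal.span (p '' Set.Iio k)) (d : ℤ) :
    comp d (theta s f) ∈ idl (gr (Subalgebra.toSubmodule (supported K s))) p k d := by
  induction k generalizing f with
  | zero =>
    have : f = 0 := by simpa using hf
    rw [this, map_zero, map_zero]
    exact zero_mem _
  | succ k ih =>
    have hIio : Set.Iio (k + 1) = Set.Iio k ∪ {k} := by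
      ext i
      simp only [Set.mem_Iio, Set.mem_union, Set.mem_singleton_iff]
      omega
    rw [hIio, Set.image_union, Set.image_singleton, Ideal.span_union, Submodule.mem_sup] at hf
    obtain ⟨g, hg, h, hh, rfl⟩ := hf
    obtain ⟨a, rfl⟩ := Ideal.mem_span_singleton'.1 hh
    refine mem_idl_succ.2 ⟨_, ih hg, comp (d - (k + 1)) (theta s a),
      (grd_supported s).comp_mem ?_, ?_⟩
    · refine mem_supported_iff.2 (AlgHom.congr_fun (φ₁ := (theta s).comp (theta s)) ?_ a)
      ext v
      by_cases hv : v ∈ s <;> simp [theta, hv]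
    · rw [map_add, map_add, map_mul, mem_supported_iff.1 (hps k), mul_comm, comp_mul' (hp k)]

theorem finQ_of_pow_mem {s : Set σ} (hs' : s.Finite) {p : ℕ → MvPolynomial σ K}
    (hp : ∀ i : ℕ, p i ∈ hs K σ (i + 1)) (hps : ∀ i, p i ∈ supported K s) {k : ℕ}
    (h : ∀ v ∈ s, ∃ N : ℕ, (X v : MvPolynomial σ K) ^ N ∈ Ideal.span (p '' Set.Iio k)) :
    FinQ (gr (Subalgebra.toSubmodule (supported K s))) p k := by
  obtain ⟨N, hN⟩ := Ideal.exists_pow_le_of_le_radical_of_fg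
    (I := Ideal.span ((X : σ → MvPolynomial σ K) '' s)) (J := Ideal.span (p '' Set.Iio k))
    (Ideal.span_le.2 (by rintro _ ⟨v, hv, rfl⟩; exact h v hv))
    ⟨(hs'.image X).toFinset, by simp⟩
  refine ⟨N, fun d hd f hf => ?_⟩
  obtain ⟨e, rfl⟩ := Int.eq_ofNat_of_zero_le ((Int.natCast_nonneg N).trans hd)
  have hJ := hN (Ideal.pow_le_pow_right (Int.ofNat_le.1 hd) (mem_span_X_pow hf.1 hf.2))
  have := comp_theta_mem_idl hp hps k hJ e
  rwa [mem_supported_iff.1 hf.1, comp_of_mem hf.2] at this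

end

theorem pow_card_add_mem {ι : Type*} [DecidableEq ι] {s : Finset ι} {v : ι → RR} {J : Ideal RR}
    (h : ∀ i < s.card - 1, ∑ a ∈ s, v a ^ (i + 1) ∈ J) {a : ι} (ha : a ∈ s) :
    v a ^ s.card + PowerSeries.coeff s.card (lin s v) ∈ J := by
  have h0 := sum_coeff_lin_eq_zero v ha
  obtain ⟨N, hN⟩ : ∃ N, s.card = N + 1 := Nat.exists_eq_succ_of_ne_zero (Finset.card_ne_zero_of_mem ha)
  rw [hN] at h h0 ⊢
  have hc : ∀ i < N, PowerSeries.coeff (i + 1) (lin s v) ∈ J :=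
    coeff_mem_ideal_of_derivative ℂ (derivative_lin s v) J N fun i hi => by
      rw [map_neg, psums, PowerSeries.coeff_mk]
      exact J.neg_mem (h i hi)
  rw [Finset.Nat.sum_antidiagonal_eq_sum_range_succ_mk, Finset.sum_range_succ,
    Finset.sum_range_succ'] at h0
  simp only [Nat.sub_self, pow_zero, mul_one, Nat.sub_zero, coeff_zero_lin, one_mul] at h0
  rw [add_assoc] at h0
  rw [eq_neg_of_add_eq_zero_right h0]
  exact J.neg_mem (sum_mem fun i hi => J.mul_mem_right _ (hc i (Finset.mem_range.1 hi)))

theorem pow_card_mem {ι : Type*} [DecidableEq ι] {s : Finset ι} {v : ι → RR} {J : Ideal RR}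
    (h : ∀ i < s.card, ∑ a ∈ s, v a ^ (i + 1) ∈ J) {a : ι} (ha : a ∈ s) :
    v a ^ s.card ∈ J := by
  have h1 := pow_card_add_mem (fun i hi => h i (by omega)) ha
  have h2 : PowerSeries.coeff s.card (lin s v) ∈ J := by
    obtain ⟨N, hN⟩ : ∃ N, s.card = N + 1 :=
      Nat.exists_eq_succ_of_ne_zero (Finset.card_ne_zero_of_mem ha)
    rw [hN]
    exact coeff_mem_ideal_of_derivative ℂ (derivative_lin s v) J s.card (fun i hi => by
      rw [map_neg, psums, PowerSeries.coeff_mk]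
      exact J.neg_mem (h i hi)) N (by omega)
  exact (J.add_mem_iff_left h2).1 h1

theorem kap_special (i : ℕ) : kap 2 (1 / 2) i = 2 ^ (i + 1) := by
  have h : (2 : ℂ) ^ (i + 1) ≠ 1 := by
    have := Nat.one_lt_two_pow (Nat.succ_ne_zero i)
    exact_mod_cast this.ne'
  have h0 : (2 : ℂ) ^ (i + 1) ≠ 0 := pow_ne_zero _ two_ne_zero
  rw [kap, one_div, inv_pow]
  have h1 : 1 - ((2 : ℂ) ^ (i + 1))⁻¹ = (2 ^ (i + 1) - 1) / 2 ^ (i + 1) := by field_simp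
  rw [h1, div_div_eq_mul_div, mul_comm, mul_div_assoc, div_self (sub_ne_zero.2 h), mul_one]

theorem mem_of_C_mul_mem {J : Ideal RR} {c : ℂ} (hc : c ≠ 0) {f : RR} (h : C c * f ∈ J) : f ∈ J := by
  have := J.mul_mem_left (C c⁻¹) h
  rwa [← mul_assoc, ← C_mul, inv_mul_cancel₀ hc, C_1, one_mul] at this

theorem finQ_special (n m : ℕ) :
    FinQ (gr (Subalgebra.toSubmodule (W n m))) (P (kap 2 (1 / 2)) n m) (n + m) := by
  refine finQ_of_pow_mem (V_finite n m) (P_mem_hs _ n m) (P_mem_W _ le_rfl le_rfl) ?_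
  set J := Ideal.span (P (kap 2 (1 / 2)) n m '' Set.Iio (n + m))
  let s := (Finset.range n).disjSum (Finset.range m)
  let v : ℕ ⊕ ℕ → RR := Sum.elim (fun a => C 2 * yv a) zv
  have hvl : ∀ a, v (Sum.inl a) = C 2 * yv a := fun _ => rfl
  have hcard : s.card = n + m := by simp [s]
  have h : ∀ i < s.card, ∑ a ∈ s, v a ^ (i + 1) ∈ J := fun i hi => by
    rw [hcard] at hi
    refine Ideal.subset_span ⟨i, hi, ?_⟩
    rw [Finset.sum_disjSum, P, kap_special, py, pz, Finset.mul_sum]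
    simp only [v, Sum.elim_inl, Sum.elim_inr, mul_pow, C_pow]
  rintro (a | b) hv
  · refine ⟨n + m, mem_of_C_mul_mem (pow_ne_zero (n + m) (two_ne_zero (α := ℂ))) ?_⟩
    have := pow_card_mem h (a := Sum.inl a) (by simpa [s] using hv)
    rwa [hcard, hvl, mul_pow, ← C_pow] at this
  · have := pow_card_mem h (a := Sum.inr b) (by simpa [s] using hv)
    rw [hcard] at this
    exact ⟨n + m, this⟩

theorem finQx_special (n m : ℕ) : FinQ (gr (Subalgebra.toSubmodule (W (n + 1) m)))
    (Px (kap 2 (1 / 2)) n m) (n + m + 1) := by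
  refine finQ_of_pow_mem (V_finite (n + 1) m) (Px_mem_hs _ n m) (Px_mem_W _ n m) ?_
  set J := Ideal.span (Px (kap 2 (1 / 2)) n m '' Set.Iio (n + m + 1))
  let s := (Finset.range (n + 1)).disjSum (Finset.range (m + 1))
  let v : ℕ ⊕ ℕ → RR := Sum.elim (fun a => C 2 * yv a) fun b => if b = m then yv n else zv b
  have hvl : ∀ a, v (Sum.inl a) = C 2 * yv a := fun _ => rfl
  have hvr : ∀ b < m, v (Sum.inr b) = zv b := fun b hb => if_neg hb.ne
  have hcard : s.card = n + m + 2 := by simp [s]; omega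
  have h : ∀ i < s.card - 1, ∑ a ∈ s, v a ^ (i + 1) ∈ J := fun i hi => by
    rw [hcard] at hi
    refine Ideal.subset_span ⟨i, hi, ?_⟩
    have hz : ∑ b ∈ Finset.range m, v (Sum.inr b) ^ (i + 1) = pz m i :=
      Finset.sum_congr rfl fun b hb => by rw [hvr b (Finset.mem_range.1 hb)]
    rw [Finset.sum_disjSum, Finset.sum_range_succ, Finset.sum_range_succ _ m, hz, Px, P, kap_special,
      py, Finset.mul_sum]
    simp only [v, Sum.elim_inl, Sum.elim_inr, mul_pow, C_pow, C_add, C_1, if_true]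
    ring
  have hN : ∀ a ∈ s, v a ^ (n + m + 2) + PowerSeries.coeff (n + m + 2) (lin s v) ∈ J :=
    fun a ha => hcard ▸ pow_card_add_mem h ha
  have hdiff : ∀ a ∈ s, ∀ b ∈ s, v a ^ (n + m + 2) - v b ^ (n + m + 2) ∈ J := fun a ha b hb => by
    have := J.sub_mem (hN a ha) (hN b hb)
    rwa [add_sub_add_right_eq_sub] at this
  have hx : Sum.inr m ∈ s := by simp [s]
  have hvx : v (Sum.inr m) = yv n := by simp [v]
  have h2 : ((2 : ℂ) ^ (n + m + 2) - 1) ≠ 0 := by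
    have := Nat.one_lt_two_pow (Nat.succ_ne_zero (n + m + 1))
    exact sub_ne_zero.2 (by exact_mod_cast this.ne')
  have hyn : yv n ^ (n + m + 2) ∈ J := by
    refine mem_of_C_mul_mem h2 ?_
    have := hdiff (Sum.inl n) (by simp [s]) _ hx
    rw [hvx, hvl, mul_pow, ← C_pow] at this
    rwa [C_sub, C_1, sub_mul, one_mul]
  have hall : ∀ a ∈ s, v a ^ (n + m + 2) ∈ J := fun a ha => by
    have := J.add_mem (hdiff a ha _ hx) hyn
    rwa [hvx, sub_add_cancel] at this
  rintro (a | b) hv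
  · refine ⟨n + m + 2, mem_of_C_mul_mem (pow_ne_zero (n + m + 2) (two_ne_zero (α := ℂ))) ?_⟩
    have := hall (Sum.inl a) (by simpa [s] using hv)
    rwa [hvl, mul_pow, ← C_pow] at this
  · have hb : b < m := hv
    have := hall (Sum.inr b) (by simp [s]; omega)
    rw [hvr b hb] at this
    exact ⟨n + m + 2, this⟩

/-! ### Finiteness for generic parameters -/

theorem exists_family_idl {M : ℤ → Submodule ℂ RR} {p p' : ℂ → ℂ → ℕ → RR} {c : ℂ → ℂ → ℕ → ℂ}
    {T : ℂ → ℂ → Prop} (hp' : ∀ i, PF fun q t => p' q t i)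
    (h : ∀ q t, T q t → ∀ i, p' q t i = C (c q t i) * p q t i) {q₀ t₀ : ℂ} (hT : T q₀ t₀)
    (hc : ∀ i, c q₀ t₀ i ≠ 0) (k : ℕ) (d : ℤ) {f : RR} (hf : f ∈ idl M (p q₀ t₀) k d) :
    ∃ u, PF u ∧ u q₀ t₀ = f ∧ ∀ q t, T q t → u q t ∈ idl M (p q t) k d := by
  induction k generalizing f with
  | zero =>
    have : f = 0 := by simpa [idl] using hf
    exact ⟨_, PF.const f, rfl, fun q t _ => by rw [this]; exact zero_mem _⟩
  | succ k ih =>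
    obtain ⟨a, ha, w, hw, rfl⟩ := mem_idl_succ.1 hf
    obtain ⟨u, hu, rfl, hu'⟩ := ih ha
    refine ⟨_, hu.add ((hp' k).mul (PF.const (C (c q₀ t₀ k)⁻¹ * w))), ?_, fun q t hqt => ?_⟩
    · beta_reduce
      rw [h _ _ hT, mul_mul_mul_comm, ← C_mul, mul_inv_cancel₀ (hc k), C_1, one_mul]
    · refine mem_idl_succ.2 ⟨_, hu' q t hqt, C (c q t k * (c q₀ t₀ k)⁻¹) * w, ?_, ?_⟩
      · rw [C_mul']
        exact Submodule.smul_mem _ _ hw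
      · rw [h q t hqt, C_mul]
        ring

theorem gen_finQ {n m : ℕ} {p p' : ℂ → ℂ → ℕ → RR} {c : ℂ → ℂ → ℕ → ℂ} {T : ℂ → ℂ → Prop}
    (hp' : ∀ i, PF fun q t => p' q t i) (h : ∀ q t, T q t → ∀ i, p' q t i = C (c q t i) * p q t i)
    {q₀ t₀ : ℂ} (hT : T q₀ t₀) (hc : ∀ i, c q₀ t₀ i ≠ 0)
    (hp : ∀ q t (i : ℕ), p q t i ∈ hs ℂ (ℕ ⊕ ℕ) (i + 1)) (hpW : ∀ q t i, p q t i ∈ W n m) {k : ℕ}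
    (hfin : FinQ (gr (Subalgebra.toSubmodule (W n m))) (p q₀ t₀) k) :
    Gen fun q t => T q t → FinQ (gr (Subalgebra.toSubmodule (W n m))) (p q t) k := by
  obtain ⟨D, hD⟩ := hfin
  have hle : ∀ q t d, idl (gr (Subalgebra.toSubmodule (W n m))) (p q t) k d ≤
      gr (Subalgebra.toSubmodule (W n m)) d := fun q t d =>
    (stable_gr (hp q t) fun i v hv => Subalgebra.mul_mem _ (hpW q t i) hv).idl_le k d
  have : Gen fun q t => ∀ d : ℤ, T q t → D ≤ d → gr (Subalgebra.toSubmodule (W n m)) d ≤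
      idl (gr (Subalgebra.toSubmodule (W n m))) (p q t) k d := by
    refine Gen.all fun d => ?_
    by_cases hd : D ≤ d
    · have := gen_finrank_le (M₀ := gr (Subalgebra.toSubmodule (W n m)) d) (T := T)
        (M := fun q t => idl (gr (Subalgebra.toSubmodule (W n m))) (p q t) k d) q₀ t₀
        (fun f hf => exists_family_idl hp' h hT hc k d (hD d hd hf))
        (fun q t => Submodule.finiteDimensional_of_le (hle q t d))
      exact this.mono fun q t hqt hTq _ =>
        (Submodule.eq_of_le_of_finrank_le (hle q t d) (hqt hTq)).ge
    · exact Gen.of_forall fun q t _ h => absurd h hd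
  exact this.mono fun q t hqt hTq => ⟨D, fun d hd => hqt d hTq hd⟩

theorem nru_half : NRU (1 / 2) := fun i h => by
  have h2 : (2 : ℂ) ^ (i + 1) = 1 := by
    rw [one_div, inv_pow, inv_eq_one] at h
    exact h
  have := Nat.one_lt_two_pow (Nat.succ_ne_zero i)
  exact this.ne' (by exact_mod_cast h2)

theorem gen_finQ_P (n m : ℕ) : Gen fun q t => NRU t →
    FinQ (gr (Subalgebra.toSubmodule (W n m))) (P (kap q t) n m) (n + m) :=
  gen_finQ (p := fun q t => P (kap q t) n m) (c := fun _ t i => 1 - t ^ (i + 1))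
    (T := fun _ t => NRU t) (PF.num n m) (fun q _ h i => h.mul_P q n m i) nru_half nru_half.ne_zero
    (fun q t => P_mem_hs (kap q t) n m) (fun q t => P_mem_W (kap q t) le_rfl le_rfl)
    (finQ_special n m)

theorem NRU.mul_Px {t : ℂ} (h : NRU t) (q : ℂ) (n m i : ℕ) :
    (C (q ^ (i + 1)) - 1) * py n i + (1 - C (t ^ (i + 1))) * pz m i +
        (C (q ^ (i + 1)) - C (t ^ (i + 1))) * yv n ^ (i + 1) =
      C (1 - t ^ (i + 1)) * Px (kap q t) n m i := by
  rw [h.mul_P, Px, mul_add, ← mul_assoc, ← C_mul, mul_add, mul_comm _ (kap q t i), h.rel q i, mul_one,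
    ← C_sub, sub_add_sub_cancel]

theorem gen_finQ_Px (n m : ℕ) : Gen fun q t => NRU t →
    FinQ (gr (Subalgebra.toSubmodule (W (n + 1) m))) (Px (kap q t) n m) (n + m + 1) :=
  gen_finQ (p := fun q t => Px (kap q t) n m) (c := fun _ t i => 1 - t ^ (i + 1))
    (T := fun _ t => NRU t)
    (fun i => (PF.num n m i).add (((PF.fst_pow _).sub (PF.snd_pow _)).mul (PF.const _)))
    (fun q _ h i => h.mul_Px q n m i) nru_half nru_half.ne_zero
    (fun q t => Px_mem_hs (kap q t) n m) (fun q t => Px_mem_W (kap q t) n m)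
    (finQx_special n m)

/-! ### Generic parameters are good -/

theorem gen_fst_pow_ne_one (i : ℕ) : Gen fun q _ => q ^ (i + 1) ≠ 1 :=
  Gen.of_eval (p := X 0 ^ (i + 1) - 1) 0 0 (by simp) fun q t h h1 => h (by simp [h1])

theorem gen_snd_pow_ne_one (i : ℕ) : Gen fun _ t => t ^ (i + 1) ≠ 1 :=
  Gen.of_eval (p := X 1 ^ (i + 1) - 1) 0 0 (by simp) fun q t h h1 => h (by simp [h1])

theorem gen_good : Gen fun q t => NRU t ∧ Good (kap q t) q t := by
  have hq : Gen fun q _ => ∀ i : ℕ, q ^ (i + 1) ≠ 1 := Gen.all gen_fst_pow_ne_one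
  have ht : Gen fun _ t => NRU t := Gen.all gen_snd_pow_ne_one
  have hq0 : Gen fun q _ => q ≠ 0 :=
    Gen.of_eval (p := X 0) 1 1 (by simp) fun q t h h1 => h (by simp [h1])
  have ht0 : Gen fun _ t => t ≠ 0 :=
    Gen.of_eval (p := X 1) 1 1 (by simp) fun q t h h1 => h (by simp [h1])
  have hqt : Gen fun q t => q ≠ t :=
    Gen.of_eval (p := X 0 - X 1) 1 0 (by simp) fun q t h h1 => h (by simp [h1])
  have hQ : Gen fun q t => ∀ x : ℕ × ℕ, NRU t → _ := Gen.all fun x => gen_Q_eq x.1 x.2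
  have hF : Gen fun q t => ∀ x : ℕ × ℕ, NRU t → _ := Gen.all fun x => gen_finQ_P x.1 x.2
  have hFx : Gen fun q t => ∀ x : ℕ × ℕ, NRU t → _ := Gen.all fun x => gen_finQ_Px x.1 x.2
  refine (((hq.and ht).and (hq0.and ht0)).and (hqt.and (hQ.and (hF.and hFx)))).mono ?_
  rintro q t ⟨⟨⟨hq, ht⟩, hq0, ht0⟩, hqt, hQ, hF, hFx⟩
  refine ⟨ht, ?_⟩
  constructor
  · exact ht.rel q
  · exact fun i => div_ne_zero (sub_ne_zero.2 (hq i)) (ht.ne_zero i)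
  · intro n hn
    obtain ⟨k, rfl⟩ := Nat.exists_eq_add_of_le' hn
    exact hq k
  · exact hq0
  · exact ht0
  · exact hqt
  · exact fun n m => (hQ (n, m) ht).1
  · exact fun n m => (hQ (n, m) ht).2
  · exact fun n m => hF (n, m) ht
  · exact fun n m => hFx (n, m) ht

/-! ### Transport to the algebra `Aqt` -/

section

variable {K R R' : Type*} [Field K] [CommRing R] [Algebra K R] [CommRing R'] [Algebra K R']
  {M : ℤ → Submodule K R} {N : ℤ → Submodule K R'} {p : ℕ → R} {p' : ℕ → R'}

theorem mem_idl_of_map_mem (φ : R →ₗ[K] R') (hφ : Function.Injective φ)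
    (hNM : ∀ d, ∀ w ∈ N d, ∃ v ∈ M d, φ v = w)
    (hp : ∀ i d, ∀ v ∈ M d, φ (p i * v) = p' i * φ v) {j : ℕ} {d : ℤ} {v : R}
    (hv : φ v ∈ idl N p' j d) : v ∈ idl M p j d := by
  obtain ⟨u, hu, huv⟩ := idl_lift φ hNM hp _ _ _ hv
  rwa [hφ huv] at hu

theorem Reg.comap {k : ℕ} (φ : R →ₗ[K] R') (hφ : Function.Injective φ)
    (hMN : ∀ d, ∀ v ∈ M d, φ v ∈ N d) (hNM : ∀ d, ∀ w ∈ N d, ∃ v ∈ M d, φ v = w)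
    (hp : ∀ i d, ∀ v ∈ M d, φ (p i * v) = p' i * φ v) (hN : Reg N p' k) : Reg M p k :=
  fun j hj d v hv h => mem_idl_of_map_mem φ hφ hNM hp
    (hN j hj d _ (hMN d v hv) (hp j d v hv ▸ idl_map_zero φ hMN hp _ _ _ h))

theorem FinQ.comap {k : ℕ} (φ : R →ₗ[K] R') (hφ : Function.Injective φ)
    (hMN : ∀ d, ∀ v ∈ M d, φ v ∈ N d) (hNM : ∀ d, ∀ w ∈ N d, ∃ v ∈ M d, φ v = w)
    (hp : ∀ i d, ∀ v ∈ M d, φ (p i * v) = p' i * φ v) (hN : FinQ N p' k) : FinQ M p k := by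
  obtain ⟨d₀, h⟩ := hN
  exact ⟨d₀, fun d hd v hv => mem_idl_of_map_mem φ hφ hNM hp (h d hd (hMN d v hv))⟩

end

variable {r s : ℕ} {q t : ℂ}

/-- The embedding of the variables of `Rxrs r s`. -/
def emb (r s : ℕ) : Unit ⊕ Fin r ⊕ Fin s → ℕ ⊕ ℕ :=
  Sum.elim (fun _ => Sum.inl r) (Sum.elim (fun j => Sum.inl j) fun l => Sum.inr l)

theorem emb_injective (r s : ℕ) : Function.Injective (emb r s) := by
  rintro (_ | a | a) (_ | b | b) h
  · rfl
  · have := b.2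
    simp only [emb, Sum.elim_inl, Sum.elim_inr, Sum.inl.injEq] at h
    omega
  · simp [emb] at h
  · have := a.2
    simp only [emb, Sum.elim_inl, Sum.elim_inr, Sum.inl.injEq] at h
    omega
  · simpa [emb, Fin.ext_iff] using h
  · simp [emb] at h
  · simp [emb] at h
  · simp [emb] at h
  · simpa [emb, Fin.ext_iff] using h

/-- The embedding of `Rxrs r s` into the ambient polynomial ring. -/
def embHom (r s : ℕ) : Rxrs r s →ₐ[ℂ] RR := rename (emb r s)

theorem embHom_injective (r s : ℕ) : Function.Injective (embHom r s) :=
  rename_injective _ (emb_injective r s)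

theorem linHom_embHom (r s : ℕ) : LinHom (embHom r s) := fun v => by
  rw [embHom, rename_X]
  exact X_mem_hs _

theorem embHom_Pqt (h : NRU t) (i : ℕ) :
    embHom r s (Pqt r s q t (i + 1)) = Px (kap q t) r s i := by
  have hk : (q ^ (i + 1) - t ^ (i + 1)) / (1 - t ^ (i + 1)) = kap q t i + 1 := by
    rw [kap, div_add_one (h.ne_zero i), sub_add_sub_cancel]
  rw [Pqt, hk, Px, P, py, pz, Finset.sum_range, Finset.sum_range, kap]
  simp only [embHom, map_add, map_mul, map_sum, map_pow, rename_C, rename_X, emb, Sum.elim_inl,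
    Sum.elim_inr]
  ring

theorem Aqt_eq (r s : ℕ) (q t : ℂ) :
    Aqt r s q t = Algebra.adjoin ℂ (Set.range fun i => Pqt r s q t (i + 1)) := by
  rw [Aqt]
  congr 1
  ext f
  constructor
  · rintro ⟨i, hi, rfl⟩
    exact ⟨i - 1, by simp only [Nat.sub_add_cancel hi]⟩
  · rintro ⟨i, rfl⟩
    exact ⟨i + 1, Nat.le_add_left 1 i, rfl⟩

theorem BAqt_eq (r s : ℕ) (q t : ℂ) : BAqt r s q t =
    Algebra.adjoin ℂ ((fun i => Pqt r s q t (i + 1)) '' Set.Iio (r + s + 1)) := by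
  rw [BAqt]
  congr 1
  ext f
  constructor
  · rintro ⟨i, hi, hi', rfl⟩
    refine ⟨i - 1, ?_, by simp only [Nat.sub_add_cancel hi]⟩
    rw [Set.mem_Iio]
    omega
  · rintro ⟨i, hi, rfl⟩
    exact ⟨i + 1, Nat.le_add_left 1 i, hi, rfl⟩

theorem BAqt_le_Aqt (r s : ℕ) (q t : ℂ) : BAqt r s q t ≤ Aqt r s q t :=
  Algebra.adjoin_mono fun _ ⟨i, hi, _, hf⟩ => ⟨i, hi, hf⟩

theorem mem_AqtMod {f : Rxrs r s} : f ∈ AqtMod r s q t ↔ f ∈ Aqt r s q t := by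
  constructor
  · intro h
    induction h using Submodule.span_induction with
    | mem f hf => exact hf
    | zero => exact zero_mem _
    | add f g _ _ hf hg => exact add_mem hf hg
    | smul b f _ hf =>
      rw [Algebra.smul_def]
      exact mul_mem (BAqt_le_Aqt r s q t b.2) hf
  · exact fun h => Submodule.subset_span h

theorem map_embHom_Aqt (h : NRU t) : (Aqt r s q t).map (embHom r s) = AA (kap q t) r s := by
  rw [Aqt_eq, AlgHom.map_adjoin, ← Set.range_comp, AA]
  congr 2
  ext1 i
  exact embHom_Pqt h i

theorem Pqt_mem_Aqt (i : ℕ) : Pqt r s q t (i + 1) ∈ Aqt r s q t :=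
  Algebra.subset_adjoin ⟨i + 1, Nat.le_add_left 1 i, rfl⟩

theorem Pqt_mem_hs (i : ℕ) : Pqt r s q t (i + 1) ∈ hs ℂ (Unit ⊕ Fin r ⊕ Fin s) (i + 1) := by
  have hX : ∀ v : Unit ⊕ Fin r ⊕ Fin s,
      X v ^ (i + 1) ∈ hs ℂ (Unit ⊕ Fin r ⊕ Fin s) ((i : ℤ) + 1) := fun v => by
    simpa using Xpow_mem_hs (K := ℂ) v (i + 1)
  exact add_mem (add_mem (C_mul_mem_hs _ (hX _)) (C_mul_mem_hs _ (sum_mem fun j _ => hX _)))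
    (sum_mem fun l _ => hX _)

theorem grd_Aqt (r s : ℕ) (q t : ℂ) : Grd (Subalgebra.toSubmodule (Aqt r s q t)) := by
  rw [Aqt_eq]
  refine grd_adjoin ?_
  rintro _ ⟨i, rfl⟩
  exact ⟨_, Pqt_mem_hs i⟩

theorem embHom_mem_gr (h : NRU t) (d : ℤ) {f : Rxrs r s}
    (hf : f ∈ gr (Subalgebra.toSubmodule (Aqt r s q t)) d) :
    embHom r s f ∈ gr (Subalgebra.toSubmodule (AA (kap q t) r s)) d := by
  refine ⟨?_, (linHom_embHom r s).mem_hs hf.2⟩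
  rw [← map_embHom_Aqt h]
  exact ⟨f, hf.1, rfl⟩

theorem exists_embHom_eq (h : NRU t) (d : ℤ) {g : RR}
    (hg : g ∈ gr (Subalgebra.toSubmodule (AA (kap q t) r s)) d) :
    ∃ f ∈ gr (Subalgebra.toSubmodule (Aqt r s q t)) d, embHom r s f = g := by
  obtain ⟨hg, hd⟩ := hg
  rw [← map_embHom_Aqt h] at hg
  obtain ⟨f, hf, rfl⟩ := hg
  refine ⟨comp d f, (grd_Aqt r s q t).comp_mem hf, ?_⟩
  rw [← (linHom_embHom r s).comp]
  exact comp_of_mem hd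

theorem hilbX_Aqt (h : NRU t) : hilbX r s (Subalgebra.toSubmodule (Aqt r s q t)) =
    hilb (Subalgebra.toSubmodule (AA (kap q t) r s)) := by
  ext d
  rw [hilbX, hilb, PowerSeries.coeff_mk, PowerSeries.coeff_mk, Nat.cast_inj]
  have he : compX r s (Subalgebra.toSubmodule (Aqt r s q t)) d =
      gr (Subalgebra.toSubmodule (Aqt r s q t)) d := by
    ext f
    exact and_congr_right fun _ => mem_hs_iff_natCast.symm
  have hm : gr (Subalgebra.toSubmodule (AA (kap q t) r s)) (d : ℤ) =
      (gr (Subalgebra.toSubmodule (Aqt r s q t)) d).map (embHom r s).toLinearMap := by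
    ext g
    constructor
    · exact exists_embHom_eq h d
    · rintro ⟨f, hf, rfl⟩
      exact embHom_mem_gr h d hf
  rw [he, hm]
  exact (Submodule.equivMapOfInjective _ (embHom_injective r s) _).finrank_eq

theorem Good.finite_free_Aqt (h : NRU t) (hg : Good (kap q t) q t) :
    Module.Finite (BAqt r s q t) (AqtMod r s q t) ∧ Module.Free (BAqt r s q t) (AqtMod r s q t) := by
  have hp : ∀ (i : ℕ) (d : ℤ), ∀ v ∈ gr (Subalgebra.toSubmodule (Aqt r s q t)) d,
      (embHom r s).toLinearMap (Pqt r s q t (i + 1) * v) =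
        Px (kap q t) r s i * (embHom r s).toLinearMap v := fun i d v _ => by
    rw [AlgHom.toLinearMap_apply, map_mul, embHom_Pqt h]
    rfl
  have hfd : ∀ d, FiniteDimensional ℂ (gr (Subalgebra.toSubmodule (Aqt r s q t)) d) := fun d =>
    finiteDimensional_gr_of_le (s := Set.univ) Set.finite_univ (by
      rw [supported_univ]
      exact le_top) d
  exact finite_free_of_reg (Subalgebra.toSubmodule (Aqt r s q t)) (grd_Aqt r s q t)
    (p := fun i => Pqt r s q t (i + 1)) Pqt_mem_hs
    (fun i v hv => Subalgebra.mul_mem _ (Pqt_mem_Aqt i) hv) (N := r + s + 1)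
    (FinQ.comap (embHom r s).toLinearMap (embHom_injective r s) (fun d _ => embHom_mem_gr h d)
      (fun d _ => exists_embHom_eq h d) hp (hg.finQx_of_le (AA_le_W _ r s)
        (fun i _ hv => Subalgebra.mul_mem _ (Px_mem_AA _ r s i) hv) (grd_AA _ r s)))
    (Reg.comap (embHom r s).toLinearMap (embHom_injective r s) (fun d _ => embHom_mem_gr h d)
      (fun d _ => exists_embHom_eq h d) hp (hg.reg_AA r s))
    (BAqt r s q t) (BAqt_eq r s q t) (AqtMod r s q t) fun _ => mem_AqtMod

end AqtCM

/-- For `r, s ≥ 1` and Weil generic `(q,t)` — i.e. for all `(q,t)` outside a countable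
union of proper Zariski-closed subsets of `ℂ²` (in particular `q, t` not roots of unity
and `q ≠ t`) — the algebra `A_{r,s,q,t}` is Cohen–Macaulay (a free module of finite rank
over `ℂ[P_1,...,P_{r+s+1}]`), with Hilbert series
`h_{r+1,s+1}(u) − u^{2(r+1)(s+1)}/((u;u)_{r+1}(u;u)_{s+1})`, i.e.
`H(u)·(u;u)_{r+1}·(u;u)_{s+1} = Σ_{i=0}^{s+1} u^{i(r+2)} Π_{k=i+1}^{s+1}(1-u^k) − u^{2(r+1)(s+1)}`. -/
theorem Aqt_CM_weil_generic (r s : ℕ) (hr : 1 ≤ r) (hs : 1 ≤ s) :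
    ∃ Z : ℕ → Set (ℂ × ℂ),
      (∀ n : ℕ, ∃ p : MvPolynomial (Fin 2) ℂ, p ≠ 0 ∧
        Z n = {x : ℂ × ℂ | eval ![x.1, x.2] p = 0}) ∧
      ∀ q t : ℂ, (q, t) ∉ ⋃ n, Z n →
        (∀ n : ℕ, 1 ≤ n → q ^ n ≠ 1) ∧ (∀ n : ℕ, 1 ≤ n → t ^ n ≠ 1) ∧ q ≠ t ∧
        Module.Finite ↥(BAqt r s q t) ↥(AqtMod r s q t) ∧
        Module.Free ↥(BAqt r s q t) ↥(AqtMod r s q t) ∧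
        hilbX r s (Subalgebra.toSubmodule (Aqt r s q t)) * (uu (r + 1) * uu (s + 1)) =
          (∑ i ∈ Finset.range (s + 2), PowerSeries.X ^ (i * (r + 2)) *
            ∏ k ∈ Finset.Ico i (s + 1), (1 - PowerSeries.X ^ (k + 1))) -
            PowerSeries.X ^ (2 * (r + 1) * (s + 1)) := by
  obtain ⟨Z, hZ, h⟩ := AqtCM.gen_good
  refine ⟨fun n => {x | eval ![x.1, x.2] (Z n) = 0}, fun n => ⟨Z n, hZ n, rfl⟩, fun q t hqt => ?_⟩
  obtain ⟨ht, hg⟩ := h q t fun k hk => hqt (Set.mem_iUnion.2 ⟨k, hk⟩)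
  obtain ⟨hfin, hfree⟩ := hg.finite_free_Aqt (r := r) (s := s) ht
  refine ⟨hg.q_pow, fun n hn => ?_, hg.ne, hfin, hfree, ?_⟩
  · obtain ⟨k, rfl⟩ := Nat.exists_eq_add_of_le' hn
    exact ht k
  · rw [AqtCM.hilbX_Aqt ht]
    exact hg.hilb_AA r s
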